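/- arXiv:1910.01912 — 4 statements merged into one kernel-verified Lean document; each statement's English description precedes it below -/
import Mathlib

section
/- Let ψ : ℝ² → ℂ be smooth and supported in the annulus {ξ : 1/4 ≤ ‖ξ‖ ≤ 2}. For every integer L ≥ 0 there is a constant C_L = C(ψ, L) such that for every k ∈ ℤ, every x ∈ ℝ², every real a ≤ 0, and every m among the three functions ξ ↦ ‖ξ‖, ξ ↦ ξ₁, ξ ↦ ξ₂, one has |∫_{ℝ²} e^{i x·ξ} e^{a‖ξ‖} m(ξ) ψ(2^{−k}ξ) dξ| ≤ C_L · 2^{3k} · (1 + 2^k‖x‖ + 2^k|a|)^{−L}. -/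
open MeasureTheory Complex
open scoped RealInnerProductSpace

/-- Smooth functions supported in the annulus `1/4 ≤ ‖ξ‖ ≤ 2`. -/
structure IsAnnularBump {E : Type*} [NormedAddCommGroup E] [NormedSpace ℝ E] (φ : E → ℂ) :
    Prop where
  contDiff : ContDiff ℝ (⊤ : ℕ∞) φ
  tsupport_subset : tsupport φ ⊆ {ξ : E | 1 / 4 ≤ ‖ξ‖ ∧ ‖ξ‖ ≤ 2}

/-- The kernel `∫ e^{i⟪x, ξ⟫} e^{a‖ξ‖} φ(ξ) dξ`. -/
noncomputable def halfSpaceKernel {E : Type*} [NormedAddCommGroup E] [InnerProductSpace ℝ E]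
    [MeasurableSpace E] [BorelSpace E] [FiniteDimensional ℝ E] (φ : E → ℂ) (x : E) (a : ℝ) : ℂ :=
  ∫ ξ : E, Complex.exp (Complex.I * ((⟪x, ξ⟫ : ℝ) : ℂ)) *
    (Complex.exp (((a * ‖ξ‖ : ℝ) : ℂ)) * φ ξ)

section AnnularBump

variable {E : Type*} [NormedAddCommGroup E] [InnerProductSpace ℝ E] {φ : E → ℂ}

lemma IsAnnularBump.zero_notMem (hφ : IsAnnularBump φ) : (0 : E) ∉ tsupport φ := by
  intro h
  have := (hφ.tsupport_subset h).1
  norm_num at this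

lemma IsAnnularBump.hasCompactSupport [FiniteDimensional ℝ E] (hφ : IsAnnularBump φ) :
    HasCompactSupport φ := by
  refine (isCompact_closedBall (0 : E) 2).of_isClosed_subset (isClosed_tsupport φ) fun ξ hξ => ?_
  simpa using (hφ.tsupport_subset hξ).2

/-- Multiplication by a function smooth away from the origin preserves annular bumps. -/
lemma IsAnnularBump.mul (hφ : IsAnnularBump φ) {g : E → ℂ}
    (hg : ∀ ξ, ξ ≠ 0 → ContDiffAt ℝ (⊤ : ℕ∞) g ξ) : IsAnnularBump fun ξ => g ξ * φ ξ := by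
  refine ⟨contDiff_iff_contDiffAt.2 fun ξ => ?_,
    (tsupport_mul_subset_right (f := g) (g := φ)).trans hφ.tsupport_subset⟩
  by_cases hξ : ξ = 0
  · subst hξ
    have h := notMem_tsupport_iff_eventuallyEq.1 hφ.zero_notMem
    refine (contDiffAt_const (c := (0 : ℂ))).congr_of_eventuallyEq ?_
    filter_upwards [h] with η hη
    simp [hη]
  · exact (hg ξ hξ).mul hφ.contDiff.contDiffAt

lemma IsAnnularBump.fderiv_apply (hφ : IsAnnularBump φ) (v : E) :
    IsAnnularBump fun ξ => fderiv ℝ φ ξ v :=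
  ⟨(hφ.contDiff.fderiv_right (m := (⊤ : ℕ∞)) (by simp)).clm_apply contDiff_const,
    (tsupport_fderiv_apply_subset ℝ v).trans hφ.tsupport_subset⟩

lemma contDiffAt_ofReal_comp {g : E → ℝ} {ξ : E} (hg : ContDiffAt ℝ (⊤ : ℕ∞) g ξ) :
    ContDiffAt ℝ (⊤ : ℕ∞) (fun η => (g η : ℂ)) ξ :=
  Complex.ofRealCLM.contDiff.contDiffAt.comp ξ hg

lemma contDiffAt_fderiv_norm_apply {ξ : E} (hξ : ξ ≠ 0) (v : E) :
    ContDiffAt ℝ (⊤ : ℕ∞) (fun η : E => fderiv ℝ (fun ζ : E => ‖ζ‖) η v) ξ :=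
  ((contDiffAt_norm ℝ (n := (⊤ : ℕ∞)) hξ).fderiv_right (m := (⊤ : ℕ∞)) (by simp)).clm_apply
    contDiffAt_const

lemma IsAnnularBump.fderiv_norm_mul (hφ : IsAnnularBump φ) (v : E) :
    IsAnnularBump fun ξ => ((fderiv ℝ (fun ζ : E => ‖ζ‖) ξ v : ℝ) : ℂ) * φ ξ :=
  hφ.mul fun _ hξ => contDiffAt_ofReal_comp (contDiffAt_fderiv_norm_apply hξ v)

lemma IsAnnularBump.exp_mul (hφ : IsAnnularBump φ) (a : ℝ) :
    IsAnnularBump fun ξ => Complex.exp (((a * ‖ξ‖ : ℝ) : ℂ)) * φ ξ :=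
  hφ.mul fun _ hξ =>
    (contDiffAt_ofReal_comp (contDiffAt_const.mul (contDiffAt_norm ℝ hξ))).cexp

lemma fderiv_exp_inner (x ξ v : E) :
    fderiv ℝ (fun η : E => Complex.exp (Complex.I * ((⟪x, η⟫ : ℝ) : ℂ))) ξ v =
      Complex.I * ((⟪x, v⟫ : ℝ) : ℂ) * Complex.exp (Complex.I * ((⟪x, ξ⟫ : ℝ) : ℂ)) := by
  have h1 : HasFDerivAt (fun η : E => ((⟪x, η⟫ : ℝ) : ℂ)) (Complex.ofRealCLM.comp (innerSL ℝ x)) ξ :=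
    (Complex.ofRealCLM.comp (innerSL ℝ x)).hasFDerivAt
  rw [((h1.const_mul Complex.I).cexp).fderiv]
  simp
  ring

lemma IsAnnularBump.fderiv_exp_mul (hφ : IsAnnularBump φ) (a : ℝ) (ξ v : E) :
    fderiv ℝ (fun η => Complex.exp (((a * ‖η‖ : ℝ) : ℂ)) * φ η) ξ v =
      a * (Complex.exp (((a * ‖ξ‖ : ℝ) : ℂ)) *
        (((fderiv ℝ (fun ζ : E => ‖ζ‖) ξ v : ℝ) : ℂ) * φ ξ)) +
      Complex.exp (((a * ‖ξ‖ : ℝ) : ℂ)) * fderiv ℝ φ ξ v := by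
  by_cases hξ : ξ = 0
  · subst hξ
    have h0 := image_eq_zero_of_notMem_tsupport hφ.zero_notMem
    have h1 := image_eq_zero_of_notMem_tsupport (hφ.fderiv_apply v).zero_notMem
    have h2 := image_eq_zero_of_notMem_tsupport ((hφ.exp_mul a).fderiv_apply v).zero_notMem
    rw [h0, h1, h2]
    simp
  · have hn : HasFDerivAt (fun ζ : E => ‖ζ‖) (fderiv ℝ (fun ζ : E => ‖ζ‖) ξ) ξ :=
      ((contDiffAt_norm ℝ (n := 1) hξ).differentiableAt (by simp)).hasFDerivAt
    have hp : HasFDerivAt φ (fderiv ℝ φ ξ) ξ :=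
      (hφ.contDiff.differentiable (by simp) ξ).hasFDerivAt
    have he : HasFDerivAt (fun η : E => ((a * ‖η‖ : ℝ) : ℂ))
        (Complex.ofRealCLM.comp (a • fderiv ℝ (fun ζ : E => ‖ζ‖) ξ)) ξ :=
      Complex.ofRealCLM.hasFDerivAt.comp ξ (hn.const_mul a)
    rw [HasFDerivAt.fderiv (f := fun η => Complex.exp (((a * ‖η‖ : ℝ) : ℂ)) * φ η)
      (he.cexp.mul hp)]
    simp
    ring

lemma contDiff_exp_inner (x : E) :
    ContDiff ℝ (⊤ : ℕ∞) fun ξ : E => Complex.exp (Complex.I * ((⟪x, ξ⟫ : ℝ) : ℂ)) :=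
  (contDiff_const.mul (Complex.ofRealCLM.comp (innerSL ℝ x)).contDiff).cexp

variable [MeasurableSpace E] [BorelSpace E] [FiniteDimensional ℝ E]

lemma IsAnnularBump.integrable_mul (hφ : IsAnnularBump φ) {g : E → ℂ} (hg : Continuous g) :
    Integrable fun ξ => g ξ * φ ξ :=
  (hg.mul hφ.contDiff.continuous).integrable_of_hasCompactSupport hφ.hasCompactSupport.mul_left

/-- Integration by parts in the direction `v`. -/
lemma IsAnnularBump.inner_mul_halfSpaceKernel (hφ : IsAnnularBump φ) (x v : E) (a : ℝ) :
    Complex.I * ((⟪x, v⟫ : ℝ) : ℂ) * halfSpaceKernel φ x a =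
      -(a * halfSpaceKernel (fun ξ => ((fderiv ℝ (fun ζ : E => ‖ζ‖) ξ v : ℝ) : ℂ) * φ ξ) x a +
        halfSpaceKernel (fun ξ => fderiv ℝ φ ξ v) x a) := by
  have hF := hφ.exp_mul a
  have hc := (contDiff_exp_inner x).continuous
  have hparts := integral_mul_fderiv_eq_neg_fderiv_mul_of_integrable (𝕜 := ℂ) (μ := volume) (v := v)
    (f := fun η : E => Complex.exp (Complex.I * ((⟪x, η⟫ : ℝ) : ℂ)))
    (g := fun ξ => Complex.exp (((a * ‖ξ‖ : ℝ) : ℂ)) * φ ξ)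
    (by simp only [fderiv_exp_inner]; exact hF.integrable_mul (continuous_const.mul hc))
    ((hF.fderiv_apply v).integrable_mul hc) (hF.integrable_mul hc)
    (fun ξ _ => (contDiff_exp_inner x).differentiable (by simp) ξ)
    (fun ξ _ => hF.contDiff.differentiable (by simp) ξ)
  simp only [fderiv_exp_inner, hφ.fderiv_exp_mul] at hparts
  unfold halfSpaceKernel
  rw [← integral_const_mul, ← integral_const_mul, ← integral_add, eq_neg_iff_add_eq_zero,
    add_comm, ← eq_neg_iff_add_eq_zero]
  · convert hparts using 1
    · congr 1; ext ξ; ring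
    · congr 2; ext ξ; ring
  · exact (((hφ.fderiv_norm_mul v).exp_mul a).integrable_mul hc).const_mul _
  · exact ((hφ.fderiv_apply v).exp_mul a).integrable_mul hc

lemma one_add_abs_pow_mul_exp_le (N : ℕ) {a r : ℝ} (ha : a ≤ 0) (hr : 1 / 4 ≤ r) :
    (1 + |a|) ^ N * Real.exp (a * r) ≤ 4 ^ N * N.factorial * Real.exp (1 / 4) := by
  have h := Real.pow_div_factorial_le_exp ((1 + |a|) / 4) (by positivity) N
  rw [div_le_iff₀ (by positivity), div_pow, div_le_iff₀ (by positivity)] at h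
  have h2 : Real.exp (a * r) ≤ Real.exp (-|a| / 4) := by
    rw [Real.exp_le_exp, abs_of_nonpos ha]
    nlinarith
  calc (1 + |a|) ^ N * Real.exp (a * r)
      ≤ (Real.exp ((1 + |a|) / 4) * N.factorial * 4 ^ N) * Real.exp (-|a| / 4) := by gcongr
    _ = 4 ^ N * N.factorial * (Real.exp ((1 + |a|) / 4) * Real.exp (-|a| / 4)) := by ring
    _ = _ := by rw [← Real.exp_add]; congr 2; ring

/-- Rapid decay in `a`, uniformly in `x`. -/
lemma IsAnnularBump.exists_pow_mul_norm_halfSpaceKernel_le (hφ : IsAnnularBump φ) (N : ℕ) :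
    ∃ C : ℝ, 0 ≤ C ∧ ∀ (x : E) (a : ℝ), a ≤ 0 → (1 + |a|) ^ N * ‖halfSpaceKernel φ x a‖ ≤ C := by
  refine ⟨4 ^ N * N.factorial * Real.exp (1 / 4) * ∫ ξ, ‖φ ξ‖,
    mul_nonneg (by positivity) (integral_nonneg fun _ => norm_nonneg _), fun x a ha => ?_⟩
  have hint : Integrable φ := hφ.contDiff.continuous.integrable_of_hasCompactSupport
    hφ.hasCompactSupport
  have hint' := (hφ.exp_mul a).integrable_mul (contDiff_exp_inner x).continuous
  calc (1 + |a|) ^ N * ‖halfSpaceKernel φ x a‖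
      ≤ (1 + |a|) ^ N * ∫ ξ, ‖Complex.exp (Complex.I * ((⟪x, ξ⟫ : ℝ) : ℂ)) *
          (Complex.exp (((a * ‖ξ‖ : ℝ) : ℂ)) * φ ξ)‖ := by
        gcongr
        exact norm_integral_le_integral_norm _
    _ = ∫ ξ, (1 + |a|) ^ N * ‖Complex.exp (Complex.I * ((⟪x, ξ⟫ : ℝ) : ℂ)) *
          (Complex.exp (((a * ‖ξ‖ : ℝ) : ℂ)) * φ ξ)‖ := by rw [integral_const_mul]
    _ ≤ ∫ ξ, 4 ^ N * N.factorial * Real.exp (1 / 4) * ‖φ ξ‖ := by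
        refine integral_mono (hint'.norm.const_mul _) (hint.norm.const_mul _) fun ξ => ?_
        simp only [norm_mul, mul_comm Complex.I, Complex.norm_exp_ofReal_mul_I, one_mul,
          Complex.norm_exp_ofReal]
        by_cases hξ : φ ξ = 0
        · simp [hξ]
        · rw [← mul_assoc]
          exact mul_le_mul_of_nonneg_right (one_add_abs_pow_mul_exp_le N ha
            (hφ.tsupport_subset (subset_tsupport φ hξ)).1) (norm_nonneg _)
    _ = _ := by rw [integral_const_mul]

lemma IsAnnularBump.abs_inner_mul_norm_halfSpaceKernel_le (hφ : IsAnnularBump φ) (x v : E) (a : ℝ) :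
    |⟪x, v⟫| * ‖halfSpaceKernel φ x a‖ ≤
      (1 + |a|) * ‖halfSpaceKernel (fun ξ => ((fderiv ℝ (fun ζ : E => ‖ζ‖) ξ v : ℝ) : ℂ) * φ ξ) x a‖ +
        ‖halfSpaceKernel (fun ξ => fderiv ℝ φ ξ v) x a‖ := by
  have h := congrArg norm (hφ.inner_mul_halfSpaceKernel x v a)
  rw [norm_neg, norm_mul, norm_mul, Complex.norm_I, one_mul, Complex.norm_real,
    Real.norm_eq_abs] at h
  rw [h]
  refine (norm_add_le _ _).trans ?_
  rw [norm_mul, Complex.norm_real, Real.norm_eq_abs]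
  gcongr
  linarith

end AnnularBump

lemma norm_le_abs_inner_add_abs_inner (x : EuclideanSpace ℝ (Fin 2)) :
    ‖x‖ ≤ |⟪x, EuclideanSpace.single 0 (1 : ℝ)⟫| + |⟪x, EuclideanSpace.single 1 (1 : ℝ)⟫| := by
  rw [EuclideanSpace.norm_eq, Real.sqrt_le_left (by positivity)]
  simp [Fin.sum_univ_two, EuclideanSpace.inner_single_right]
  nlinarith [sq_abs (x 0), sq_abs (x 1), abs_nonneg (x 0), abs_nonneg (x 1),
    mul_nonneg (abs_nonneg (x 0)) (abs_nonneg (x 1))]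

/-- Rapid decay in `x` and `a`. -/
lemma IsAnnularBump.exists_pow_mul_pow_mul_norm_halfSpaceKernel_le (n : ℕ) :
    ∀ {φ : EuclideanSpace ℝ (Fin 2) → ℂ}, IsAnnularBump φ → ∀ N : ℕ, ∃ C : ℝ, 0 ≤ C ∧
      ∀ (x : EuclideanSpace ℝ (Fin 2)) (a : ℝ), a ≤ 0 →
        (1 + ‖x‖) ^ n * (1 + |a|) ^ N * ‖halfSpaceKernel φ x a‖ ≤ C := by
  induction n with
  | zero =>
    intro φ hφ N
    simpa using hφ.exists_pow_mul_norm_halfSpaceKernel_le N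
  | succ n ih =>
    intro φ hφ N
    obtain ⟨C, hC, h⟩ := ih hφ N
    have hdir (v : EuclideanSpace ℝ (Fin 2)) : ∃ D : ℝ, 0 ≤ D ∧
        ∀ (x : EuclideanSpace ℝ (Fin 2)) (a : ℝ), a ≤ 0 →
          (1 + ‖x‖) ^ n * (1 + |a|) ^ N * (|⟪x, v⟫| * ‖halfSpaceKernel φ x a‖) ≤ D := by
      obtain ⟨C₁, hC₁, h₁⟩ := ih (hφ.fderiv_norm_mul v) (N + 1)
      obtain ⟨C₂, hC₂, h₂⟩ := ih (hφ.fderiv_apply v) N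
      refine ⟨C₁ + C₂, by positivity, fun x a ha => ?_⟩
      have hw : 0 ≤ (1 + ‖x‖) ^ n * (1 + |a|) ^ N := by positivity
      have := mul_le_mul_of_nonneg_left (hφ.abs_inner_mul_norm_halfSpaceKernel_le x v a) hw
      refine this.trans (le_trans (le_of_eq ?_) (add_le_add (h₁ x a ha) (h₂ x a ha)))
      ring
    obtain ⟨D₀, hD₀, h₀⟩ := hdir (EuclideanSpace.single 0 1)
    obtain ⟨D₁, hD₁, h₁⟩ := hdir (EuclideanSpace.single 1 1)
    refine ⟨C + (D₀ + D₁), by positivity, fun x a ha => ?_⟩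
    have hw : 0 ≤ (1 + ‖x‖) ^ n * (1 + |a|) ^ N * ‖halfSpaceKernel φ x a‖ := by positivity
    have := mul_le_mul_of_nonneg_left (norm_le_abs_inner_add_abs_inner x) hw
    have h' := h x a ha
    have h₀' := h₀ x a ha
    have h₁' := h₁ x a ha
    rw [pow_succ]
    nlinarith

/-- The bound at frequency scale one. -/
lemma IsAnnularBump.exists_norm_halfSpaceKernel_le {φ : EuclideanSpace ℝ (Fin 2) → ℂ}
    (hφ : IsAnnularBump φ) (L : ℕ) : ∃ C : ℝ, 0 ≤ C ∧
      ∀ (x : EuclideanSpace ℝ (Fin 2)) (a : ℝ), a ≤ 0 →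
        ‖halfSpaceKernel φ x a‖ ≤ C * (1 + ‖x‖ + |a|) ^ (-(L : ℤ)) := by
  obtain ⟨C, hC, h⟩ := IsAnnularBump.exists_pow_mul_pow_mul_norm_halfSpaceKernel_le L hφ L
  refine ⟨C, hC, fun x a ha => ?_⟩
  rw [zpow_neg, zpow_natCast, ← div_eq_mul_inv, le_div_iff₀ (by positivity)]
  refine le_trans ?_ (h x a ha)
  rw [← mul_pow, mul_comm]
  gcongr
  nlinarith [norm_nonneg x, abs_nonneg a, mul_nonneg (norm_nonneg x) (abs_nonneg a)]

lemma integral_eq_scaled_halfSpaceKernel (ψ : EuclideanSpace ℝ (Fin 2) → ℂ)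
    {m : EuclideanSpace ℝ (Fin 2) → ℝ} (hm : ∀ (r : ℝ), 0 < r → ∀ ξ, m (r • ξ) = r * m ξ)
    {r : ℝ} (hr : 0 < r) (x : EuclideanSpace ℝ (Fin 2)) (a : ℝ) :
    ∫ ξ : EuclideanSpace ℝ (Fin 2), Complex.exp (Complex.I * ((⟪x, ξ⟫ : ℝ) : ℂ)) *
        Complex.exp (((a * ‖ξ‖ : ℝ) : ℂ)) * ((m ξ : ℝ) : ℂ) * ψ (r⁻¹ • ξ) =
      (r : ℂ) ^ 3 * halfSpaceKernel (fun ξ => ((m ξ : ℝ) : ℂ) * ψ ξ) (r • x) (r * a) := by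
  have h := Measure.integral_comp_smul (volume : Measure (EuclideanSpace ℝ (Fin 2)))
    (fun ξ => Complex.exp (Complex.I * ((⟪x, ξ⟫ : ℝ) : ℂ)) *
        Complex.exp (((a * ‖ξ‖ : ℝ) : ℂ)) * ((m ξ : ℝ) : ℂ) * ψ (r⁻¹ • ξ)) r
  rw [finrank_euclideanSpace_fin, abs_of_pos (by positivity), eq_inv_smul_iff₀ (by positivity)] at h
  rw [← h, halfSpaceKernel, ← integral_const_mul, ← integral_smul]
  congr 1
  ext ξ
  rw [hm r hr, inv_smul_smul₀ hr.ne', norm_smul, Real.norm_of_nonneg hr.le, inner_smul_left,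
    inner_smul_right, Complex.real_smul]
  simp only [conj_trivial, mul_left_comm a r, mul_assoc]
  push_cast
  ring

/-- Pointwise kernel bounds for the frequency-localized convolution kernels of the
operators `e^{a|∇|} ∘ D`, `D` a first-order multiplier (`‖ξ‖`, `ξ₁` or `ξ₂`), appearing in
the fixed-point solution formula for the Dirichlet problem below the free surface
(Lemma `K-bound` of the paper). -/
theorem stmt8 (ψ : EuclideanSpace ℝ (Fin 2) → ℂ) (hψ : ContDiff ℝ (⊤ : ℕ∞) ψ)
    (hsupp : tsupport ψ ⊆ {ξ : EuclideanSpace ℝ (Fin 2) | 1 / 4 ≤ ‖ξ‖ ∧ ‖ξ‖ ≤ 2})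
    (L : ℕ) :
    ∃ C : ℝ, 0 < C ∧
      ∀ (k : ℤ) (x : EuclideanSpace ℝ (Fin 2)) (a : ℝ), a ≤ 0 →
      ∀ m : EuclideanSpace ℝ (Fin 2) → ℝ,
        (m = fun ξ => ‖ξ‖) ∨ (m = fun ξ => ξ 0) ∨ (m = fun ξ => ξ 1) →
        ‖∫ ξ : EuclideanSpace ℝ (Fin 2),
            Complex.exp (Complex.I * ((⟪x, ξ⟫ : ℝ) : ℂ)) *
              Complex.exp (((a * ‖ξ‖ : ℝ) : ℂ)) * ((m ξ : ℝ) : ℂ) * ψ ((2 : ℝ) ^ (-k) • ξ)‖ ≤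
          C * (2 : ℝ) ^ (3 * k) * (1 + (2 : ℝ) ^ k * ‖x‖ + (2 : ℝ) ^ k * |a|) ^ (-(L : ℤ)) := by
  have hψ' : IsAnnularBump ψ := ⟨hψ, hsupp⟩
  have hcoord (i : Fin 2) : IsAnnularBump fun ξ : EuclideanSpace ℝ (Fin 2) => ((ξ i : ℝ) : ℂ) * ψ ξ :=
    hψ'.mul fun ξ _ => contDiffAt_ofReal_comp (by fun_prop)
  have hnorm : IsAnnularBump fun ξ : EuclideanSpace ℝ (Fin 2) => ((‖ξ‖ : ℝ) : ℂ) * ψ ξ :=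
    hψ'.mul fun ξ hξ => contDiffAt_ofReal_comp (contDiffAt_norm ℝ hξ)
  obtain ⟨C₀, hC₀, h₀⟩ := hnorm.exists_norm_halfSpaceKernel_le L
  obtain ⟨C₁, hC₁, h₁⟩ := (hcoord 0).exists_norm_halfSpaceKernel_le L
  obtain ⟨C₂, hC₂, h₂⟩ := (hcoord 1).exists_norm_halfSpaceKernel_le L
  refine ⟨C₀ + C₁ + C₂ + 1, by positivity, fun k x a ha m hm => ?_⟩
  have hr : (0 : ℝ) < 2 ^ k := by positivity
  have hra : (2 : ℝ) ^ k * a ≤ 0 := mul_nonpos_of_nonneg_of_nonpos hr.le ha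
  have hhom : ∀ (r : ℝ), 0 < r → ∀ ξ, m (r • ξ) = r * m ξ := by
    intro r hr ξ
    rcases hm with rfl | rfl | rfl <;> simp [norm_smul, abs_of_pos hr]
  have hker : ‖halfSpaceKernel (fun ξ => ((m ξ : ℝ) : ℂ) * ψ ξ) ((2 : ℝ) ^ k • x) (2 ^ k * a)‖ ≤
      (C₀ + C₁ + C₂ + 1) * (1 + ‖(2 : ℝ) ^ k • x‖ + |2 ^ k * a|) ^ (-(L : ℤ)) := by
    rcases hm with rfl | rfl | rfl
    · refine (h₀ _ _ hra).trans ?_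
      gcongr
      linarith
    · refine (h₁ _ _ hra).trans ?_
      gcongr
      linarith
    · refine (h₂ _ _ hra).trans ?_
      gcongr
      linarith
  rw [norm_smul, Real.norm_of_nonneg hr.le, abs_mul, abs_of_pos hr] at hker
  rw [zpow_neg, integral_eq_scaled_halfSpaceKernel ψ hhom hr, norm_mul, norm_pow, Complex.norm_real,
    Real.norm_of_nonneg hr.le, mul_comm 3 k, zpow_mul, mul_comm (C₀ + C₁ + C₂ + 1), mul_assoc]
  exact mul_le_mul_of_nonneg_left hker (by positivity)
end

section
/- Let χ̃ : ℝ² → [0,1] be smooth, supported in {x : ‖x‖ > 1}, and equal to 1 on {x : ‖x‖ ≥ 2}. For an integer n ≥ 1 let Γ̃_n(x) = χ̃(x)·‖x‖^{−(2n+1)}, and for Schwartz functions h, ρ : ℝ² → ℝ and an integer j with 0 ≤ j ≤ 2n define K_{n,j} ρ = ∇( h^j · (Γ̃_n ⋆ (ρ · h^{2n−j})) ), where ⋆ is convolution on ℝ². Then for every α ∈ (0,1) and every integer k with 0 ≤ k ≤ 8 there is a constant B = B(χ̃, α, k) such that for every integer n ≥ 1, every 0 ≤ j ≤ 2n, and all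 Schwartz h, ρ: ‖(1+‖x‖)^α ∇^k K_{n,j} ρ‖_{L²(ℝ²)} ≤ B^n · ‖h‖_{L^∞}^{2n−1} · ‖h‖_{W^{k+1,∞}} · ‖(1+‖x‖)^α ρ‖_{L²(ℝ²)}. -/
open MeasureTheory
open scoped ENNReal

noncomputable section

/-- The Sobolev norm `‖u‖_{W^{m,s}} = Σ_{j=0}^{m} ‖∇ʲu‖_{L^s(ℝ²)}` (valued in `ℝ≥0∞`). -/
def sobNorm {F : Type*} [NormedAddCommGroup F] [NormedSpace ℝ F]
    (m : ℕ) (s : ℝ≥0∞) (u : EuclideanSpace ℝ (Fin 2) → F) : ℝ≥0∞ :=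
  ∑ j ∈ Finset.range (m + 1), eLpNorm (iteratedFDeriv ℝ j u) s volume

section Leibniz

variable {V : Type*} [NormedAddCommGroup V] [NormedSpace ℝ V]

/-- Leibniz rule for uniform (weighted) bounds on the derivatives up to order `m` at a point. -/
theorem pow_mul_norm_iteratedFDeriv_mul_le {s : Set V} (hs : IsOpen s) {f g : V → ℝ}
    (hf : ContDiffOn ℝ (⊤ : ℕ∞) f s) (hg : ContDiffOn ℝ (⊤ : ℕ∞) g s) {x : V} (hx : x ∈ s)
    {lam A B : ℝ} (hlam : 0 ≤ lam) {m : ℕ}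
    (hA : ∀ i ≤ m, lam ^ i * ‖iteratedFDeriv ℝ i f x‖ ≤ A)
    (hB : ∀ i ≤ m, lam ^ i * ‖iteratedFDeriv ℝ i g x‖ ≤ B) :
    ∀ i ≤ m, lam ^ i * ‖iteratedFDeriv ℝ i (fun y => f y * g y) x‖ ≤ 2 ^ m * A * B := by
  intro i hi
  have hA0 : 0 ≤ A := le_trans (by positivity) (hA 0 (Nat.zero_le _))
  have hB0 : 0 ≤ B := le_trans (by positivity) (hB 0 (Nat.zero_le _))
  have key := norm_iteratedFDerivWithin_mul_le hf hg hs.uniqueDiffOn hx (n := i)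
    (by exact_mod_cast le_top)
  simp only [iteratedFDerivWithin_of_isOpen _ hs hx] at key
  calc lam ^ i * ‖iteratedFDeriv ℝ i (fun y => f y * g y) x‖
      ≤ lam ^ i * ∑ l ∈ Finset.range (i + 1), (i.choose l : ℝ) * ‖iteratedFDeriv ℝ l f x‖ *
          ‖iteratedFDeriv ℝ (i - l) g x‖ := by gcongr
    _ = ∑ l ∈ Finset.range (i + 1), (i.choose l : ℝ) * ((lam ^ l * ‖iteratedFDeriv ℝ l f x‖) *
          (lam ^ (i - l) * ‖iteratedFDeriv ℝ (i - l) g x‖)) := by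
        rw [Finset.mul_sum]
        refine Finset.sum_congr rfl fun l hl => ?_
        have hli : l ≤ i := Nat.lt_succ_iff.mp (Finset.mem_range.mp hl)
        rw [← Nat.add_sub_cancel' hli, pow_add, Nat.add_sub_cancel' hli]
        ring
    _ ≤ ∑ l ∈ Finset.range (i + 1), (i.choose l : ℝ) * (A * B) := by
        refine Finset.sum_le_sum fun l hl => ?_
        have hli : l ≤ i := Nat.lt_succ_iff.mp (Finset.mem_range.mp hl)
        have h1 := hA l (hli.trans hi)
        have h2 := hB (i - l) ((Nat.sub_le _ _).trans hi)
        gcongr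
    _ = 2 ^ i * (A * B) := by
        rw [← Finset.sum_mul]
        congr 1
        exact_mod_cast Nat.sum_range_choose i
    _ ≤ 2 ^ m * (A * B) := by
        gcongr
        norm_num
    _ = 2 ^ m * A * B := by ring

theorem pow_mul_norm_iteratedFDeriv_one_le {lam : ℝ} (m : ℕ) (x : V) :
    ∀ i ≤ m, lam ^ i * ‖iteratedFDeriv ℝ i (fun _ : V => (1 : ℝ)) x‖ ≤ 1 := by
  intro i _
  rcases Nat.eq_zero_or_pos i with rfl | hi
  · simp
  · rw [iteratedFDeriv_const_of_ne hi.ne']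
    simp

theorem pow_mul_norm_iteratedFDeriv_pow_le {s : Set V} (hs : IsOpen s) {f : V → ℝ}
    (hf : ContDiffOn ℝ (⊤ : ℕ∞) f s) {x : V} (hx : x ∈ s)
    {lam A : ℝ} (hlam : 0 ≤ lam) {m : ℕ}
    (hA : ∀ i ≤ m, lam ^ i * ‖iteratedFDeriv ℝ i f x‖ ≤ A) (N : ℕ) :
    ∀ i ≤ m, lam ^ i * ‖iteratedFDeriv ℝ i (fun y => f y ^ N) x‖ ≤ (2 ^ m * A) ^ N := by
  induction N with
  | zero => simpa using pow_mul_norm_iteratedFDeriv_one_le m x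
  | succ N ih =>
    have := pow_mul_norm_iteratedFDeriv_mul_le hs hf (hf.pow N) hx hlam hA ih
    intro i hi
    simpa only [pow_succ'] using this i hi

end Leibniz

section Interpolation

variable {V F : Type*} [NormedAddCommGroup V] [NormedSpace ℝ V] [NormedAddCommGroup F]
  [NormedSpace ℝ F]

/-- Landau's inequality: the supremum of the first derivative is controlled by the geometric mean
of those of the function and of its second derivative. -/
theorem norm_fderiv_sq_le_of_lipschitz {u : V → F} (hu : Differentiable ℝ u) {A C : ℝ}
    (hA : ∀ x, ‖u x‖ ≤ A) (hC0 : 0 ≤ C)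
    (hC : ∀ x y, ‖fderiv ℝ u y - fderiv ℝ u x‖ ≤ C * ‖y - x‖) (x : V) :
    ‖fderiv ℝ u x‖ ^ 2 ≤ 8 * A * C := by
  have hA0 : 0 ≤ A := (norm_nonneg _).trans (hA x)
  have h1 : ∀ v, ‖fderiv ℝ u x v‖ ≤ 2 * A + C * ‖v‖ ^ 2 := by
    intro v
    have := (convex_closedBall x ‖v‖).norm_image_sub_le_of_norm_fderiv_le' (f := u)
      (φ := fderiv ℝ u x) (C := C * ‖v‖) (x := x) (y := x + v)
      (fun y _ => hu y) (fun y hy => (hC x y).trans (by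
        have : ‖y - x‖ ≤ ‖v‖ := by simpa [dist_eq_norm] using hy
        gcongr)) (by simp) (by simp)
    simp only [add_sub_cancel_left] at this
    have h2 : fderiv ℝ u x v = u (x + v) - u x - (u (x + v) - u x - fderiv ℝ u x v) := by abel
    rw [h2]
    calc _ ≤ ‖u (x + v)‖ + ‖u x‖ + ‖u (x + v) - u x - fderiv ℝ u x v‖ :=
          (norm_sub_le _ _).trans (by gcongr; exact norm_sub_le _ _)
      _ ≤ A + A + C * ‖v‖ * ‖v‖ := by gcongr <;> apply hA
      _ = _ := by ring
  have h3 : ∀ t : ℝ, 0 < t → ‖fderiv ℝ u x‖ * t ≤ 2 * A + C * t ^ 2 := by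
    intro t ht
    rw [← le_div_iff₀ ht]
    refine ContinuousLinearMap.opNorm_le_bound _ (by positivity) fun v => ?_
    rcases eq_or_ne v 0 with rfl | hv
    · simp
    have hv' : 0 < ‖v‖ := norm_pos_iff.mpr hv
    have := h1 ((t / ‖v‖) • v)
    rw [map_smul, norm_smul, norm_smul, Real.norm_of_nonneg (by positivity),
      div_mul_cancel₀ _ hv'.ne'] at this
    calc ‖fderiv ℝ u x v‖ = (t / ‖v‖ * ‖fderiv ℝ u x v‖) * (‖v‖ / t) := by field_simp
      _ ≤ (2 * A + C * t ^ 2) * (‖v‖ / t) := by gcongr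
      _ = _ := by ring
  have h4 : ∀ t : ℝ, 0 ≤ C * (t * t) + (-‖fderiv ℝ u x‖) * t + 2 * A := by
    intro t
    rcases le_or_gt t 0 with ht | ht
    · have h5 : 0 ≤ ‖fderiv ℝ u x‖ * (-t) := mul_nonneg (norm_nonneg _) (by linarith)
      have h6 : 0 ≤ C * (t * t) := mul_nonneg hC0 (mul_self_nonneg t)
      linarith
    · have := h3 t ht
      nlinarith
  have := discrim_le_zero h4
  rw [discrim] at this
  nlinarith

theorem norm_sq_le_of_fderiv_eq {G : Type*} [NormedAddCommGroup G] [NormedSpace ℝ G] {u : V → F}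
    (hu : Differentiable ℝ u) {g : V → G} (L : G ≃ₗᵢ[ℝ] (V →L[ℝ] F))
    (hg : ∀ x, fderiv ℝ u x = L (g x)) {A C : ℝ} (hA : ∀ x, ‖u x‖ ≤ A) (hC0 : 0 ≤ C)
    (hC : ∀ x y, ‖g y - g x‖ ≤ C * ‖y - x‖) (x : V) : ‖g x‖ ^ 2 ≤ 8 * A * C := by
  rw [← L.norm_map, ← hg]
  refine norm_fderiv_sq_le_of_lipschitz hu hA hC0 (fun y z => ?_) x
  rw [hg, hg, ← map_sub, L.norm_map]
  exact hC y z

theorem norm_iteratedFDeriv_sq_le {u : V → F} (hu : ContDiff ℝ (⊤ : ℕ∞) u) {i : ℕ} {A C : ℝ}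
    (hA : ∀ x, ‖iteratedFDeriv ℝ i u x‖ ≤ A) (hC : ∀ x, ‖iteratedFDeriv ℝ (i + 2) u x‖ ≤ C)
    (x : V) : ‖iteratedFDeriv ℝ (i + 1) u x‖ ^ 2 ≤ 8 * A * C := by
  have hd : ∀ l, Differentiable ℝ (iteratedFDeriv ℝ l u) := fun l =>
    hu.differentiable_iteratedFDeriv (by exact_mod_cast WithTop.coe_lt_top l)
  refine norm_sq_le_of_fderiv_eq (hd i)
    (continuousMultilinearCurryLeftEquiv ℝ (fun _ : Fin (i + 1) => V) F) (fun _ => rfl) hA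
    ((norm_nonneg _).trans (hC x)) ?_ x
  intro y z
  exact convex_univ.norm_image_sub_le_of_norm_fderiv_le (fun w _ => hd (i + 1) w)
    (fun w _ => by rw [norm_fderiv_iteratedFDeriv]; exact hC w) (Set.mem_univ _) (Set.mem_univ _)

/-- A nonnegative finite log-convex sequence is bounded by its end values. -/
theorem le_of_sq_le_mul_of_endpoints {b : ℕ → ℝ} (hb : ∀ i, 0 ≤ b i) {m : ℕ} {M : ℝ}
    (hlog : ∀ i, i + 2 ≤ m → b (i + 1) ^ 2 ≤ b i * b (i + 2)) (h0 : b 0 ≤ M) (hm : b m ≤ M) :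
    ∀ i ≤ m, b i ≤ M := by
  by_contra! hcon
  obtain ⟨i₀, hi₀, hlt⟩ := hcon
  have hM : 0 ≤ M := (hb 0).trans h0
  obtain ⟨p, hp, hpmax⟩ := Finset.exists_max_image (Finset.range (m + 1)) b ⟨0, by simp⟩
  have hex : ∃ q, q ≤ m ∧ b q = b p := ⟨p, by simpa [Nat.lt_succ_iff] using hp, rfl⟩
  classical
  have hq := Nat.find_spec hex
  have hqmin := fun l (hl : l < Nat.find hex) => Nat.find_min hex hl
  set q := Nat.find hex
  have hle : ∀ l ≤ m, b l ≤ b p := fun l hl => hpmax l (by simpa [Nat.lt_succ_iff] using hl)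
  have hpM : M < b p := hlt.trans_le (hle i₀ hi₀)
  have hq0 : q ≠ 0 := by
    intro h
    have := hq.2
    rw [h] at this
    linarith
  have hqm : q ≠ m := by
    intro h
    have := hq.2
    rw [h] at this
    linarith
  obtain ⟨r, hr⟩ := Nat.exists_eq_succ_of_ne_zero hq0
  have hr' : q = r + 1 := hr
  have h1 := hlog r (by omega)
  rw [← hr', hq.2] at h1
  have h2 : b r < b p := lt_of_le_of_ne (hle r (by omega)) fun h => hqmin r (by omega)
    ⟨by omega, h⟩
  have h3 := hle (r + 2) (by omega)
  have h4 := hb (r + 2)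
  nlinarith [hb r]

/-- Interpolation for a sequence which is log-convex up to a factor `8`. -/
theorem pow_mul_le_of_sq_le {a : ℕ → ℝ} (ha : ∀ i, 0 ≤ a i) {m : ℕ}
    (hlog : ∀ i, a (i + 1) ^ 2 ≤ 8 * a i * a (i + 2)) {H lam : ℝ} (hlam : 0 ≤ lam)
    (h0 : a 0 ≤ H) (hm : lam ^ m * a m ≤ H) :
    ∀ i ≤ m, lam ^ i * a i ≤ 3 ^ (m ^ 2) * H := by
  intro i hi
  have h3 : ∀ l : ℕ, (1 : ℝ) ≤ 3 ^ (l ^ 2) := fun l => one_le_pow₀ (by norm_num)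
  have := le_of_sq_le_mul_of_endpoints (b := fun l => 3 ^ (l ^ 2) * (lam ^ l * a l)) (m := m)
    (M := 3 ^ (m ^ 2) * H) (fun l => mul_nonneg (by positivity) (mul_nonneg (by positivity) (ha l)))
    (fun l _ => by
      have e1 : (3 : ℝ) ^ ((l + 1) ^ 2) * 3 ^ ((l + 1) ^ 2) * 9 = 3 ^ (l ^ 2) * 3 ^ ((l + 2) ^ 2) := by
        rw [show (9 : ℝ) = 3 ^ 2 by norm_num, ← pow_add, ← pow_add, ← pow_add]
        congr 1
        ring
      have h8 : 8 * a l * a (l + 2) ≤ 9 * a l * a (l + 2) := by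
        have := mul_nonneg (ha l) (ha (l + 2))
        linarith
      calc (3 ^ ((l + 1) ^ 2) * (lam ^ (l + 1) * a (l + 1))) ^ 2
          = 3 ^ ((l + 1) ^ 2) * 3 ^ ((l + 1) ^ 2) * (lam ^ l * lam ^ (l + 2)) * a (l + 1) ^ 2 := by
            ring
        _ ≤ 3 ^ ((l + 1) ^ 2) * 3 ^ ((l + 1) ^ 2) * (lam ^ l * lam ^ (l + 2)) *
              (9 * a l * a (l + 2)) := by
            gcongr
            exact (hlog l).trans h8
        _ = (3 ^ ((l + 1) ^ 2) * 3 ^ ((l + 1) ^ 2) * 9) * (lam ^ l * lam ^ (l + 2)) *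
              (a l * a (l + 2)) := by ring
        _ = _ := by rw [e1]; ring)
    (by
      have := mul_le_mul (h3 m) h0 (ha 0) (by positivity)
      simpa using this)
    (by gcongr) i hi
  calc lam ^ i * a i = 1 * (lam ^ i * a i) := (one_mul _).symm
    _ ≤ 3 ^ (i ^ 2) * (lam ^ i * a i) := by
      have := mul_nonneg (pow_nonneg hlam i) (ha i)
      gcongr
      exact h3 i
    _ ≤ _ := this

/-- Moser-type estimate for powers: all but one factor are measured in the supremum norm. -/
theorem norm_iteratedFDeriv_pow_le {h : V → ℝ} (hh : ContDiff ℝ (⊤ : ℕ∞) h) {a : ℕ → ℝ}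
    (ha : ∀ i x, ‖iteratedFDeriv ℝ i h x‖ ≤ a i)
    (hlog : ∀ i, a (i + 1) ^ 2 ≤ 8 * a i * a (i + 2)) {m : ℕ} (hm : m ≠ 0) {W : ℝ}
    (h0 : 0 < a 0) (h0W : a 0 ≤ W) (hmW : a m ≤ W) (j : ℕ) (x : V) :
    ∀ i ≤ m, a 0 * ‖iteratedFDeriv ℝ i (fun y => h y ^ j) x‖ ≤
      (2 ^ m * 3 ^ (m ^ 2) * a 0) ^ j * W := by
  intro i hi
  have hW : 0 < W := h0.trans_le h0W
  have ha0 : ∀ i, 0 ≤ a i := fun i => (norm_nonneg _).trans (ha i x)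
  set lam : ℝ := (a 0 / W) ^ ((m : ℝ)⁻¹) with hlamdef
  have hlam : 0 < lam := by positivity
  have hlam1 : lam ≤ 1 := Real.rpow_le_one (by positivity) ((div_le_one hW).mpr h0W) (by positivity)
  have hlamm : lam ^ m = a 0 / W := Real.rpow_inv_natCast_pow (by positivity) hm
  have key := pow_mul_le_of_sq_le ha0 hlog (m := m) hlam.le le_rfl (by
    rw [hlamm, div_mul_eq_mul_div, div_le_iff₀ hW]
    gcongr)
  have key2 := pow_mul_norm_iteratedFDeriv_pow_le isOpen_univ hh.contDiffOn (Set.mem_univ x)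
    hlam.le (m := m) (fun l hl => le_trans (by gcongr; exact ha l x) (key l hl)) j i hi
  have h5 : a 0 / W ≤ lam ^ i := by
    rw [← hlamm]
    exact pow_le_pow_of_le_one hlam.le hlam1 hi
  rw [← div_le_iff₀ hW]
  calc _ = a 0 / W * ‖iteratedFDeriv ℝ i (fun y => h y ^ j) x‖ := by ring
    _ ≤ lam ^ i * ‖iteratedFDeriv ℝ i (fun y => h y ^ j) x‖ := by gcongr
    _ ≤ _ := by simpa only [mul_assoc] using key2

end Interpolation

section Kernel

theorem iteratedFDeriv_norm_inv_smul {V : Type*} [NormedAddCommGroup V] [NormedSpace ℝ V]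
    {c : ℝ} (hc : 0 < c) (i : ℕ) :
    ∀ x : V, iteratedFDeriv ℝ i (fun y : V => ‖y‖⁻¹) (c • x) =
      (c ^ (i + 1))⁻¹ • iteratedFDeriv ℝ i (fun y : V => ‖y‖⁻¹) x := by
  induction i with
  | zero =>
    intro x
    ext v
    simp [norm_smul, abs_of_pos hc, mul_comm]
  | succ i ih =>
    intro x
    have h1 : (fun z => iteratedFDeriv ℝ i (fun y : V => ‖y‖⁻¹) (c • z)) =
        (c ^ (i + 1))⁻¹ • iteratedFDeriv ℝ i (fun y : V => ‖y‖⁻¹) := funext ih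
    have h2 : c • fderiv ℝ (iteratedFDeriv ℝ i (fun y : V => ‖y‖⁻¹)) (c • x) =
        (c ^ (i + 1))⁻¹ • fderiv ℝ (iteratedFDeriv ℝ i (fun y : V => ‖y‖⁻¹)) x := by
      rw [← fderiv_comp_smul, h1]
      exact congrFun (fderiv_const_smul_field (𝕜 := ℝ)
        (f := iteratedFDeriv ℝ i (fun y : V => ‖y‖⁻¹)) (c ^ (i + 1))⁻¹) x
    have h3 : fderiv ℝ (iteratedFDeriv ℝ i (fun y : V => ‖y‖⁻¹)) (c • x) =
        (c ^ (i + 2))⁻¹ • fderiv ℝ (iteratedFDeriv ℝ i (fun y : V => ‖y‖⁻¹)) x := by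
      rw [← inv_smul_smul₀ hc.ne' (fderiv ℝ _ (c • x)), h2, smul_smul]
      congr 1
      rw [← mul_inv, ← pow_succ']
    ext v
    simp only [iteratedFDeriv_succ_apply_left, h3, smul_apply]

variable {V : Type*} [NormedAddCommGroup V] [InnerProductSpace ℝ V]

theorem contDiffOn_norm_inv : ContDiffOn ℝ (⊤ : ℕ∞) (fun y : V => ‖y‖⁻¹) {x | x ≠ 0} := fun _ hx =>
  ((contDiffAt_norm ℝ hx).inv (norm_ne_zero_iff.mpr hx)).contDiffWithinAt

variable [FiniteDimensional ℝ V]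

theorem exists_norm_iteratedFDeriv_norm_inv_le (i : ℕ) :
    ∃ A : ℝ, 0 ≤ A ∧ ∀ x : V, 1 ≤ ‖x‖ → ‖iteratedFDeriv ℝ i (fun y : V => ‖y‖⁻¹) x‖ ≤ A * ‖x‖⁻¹ := by
  have ho : IsOpen {x : V | x ≠ 0} := isOpen_ne
  have hcont : ContinuousOn (iteratedFDeriv ℝ i (fun y : V => ‖y‖⁻¹)) (Metric.sphere 0 1) := by
    have h1 := (contDiffOn_norm_inv (V := V)).continuousOn_iteratedFDerivWithin (m := i)
      (by exact_mod_cast le_top) ho.uniqueDiffOn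
    refine (h1.congr fun x hx => (iteratedFDerivWithin_of_isOpen i ho hx).symm).mono ?_
    intro x hx h0
    simp [h0] at hx
  obtain ⟨A, hA⟩ := (isCompact_sphere (0 : V) 1).exists_bound_of_continuousOn hcont
  refine ⟨max A 0, le_max_right _ _, fun x hx => ?_⟩
  have hx0 : 0 < ‖x‖ := by linarith
  have h2 : x = ‖x‖ • (‖x‖⁻¹ • x) := by rw [smul_smul, mul_inv_cancel₀ hx0.ne', one_smul]
  have h3 : ‖iteratedFDeriv ℝ i (fun y : V => ‖y‖⁻¹) (‖x‖⁻¹ • x)‖ ≤ max A 0 :=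
    (hA _ (by simp [norm_smul, hx0.ne'])).trans (le_max_left _ _)
  rw [h2, iteratedFDeriv_norm_inv_smul hx0, ← h2, norm_smul, Real.norm_of_nonneg (by positivity),
    mul_comm]
  gcongr
  exact le_self_pow₀ hx (by omega)

theorem exists_norm_iteratedFDeriv_cutoff_le {χ : V → ℝ} (hχ : ContDiff ℝ (⊤ : ℕ∞) χ) {R : ℝ}
    (hχ1 : ∀ x, R ≤ ‖x‖ → χ x = 1) (i : ℕ) :
    ∃ A : ℝ, 0 ≤ A ∧ ∀ x, ‖iteratedFDeriv ℝ i χ x‖ ≤ A := by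
  have hc : HasCompactSupport (fun x => χ x - 1) :=
    HasCompactSupport.intro (isCompact_closedBall (0 : V) R) fun x hx => by
      rw [hχ1 x (by simpa using (not_le.mp (by simpa using hx)).le), sub_self]
  have hs : ContDiff ℝ (⊤ : ℕ∞) (fun x => χ x - 1) := hχ.sub contDiff_const
  obtain ⟨A, hA⟩ := (hc.iteratedFDeriv (𝕜 := ℝ) i).exists_bound_of_continuous
    (hs.continuous_iteratedFDeriv (m := i) (by exact_mod_cast le_top))
  have hA0 : 0 ≤ A := (norm_nonneg _).trans (hA 0)
  refine ⟨A + 1, by positivity, fun x => ?_⟩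
  have h1 : χ = (fun x => χ x - 1) + fun _ => 1 := by ext; simp
  rw [h1, iteratedFDeriv_add_apply (hs.contDiffAt.of_le (by exact_mod_cast le_top))
    contDiff_const.contDiffAt]
  refine (norm_add_le _ _).trans (add_le_add (hA x) ?_)
  simpa using pow_mul_norm_iteratedFDeriv_one_le (lam := 1) i x i le_rfl

/-- The truncated kernel is smooth. -/
theorem contDiff_kernel {V : Type*} [NormedAddCommGroup V] [InnerProductSpace ℝ V] {χ : V → ℝ}
    (hχ : ContDiff ℝ (⊤ : ℕ∞) χ) (hχ0 : ∀ x, ‖x‖ ≤ 1 → χ x = 0)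
    (N : ℕ) : ContDiff ℝ (⊤ : ℕ∞) (fun x => χ x * ‖x‖⁻¹ ^ N) := by
  rw [contDiff_iff_contDiffAt]
  intro x
  rcases eq_or_ne x 0 with rfl | hx
  · refine (contDiffAt_const (c := (0 : ℝ))).congr_of_eventuallyEq ?_
    filter_upwards [Metric.ball_mem_nhds (0 : V) one_pos] with y hy
    rw [hχ0 y (by simpa using (Metric.mem_ball.mp hy).le), zero_mul]
  · exact hχ.contDiffAt.mul (((contDiffAt_norm ℝ hx).inv (norm_ne_zero_iff.mpr hx)).pow N)

theorem exists_norm_iteratedFDeriv_kernel_le {χ : V → ℝ} (hχ : ContDiff ℝ (⊤ : ℕ∞) χ)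
    (hχ0 : ∀ x, ‖x‖ ≤ 1 → χ x = 0) {R : ℝ} (hχ1 : ∀ x, R ≤ ‖x‖ → χ x = 1) (m : ℕ) :
    ∃ D : ℝ, 1 ≤ D ∧ ∀ n : ℕ, 1 ≤ n → ∀ i ≤ m, ∀ x : V,
      ‖iteratedFDeriv ℝ i (fun x => χ x * ‖x‖⁻¹ ^ (2 * n + 1)) x‖ ≤
        D ^ n * ((1 + ‖x‖) ^ 3)⁻¹ := by
  choose A hA0 hA using exists_norm_iteratedFDeriv_norm_inv_le (V := V)
  choose C hC0 hC using exists_norm_iteratedFDeriv_cutoff_le hχ hχ1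
  set A' := ∑ i ∈ Finset.range (m + 1), A i
  set C' := ∑ i ∈ Finset.range (m + 1), C i
  have hA' : ∀ i ≤ m, A i ≤ A' := fun i hi =>
    Finset.single_le_sum (fun l _ => hA0 l) (Finset.mem_range.mpr (Nat.lt_succ_of_le hi))
  have hC' : ∀ i ≤ m, C i ≤ C' := fun i hi =>
    Finset.single_le_sum (fun l _ => hC0 l) (Finset.mem_range.mpr (Nat.lt_succ_of_le hi))
  have hA'0 : 0 ≤ A' := (hA0 0).trans (hA' 0 (Nat.zero_le _))
  have hC'0 : 0 ≤ C' := (hC0 0).trans (hC' 0 (Nat.zero_le _))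
  set E : ℝ := 2 ^ m * (C' + 1)
  set G : ℝ := 2 ^ m * (A' + 1)
  have h2m : (1 : ℝ) ≤ 2 ^ m := one_le_pow₀ (by norm_num)
  have hE : 1 ≤ E := one_le_mul_of_one_le_of_one_le h2m (by linarith)
  have hG : 1 ≤ G := one_le_mul_of_one_le_of_one_le h2m (by linarith)
  refine ⟨8 * E * G ^ 3, ?_, fun n hn i hi x => ?_⟩
  · have := one_le_pow₀ hG (n := 3)
    have := one_le_mul_of_one_le_of_one_le hE this
    nlinarith
  rcases lt_or_ge ‖x‖ 1 with hx | hx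
  · have h0 : (fun x => χ x * ‖x‖⁻¹ ^ (2 * n + 1)) =ᶠ[nhds x] fun _ => 0 := by
      filter_upwards [Metric.isOpen_ball.mem_nhds (show x ∈ Metric.ball (0 : V) 1 by simpa using hx)]
        with y hy
      rw [hχ0 y (by simpa using (Metric.mem_ball.mp hy).le), zero_mul]
    rw [(h0.iteratedFDeriv ℝ i).eq_of_nhds]
    simp only [iteratedFDeriv_fun_zero, Pi.zero_apply, norm_zero]
    positivity
  · have hx0 : 0 < ‖x‖ := by linarith
    have ho : IsOpen {x : V | x ≠ 0} := isOpen_ne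
    have hxm : x ∈ {x : V | x ≠ 0} := norm_pos_iff.mp hx0
    have hpow := pow_mul_norm_iteratedFDeriv_pow_le ho contDiffOn_norm_inv hxm (lam := 1)
      zero_le_one (m := m) (A := A' * ‖x‖⁻¹)
      (fun l hl => by
        rw [one_pow, one_mul]
        refine (hA l x hx).trans ?_
        gcongr
        exact hA' l hl) (2 * n + 1)
    have hmul := pow_mul_norm_iteratedFDeriv_mul_le ho hχ.contDiffOn
      (contDiffOn_norm_inv.pow (2 * n + 1)) hxm zero_le_one (m := m) (A := C')
      (fun l hl => by
        rw [one_pow, one_mul]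
        exact (hC l x).trans (hC' l hl)) hpow i hi
    rw [one_pow, one_mul] at hmul
    refine hmul.trans ?_
    calc 2 ^ m * C' * (2 ^ m * (A' * ‖x‖⁻¹)) ^ (2 * n + 1)
        = 2 ^ m * C' * ((2 ^ m * A') ^ (2 * n + 1) * ‖x‖⁻¹ ^ (2 * n + 1)) := by
          rw [← mul_assoc (2 ^ m) A', mul_pow]
      _ ≤ E * (G ^ (2 * n + 1) * (8 * ((1 + ‖x‖) ^ 3)⁻¹)) := by
          have h8 : ‖x‖⁻¹ ^ (2 * n + 1) ≤ 8 * ((1 + ‖x‖) ^ 3)⁻¹ := by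
            calc ‖x‖⁻¹ ^ (2 * n + 1) ≤ ‖x‖⁻¹ ^ 3 :=
                  pow_le_pow_of_le_one (by positivity) (inv_le_one_of_one_le₀ hx) (by omega)
              _ = 8 * ((2 * ‖x‖) ^ 3)⁻¹ := by
                  field_simp
                  norm_num
              _ ≤ 8 * ((1 + ‖x‖) ^ 3)⁻¹ := by
                  gcongr
                  linarith
          have hE' : 2 ^ m * C' ≤ E := by
            simp only [E]
            gcongr
            linarith
          have hG' : 2 ^ m * A' ≤ G := by
            simp only [G]
            gcongr
            linarith
          gcongr
      _ = (8 * E * G ^ (2 * n + 1)) * ((1 + ‖x‖) ^ 3)⁻¹ := by ring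
      _ ≤ (8 * E * G ^ 3) ^ n * ((1 + ‖x‖) ^ 3)⁻¹ := by
          rw [mul_pow (8 * E) (G ^ 3), ← pow_mul]
          have h1 : 8 * E ≤ (8 * E) ^ n := le_self_pow₀ (by linarith) (by omega)
          have h2 : G ^ (2 * n + 1) ≤ G ^ (3 * n) := pow_le_pow_right₀ hG (by omega)
          exact mul_le_mul_of_nonneg_right (mul_le_mul h1 h2 (by positivity) (by positivity))
            (by positivity)

end Kernel

section Convolution

variable {V : Type} [NormedAddCommGroup V] [InnerProductSpace ℝ V] [FiniteDimensional ℝ V]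
  [MeasurableSpace V] [BorelSpace V] {μ : Measure V}

theorem aestronglyMeasurable_smul_comp_sub {F : Type*} [NormedAddCommGroup F] [NormedSpace ℝ F]
    {f : V → ℝ} (hf : AEStronglyMeasurable f μ) {g : V → F} (hg : Continuous g) (x : V) :
    AEStronglyMeasurable (fun y => f y • g (x - y)) μ :=
  hf.smul (hg.comp (continuous_const.sub continuous_id)).aestronglyMeasurable

theorem hasFDerivAt_integral_smul_comp_sub {F : Type*} [NormedAddCommGroup F] [NormedSpace ℝ F]
    {f : V → ℝ} (hf : Integrable f μ) {g : V → F} (hg : ContDiff ℝ (⊤ : ℕ∞) g) {C₀ C₁ : ℝ}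
    (hC₀ : ∀ x, ‖g x‖ ≤ C₀) (hC₁ : ∀ x, ‖fderiv ℝ g x‖ ≤ C₁) (x : V) :
    HasFDerivAt (fun x => ∫ y, f y • g (x - y) ∂μ) (∫ y, f y • fderiv ℝ g (x - y) ∂μ) x := by
  have hdg : Differentiable ℝ g := hg.differentiable (by simp)
  refine hasFDerivAt_integral_of_dominated_of_fderiv_le (s := Set.univ)
    (bound := fun y => ‖f y‖ * C₁)
    (F' := fun x y => f y • fderiv ℝ g (x - y)) Filter.univ_mem
    (Filter.Eventually.of_forall fun z => aestronglyMeasurable_smul_comp_sub hf.1 hg.continuous z)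
    ?_ (aestronglyMeasurable_smul_comp_sub hf.1 (hg.continuous_fderiv (by simp)) x)
    (Filter.Eventually.of_forall fun y z _ => ?_) (hf.norm.mul_const _)
    (Filter.Eventually.of_forall fun y z _ => ?_)
  · refine (hf.norm.mul_const C₀).mono' (aestronglyMeasurable_smul_comp_sub hf.1 hg.continuous x)
      (Filter.Eventually.of_forall fun y => ?_)
    rw [norm_smul]
    gcongr
    exact hC₀ _
  · rw [norm_smul]
    gcongr
    exact hC₁ _
  · have h1 : HasFDerivAt (fun z => g (z - y)) (fderiv ℝ g (z - y)) z := by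
      simpa [Function.comp_def] using (hdg (z - y)).hasFDerivAt.comp z ((hasFDerivAt_id z).sub_const y)
    exact h1.const_smul (f y)

theorem contDiff_integral_smul_comp_sub {f : V → ℝ} (hf : Integrable f μ) (m : ℕ) :
    ∀ {F : Type} [NormedAddCommGroup F] [NormedSpace ℝ F] {g : V → F},
      ContDiff ℝ (⊤ : ℕ∞) g → (∀ i, ∃ C, ∀ x, ‖iteratedFDeriv ℝ i g x‖ ≤ C) →
      ContDiff ℝ m (fun x => ∫ y, f y • g (x - y) ∂μ) ∧
      ∀ x, ‖iteratedFDeriv ℝ m (fun x => ∫ y, f y • g (x - y) ∂μ) x‖ₑ ≤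
        ∫⁻ y, ‖f y‖ₑ * ‖iteratedFDeriv ℝ m g (x - y)‖ₑ ∂μ := by
  induction m with
  | zero =>
    intro F _ _ g hg hb
    obtain ⟨C₀, hC₀⟩ := hb 0
    obtain ⟨C₁, hC₁⟩ := hb 1
    have hd := hasFDerivAt_integral_smul_comp_sub hf hg (C₀ := C₀) (C₁ := C₁)
      (fun x => by simpa using hC₀ x) (fun x => by simpa using hC₁ x)
    have e0 : ∀ (u : V → F) x, ‖iteratedFDeriv ℝ 0 u x‖ₑ = ‖u x‖ₑ := fun u x => by
      rw [← ofReal_norm, norm_iteratedFDeriv_zero, ofReal_norm]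
    refine ⟨?_, fun x => ?_⟩
    · rw [Nat.cast_zero, contDiff_zero]
      exact continuous_iff_continuousAt.mpr fun x => (hd x).continuousAt
    · simp only [e0]
      refine (enorm_integral_le_lintegral_enorm _).trans (le_of_eq ?_)
      simp only [enorm_smul]
  | succ m ih =>
    intro F _ _ g hg hb
    obtain ⟨C₀, hC₀⟩ := hb 0
    obtain ⟨C₁, hC₁⟩ := hb 1
    have hd := hasFDerivAt_integral_smul_comp_sub hf hg (C₀ := C₀) (C₁ := C₁)
      (fun x => by simpa using hC₀ x) (fun x => by simpa using hC₁ x)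
    have hfd : fderiv ℝ (fun x => ∫ y, f y • g (x - y) ∂μ) =
        fun x => ∫ y, f y • fderiv ℝ g (x - y) ∂μ := funext fun x => (hd x).fderiv
    obtain ⟨ih1, ih2⟩ := ih (hg.fderiv_right (m := (⊤ : ℕ∞)) (by simp)) (fun i => by
      obtain ⟨C, hC⟩ := hb (i + 1)
      exact ⟨C, fun x => by rw [norm_iteratedFDeriv_fderiv]; exact hC x⟩)
    refine ⟨?_, fun x => ?_⟩
    · rw [Nat.cast_add, Nat.cast_one, contDiff_succ_iff_fderiv]
      refine ⟨fun x => (hd x).differentiableAt, by simp, ?_⟩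
      rw [hfd]
      exact ih1
    · have e : ∀ (u : V → F) x,
          ‖iteratedFDeriv ℝ m (fderiv ℝ u) x‖ₑ = ‖iteratedFDeriv ℝ (m + 1) u x‖ₑ := fun u x => by
        rw [← ofReal_norm, norm_iteratedFDeriv_fderiv, ofReal_norm]
      have := ih2 x
      simpa only [← hfd, e] using this

/-- Young's inequality `L¹ ⋆ L² → L²` for nonnegative functions. -/
theorem lintegral_sq_conv_le [SFinite μ] [μ.IsAddLeftInvariant] [μ.IsAddRightInvariant]
    [μ.IsNegInvariant]
    {w v : V → ℝ≥0∞} (hw : Measurable w) (hv : Measurable v) :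
    ∫⁻ x, (∫⁻ y, w (x - y) * v y ∂μ) ^ (2 : ℝ) ∂μ ≤
      (∫⁻ z, w z ∂μ) ^ (2 : ℝ) * ∫⁻ y, v y ^ (2 : ℝ) ∂μ := by
  have hsub : ∀ x, ∫⁻ y, w (x - y) ∂μ = ∫⁻ z, w z ∂μ := fun x => lintegral_sub_left_eq_self w x
  have hmw : ∀ x, Measurable fun y => w (x - y) := fun x => hw.comp (measurable_const.sub measurable_id)
  have hcs : ∀ x, (∫⁻ y, w (x - y) * v y ∂μ) ^ (2 : ℝ) ≤
      (∫⁻ z, w z ∂μ) * ∫⁻ y, w (x - y) * v y ^ (2 : ℝ) ∂μ := by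
    intro x
    have h1 := ENNReal.lintegral_mul_le_Lp_mul_Lq μ Real.HolderConjugate.two_two
      (f := fun y => w (x - y) ^ (1 / 2 : ℝ)) (g := fun y => w (x - y) ^ (1 / 2 : ℝ) * v y)
      ((hmw x).pow_const _).aemeasurable (((hmw x).pow_const _).mul hv).aemeasurable
    have e1 : ∀ a : ℝ≥0∞, a ^ (1 / 2 : ℝ) * a ^ (1 / 2 : ℝ) = a := fun a => by
      rw [← ENNReal.rpow_add_of_nonneg _ _ (by norm_num) (by norm_num)]
      norm_num
    have e2 : ∀ a : ℝ≥0∞, (a ^ (1 / 2 : ℝ)) ^ (2 : ℝ) = a := fun a => by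
      rw [← ENNReal.rpow_mul]
      norm_num
    simp only [Pi.mul_apply, ← mul_assoc, e1, e2, ENNReal.mul_rpow_of_nonneg _ _ zero_le_two,
      hsub] at h1
    calc _ ≤ _ := ENNReal.rpow_le_rpow h1 zero_le_two
      _ = _ := by rw [ENNReal.mul_rpow_of_nonneg _ _ zero_le_two, e2, e2]
  calc _ ≤ ∫⁻ x, (∫⁻ z, w z ∂μ) * ∫⁻ y, w (x - y) * v y ^ (2 : ℝ) ∂μ ∂μ := lintegral_mono hcs
    _ = (∫⁻ z, w z ∂μ) * ∫⁻ x, ∫⁻ y, w (x - y) * v y ^ (2 : ℝ) ∂μ ∂μ := by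
        have hm : Measurable (Function.uncurry fun x y => w (x - y) * v y ^ (2 : ℝ)) :=
          (hw.comp (measurable_fst.sub measurable_snd)).mul ((hv.comp measurable_snd).pow_const _)
        exact lintegral_const_mul _ hm.lintegral_prod_right'
    _ = (∫⁻ z, w z ∂μ) * ∫⁻ y, ∫⁻ x, w (x - y) * v y ^ (2 : ℝ) ∂μ ∂μ := by
        congr 1
        refine lintegral_lintegral_swap (Measurable.aemeasurable ?_)
        exact (hw.comp (measurable_fst.sub measurable_snd)).mul
          ((hv.comp measurable_snd).pow_const _)
    _ = (∫⁻ z, w z ∂μ) * ((∫⁻ z, w z ∂μ) * ∫⁻ y, v y ^ (2 : ℝ) ∂μ) := by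
        congr 1
        rw [← lintegral_const_mul _ (hv.pow_const _)]
        refine lintegral_congr fun y => ?_
        have hm : Measurable fun x => w (x - y) := hw.comp (measurable_id.sub_const y)
        rw [lintegral_mul_const _ hm,
          lintegral_sub_right_eq_self w y]
    _ = _ := by rw [← mul_assoc, ENNReal.rpow_two, sq]

/-- Young's inequality with a pointwise dominated left-hand side. -/
theorem eLpNorm_two_le_of_enorm_le_conv [SFinite μ] [μ.IsAddLeftInvariant]
    [μ.IsAddRightInvariant] [μ.IsNegInvariant] {u v : V → ℝ} {w : V → ℝ≥0∞} (hw : Measurable w)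
    (hv : Measurable v) {c : ℝ≥0∞} (hc : c ≠ ⊤)
    (hu : ∀ x, ‖u x‖ₑ ≤ c * ∫⁻ y, w (x - y) * ‖v y‖ₑ ∂μ) :
    eLpNorm u 2 μ ≤ c * (∫⁻ z, w z ∂μ) * eLpNorm v 2 μ := by
  rw [eLpNorm_eq_lintegral_rpow_enorm_toReal two_ne_zero ENNReal.ofNat_ne_top,
    eLpNorm_eq_lintegral_rpow_enorm_toReal two_ne_zero ENNReal.ofNat_ne_top]
  simp only [ENNReal.toReal_ofNat]
  have e2 : ∀ a : ℝ≥0∞, (a ^ (2 : ℝ)) ^ (1 / 2 : ℝ) = a := fun a => by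
    rw [← ENNReal.rpow_mul]
    norm_num
  have h1 : ∫⁻ x, ‖u x‖ₑ ^ (2 : ℝ) ∂μ ≤
      c ^ (2 : ℝ) * ((∫⁻ z, w z ∂μ) ^ (2 : ℝ) * ∫⁻ y, ‖v y‖ₑ ^ (2 : ℝ) ∂μ) := by
    calc _ ≤ ∫⁻ x, c ^ (2 : ℝ) * (∫⁻ y, w (x - y) * ‖v y‖ₑ ∂μ) ^ (2 : ℝ) ∂μ := by
          refine lintegral_mono fun x => ?_
          rw [← ENNReal.mul_rpow_of_nonneg _ _ zero_le_two]
          exact ENNReal.rpow_le_rpow (hu x) zero_le_two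
      _ = c ^ (2 : ℝ) * ∫⁻ x, (∫⁻ y, w (x - y) * ‖v y‖ₑ ∂μ) ^ (2 : ℝ) ∂μ :=
          lintegral_const_mul' _ _ (ENNReal.rpow_ne_top_of_nonneg zero_le_two hc)
      _ ≤ _ := by
          gcongr
          exact lintegral_sq_conv_le hw hv.enorm
  calc _ ≤ _ := ENNReal.rpow_le_rpow h1 (by norm_num : (0 : ℝ) ≤ 1 / 2)
    _ = _ := by
      rw [ENNReal.mul_rpow_of_nonneg _ _ (by norm_num), ENNReal.mul_rpow_of_nonneg _ _ (by norm_num),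
        e2, e2, mul_assoc]

end Convolution

section SupNorm

variable {V F : Type*} [MeasurableSpace V] [NormedAddCommGroup F] {μ : Measure V} {u : V → F}

theorem toReal_eLpNorm_top_le {C : ℝ} (hC0 : 0 ≤ C) (hC : ∀ x, ‖u x‖ ≤ C) :
    (eLpNorm u ⊤ μ).toReal ≤ C := by
  refine ENNReal.toReal_le_of_le_ofReal hC0 ?_
  rw [eLpNorm_exponent_top]
  exact eLpNormEssSup_le_of_ae_bound (Filter.Eventually.of_forall hC)

theorem eLpNorm_top_ne_top_of_bound {C : ℝ} (hC : ∀ x, ‖u x‖ ≤ C) : eLpNorm u ⊤ μ ≠ ⊤ := by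
  rw [eLpNorm_exponent_top]
  exact ((eLpNormEssSup_le_of_ae_bound (Filter.Eventually.of_forall hC)).trans_lt
    ENNReal.ofReal_lt_top).ne

theorem norm_le_toReal_eLpNorm_top [TopologicalSpace V] [OpensMeasurableSpace V] [μ.IsOpenPosMeasure]
    (hu : Continuous u) (hfin : eLpNorm u ⊤ μ ≠ ⊤) (x : V) : ‖u x‖ ≤ (eLpNorm u ⊤ μ).toReal := by
  have hcl : IsClosed {x | ‖u x‖ ≤ (eLpNorm u ⊤ μ).toReal} :=
    isClosed_le hu.norm continuous_const
  have hae : {x | ‖u x‖ ≤ (eLpNorm u ⊤ μ).toReal} =ᵐ[μ] Set.univ := by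
    rw [ae_eq_univ]
    have h1 : ∀ᵐ x ∂μ, ‖u x‖ₑ ≤ eLpNorm u ⊤ μ := by
      rw [eLpNorm_exponent_top]
      exact ae_le_eLpNormEssSup
    have h2 : ∀ᵐ x ∂μ, ‖u x‖ ≤ (eLpNorm u ⊤ μ).toReal := by
      filter_upwards [h1] with x hx
      rw [← toReal_enorm]
      exact ENNReal.toReal_mono hfin hx
    exact h2
  exact Set.eq_univ_iff_forall.mp (hcl.ae_eq_univ_iff_eq.mp hae) x

end SupNorm

section Schwartz

variable {V : Type*} [NormedAddCommGroup V] [NormedSpace ℝ V] [MeasurableSpace V] {μ : Measure V}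

theorem schwartz_eLpNorm_iteratedFDeriv_ne_top (h : SchwartzMap V ℝ) (i : ℕ) :
    eLpNorm (iteratedFDeriv ℝ i h) ⊤ μ ≠ ⊤ := by
  obtain ⟨C, _, hC⟩ := h.decay 0 i
  exact eLpNorm_top_ne_top_of_bound (C := C) fun x => by simpa using hC x

theorem schwartz_norm_iteratedFDeriv_le [OpensMeasurableSpace V] [μ.IsOpenPosMeasure]
    (h : SchwartzMap V ℝ) (i : ℕ) (x : V) :
    ‖iteratedFDeriv ℝ i h x‖ ≤ (eLpNorm (iteratedFDeriv ℝ i h) ⊤ μ).toReal :=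
  norm_le_toReal_eLpNorm_top
    ((h.smooth ⊤).continuous_iteratedFDeriv (m := i) (by exact_mod_cast le_top))
    (schwartz_eLpNorm_iteratedFDeriv_ne_top h i) x

theorem schwartz_eLpNorm_iteratedFDeriv_sq_le [OpensMeasurableSpace V] [μ.IsOpenPosMeasure]
    (h : SchwartzMap V ℝ) (i : ℕ) :
    (eLpNorm (iteratedFDeriv ℝ (i + 1) h) ⊤ μ).toReal ^ 2 ≤
      8 * (eLpNorm (iteratedFDeriv ℝ i h) ⊤ μ).toReal *
        (eLpNorm (iteratedFDeriv ℝ (i + 2) h) ⊤ μ).toReal := by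
  have h1 := norm_iteratedFDeriv_sq_le (h.smooth ⊤) (schwartz_norm_iteratedFDeriv_le (μ := μ) h i)
    (schwartz_norm_iteratedFDeriv_le (μ := μ) h (i + 2))
  have h2 := toReal_eLpNorm_top_le (μ := μ) (Real.sqrt_nonneg _) fun x => Real.le_sqrt_of_sq_le (h1 x)
  exact (Real.le_sqrt ENNReal.toReal_nonneg (by positivity)).mp h2

theorem eLpNorm_iteratedFDeriv_zero (u : V → ℝ) :
    eLpNorm (iteratedFDeriv ℝ 0 u) ⊤ μ = eLpNorm u ⊤ μ :=
  eLpNorm_congr_norm_ae (Filter.Eventually.of_forall fun _ => norm_iteratedFDeriv_zero)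

end Schwartz

section Weight

theorem one_add_norm_rpow_le {V : Type*} [NormedAddCommGroup V] {α : ℝ} (hα : 0 ≤ α) (x y : V) :
    (1 + ‖x‖) ^ α ≤ (1 + ‖x - y‖) ^ α * (1 + ‖y‖) ^ α := by
  rw [← Real.mul_rpow (by positivity) (by positivity)]
  refine Real.rpow_le_rpow (by positivity) ?_ hα
  have h1 : ‖x‖ ≤ ‖x - y‖ + ‖y‖ := by simpa using norm_add_le (x - y) y
  nlinarith [norm_nonneg (x - y), norm_nonneg y, mul_nonneg (norm_nonneg (x - y)) (norm_nonneg y)]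

theorem lintegral_weight_lt_top {α : ℝ} (hα : α < 1) :
    ∫⁻ z : EuclideanSpace ℝ (Fin 2),
      ENNReal.ofReal ((1 + ‖z‖) ^ α * ((1 + ‖z‖) ^ 3)⁻¹) < ⊤ := by
  have h1 := finite_integral_one_add_norm (E := EuclideanSpace ℝ (Fin 2)) (μ := volume)
    (r := 3 - α) (by rw [finrank_euclideanSpace_fin]; push_cast; linarith)
  refine lt_of_eq_of_lt (lintegral_congr fun z => ?_) h1
  have hz : 0 < 1 + ‖z‖ := by positivity
  rw [← Real.rpow_natCast, ← Real.rpow_neg hz.le, ← Real.rpow_add hz]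
  congr 2
  push_cast
  ring

theorem mul_lintegral_le_weighted {V : Type*} [NormedAddCommGroup V] [MeasurableSpace V]
    {μ : Measure V} {α : ℝ} (hα : 0 ≤ α) (ρ : V → ℝ) (x : V) :
    ENNReal.ofReal ((1 + ‖x‖) ^ α) *
        ∫⁻ y, ENNReal.ofReal ((1 + ‖x - y‖) ^ 3)⁻¹ * ‖ρ y‖ₑ ∂μ ≤
      ∫⁻ y, ENNReal.ofReal ((1 + ‖x - y‖) ^ α * ((1 + ‖x - y‖) ^ 3)⁻¹) *
        ‖(1 + ‖y‖) ^ α * ‖ρ y‖‖ₑ ∂μ := by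
  rw [← lintegral_const_mul' _ _ ENNReal.ofReal_ne_top]
  refine lintegral_mono fun y => ?_
  have hy : ‖(1 + ‖y‖) ^ α‖ₑ = ENNReal.ofReal ((1 + ‖y‖) ^ α) :=
    Real.enorm_of_nonneg (by positivity)
  rw [enorm_mul, enorm_norm, hy, ← mul_assoc, ← mul_assoc, ← ENNReal.ofReal_mul (by positivity),
    ← ENNReal.ofReal_mul (by positivity)]
  gcongr ENNReal.ofReal ?_ * _
  have := one_add_norm_rpow_le hα x y
  calc _ ≤ ((1 + ‖x - y‖) ^ α * (1 + ‖y‖) ^ α) * ((1 + ‖x - y‖) ^ 3)⁻¹ := by gcongr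
    _ = _ := by ring

end Weight

section LongRange

/-- The convolution with a kernel whose derivatives decay like `‖x‖⁻³`. -/
theorem enorm_iteratedFDeriv_integral_le {V : Type} [NormedAddCommGroup V]
    [InnerProductSpace ℝ V] [FiniteDimensional ℝ V] [MeasurableSpace V] [BorelSpace V]
    {μ : Measure V} {f ρ : V → ℝ} (hf : Integrable f μ) {H : ℝ} (hH : 0 ≤ H)
    (hfρ : ∀ y, ‖f y‖ ≤ H * ‖ρ y‖) {g : V → ℝ} (hg : ContDiff ℝ (⊤ : ℕ∞) g)
    (hb : ∀ i, ∃ C, ∀ x, ‖iteratedFDeriv ℝ i g x‖ ≤ C) {D : ℝ} (hD : 0 ≤ D) {i : ℕ}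
    (hgD : ∀ x, ‖iteratedFDeriv ℝ i g x‖ ≤ D * ((1 + ‖x‖) ^ 3)⁻¹) (x : V) :
    ‖iteratedFDeriv ℝ i (fun x => ∫ y, f y • g (x - y) ∂μ) x‖ₑ ≤
      ENNReal.ofReal (H * D) * ∫⁻ y, ENNReal.ofReal ((1 + ‖x - y‖) ^ 3)⁻¹ * ‖ρ y‖ₑ ∂μ := by
  refine ((contDiff_integral_smul_comp_sub hf i hg hb).2 x).trans ?_
  rw [← lintegral_const_mul' _ _ ENNReal.ofReal_ne_top]
  refine lintegral_mono fun y => ?_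
  calc ‖f y‖ₑ * ‖iteratedFDeriv ℝ i g (x - y)‖ₑ
      = ENNReal.ofReal ‖f y‖ * ENNReal.ofReal ‖iteratedFDeriv ℝ i g (x - y)‖ := by
        rw [ofReal_norm, ofReal_norm]
    _ ≤ ENNReal.ofReal (H * ‖ρ y‖) * ENNReal.ofReal (D * ((1 + ‖x - y‖) ^ 3)⁻¹) := by
        gcongr
        · exact hfρ y
        · exact hgD _
    _ = _ := by
        rw [ENNReal.ofReal_mul hH, ENNReal.ofReal_mul hD, ENNReal.ofReal_mul hH, ofReal_norm]
        ring

theorem enorm_iteratedFDeriv_mul_le {V : Type*} [NormedAddCommGroup V] [NormedSpace ℝ V]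
    {f g : V → ℝ} (hf : ContDiff ℝ (⊤ : ℕ∞) f) (hg : ContDiff ℝ (⊤ : ℕ∞) g) {x : V} {m : ℕ}
    {P : ℝ} (hP : ∀ i ≤ m, ‖iteratedFDeriv ℝ i f x‖ ≤ P) {Q : ℝ≥0∞} (hQ : Q ≠ ⊤)
    (hgQ : ∀ i ≤ m, ‖iteratedFDeriv ℝ i g x‖ₑ ≤ Q) :
    ‖iteratedFDeriv ℝ m (fun y => f y * g y) x‖ₑ ≤ ENNReal.ofReal (2 ^ m * P) * Q := by
  have hP0 : 0 ≤ P := (norm_nonneg _).trans (hP 0 (Nat.zero_le _))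
  have h1 := pow_mul_norm_iteratedFDeriv_mul_le isOpen_univ hf.contDiffOn hg.contDiffOn
    (Set.mem_univ x) (lam := 1) (A := P) (B := Q.toReal) zero_le_one (m := m)
    (by simpa using hP) (fun i hi => by
      rw [one_pow, one_mul, ← toReal_enorm]
      exact ENNReal.toReal_mono hQ (hgQ i hi)) m le_rfl
  rw [one_pow, one_mul] at h1
  calc _ = ENNReal.ofReal ‖iteratedFDeriv ℝ m (fun y => f y * g y) x‖ := (ofReal_norm _).symm
    _ ≤ ENNReal.ofReal (2 ^ m * P * Q.toReal) := ENNReal.ofReal_le_ofReal h1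
    _ = _ := by rw [ENNReal.ofReal_mul (by positivity), ENNReal.ofReal_toReal hQ]

theorem mul_pow_collect_le {n j : ℕ} (hn : 1 ≤ n) (hj : j ≤ 2 * n) {P C D Y W H : ℝ}
    (hP : 1 ≤ P) (hC : 1 ≤ C) (hD : 0 ≤ D) (hY : 0 ≤ Y) (hW : 0 ≤ W) (hH : 0 < H) :
    (P * ((C * H) ^ j * W / H)) * (H ^ (2 * n - j) * D ^ n) * Y ≤
      (P * C ^ 2 * D * (1 + Y)) ^ n * H ^ (2 * n - 1) * W := by
  have e1 : H ^ j * H ^ (2 * n - j) = H ^ (2 * n - 1) * H := by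
    rw [← pow_add, ← pow_succ]
    congr 1
    omega
  have h1 : P ≤ P ^ n := le_self_pow₀ hP (by omega)
  have h2 : C ^ j ≤ (C ^ 2) ^ n := by
    rw [← pow_mul]
    exact pow_le_pow_right₀ hC hj
  have h3 : Y ≤ (1 + Y) ^ n :=
    (le_add_of_nonneg_left zero_le_one).trans (le_self_pow₀ (by linarith) (by omega))
  calc _ = P * C ^ j * D ^ n * Y * (H ^ j * H ^ (2 * n - j)) * W / H := by
        rw [mul_pow]
        ring
    _ = P * C ^ j * D ^ n * Y * (H ^ (2 * n - 1) * W) := by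
        rw [e1]
        field_simp
    _ ≤ P ^ n * (C ^ 2) ^ n * D ^ n * (1 + Y) ^ n * (H ^ (2 * n - 1) * W) := by
        gcongr ?_ * ?_ * _ * ?_ * _
    _ = _ := by
        rw [← mul_pow, ← mul_pow, ← mul_pow]
        ring

theorem eLpNorm_weight_mul_le {G : Type*} [NormedAddCommGroup G] {α : ℝ}
    (hα : α ∈ Set.Ioo (0 : ℝ) 1) {u : EuclideanSpace ℝ (Fin 2) → G}
    {ρ : EuclideanSpace ℝ (Fin 2) → ℝ} (hρ : Measurable ρ) {P Q Y : ℝ} (hP : 0 ≤ P) (hQ : 0 ≤ Q)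
    (hY : ∫⁻ z : EuclideanSpace ℝ (Fin 2),
      ENNReal.ofReal ((1 + ‖z‖) ^ α * ((1 + ‖z‖) ^ 3)⁻¹) = ENNReal.ofReal Y)
    (hu : ∀ x, ‖u x‖ₑ ≤ ENNReal.ofReal P * (ENNReal.ofReal Q *
      ∫⁻ y, ENNReal.ofReal ((1 + ‖x - y‖) ^ 3)⁻¹ * ‖ρ y‖ₑ)) :
    eLpNorm (fun x => (1 + ‖x‖) ^ α * ‖u x‖) 2 volume ≤
      ENNReal.ofReal (P * Q * Y) * eLpNorm (fun x => (1 + ‖x‖) ^ α * ‖ρ x‖) 2 volume := by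
  rw [ENNReal.ofReal_mul (mul_nonneg hP hQ), ENNReal.ofReal_mul hP, ← hY]
  refine eLpNorm_two_le_of_enorm_le_conv
    (w := fun z => ENNReal.ofReal ((1 + ‖z‖) ^ α * ((1 + ‖z‖) ^ 3)⁻¹)) (by fun_prop)
    (by fun_prop) (ENNReal.mul_ne_top ENNReal.ofReal_ne_top ENNReal.ofReal_ne_top) fun x => ?_
  rw [enorm_mul, enorm_norm, Real.enorm_of_nonneg (by positivity : (0 : ℝ) ≤ (1 + ‖x‖) ^ α)]
  refine (mul_le_mul_right (hu x) _).trans ?_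
  rw [← mul_assoc (ENNReal.ofReal P), mul_left_comm]
  exact mul_le_mul_right (mul_lintegral_le_weighted hα.1.le ρ x) _

end LongRange


/-- Weighted `L²` bounds, with constant exponential in `n`, for the long-range operators
`K_{n,j} ρ = ∇(hʲ · (Γ̃_n ⋆ (ρ h^{2n−j})))`, `Γ̃_n(x) = χ̃(x)‖x‖^{−(2n+1)}`, arising from the
binomial expansion of the off-diagonal part of the `n`-th Taylor term of the single layer
potential of the Dirichlet-to-Neumann operator (Part 1 of Lemma `Kn-Z` of the paper). -/
theorem stmt10 (χ : EuclideanSpace ℝ (Fin 2) → ℝ) (hχsm : ContDiff ℝ (⊤ : ℕ∞) χ)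
    (hχr : ∀ x, χ x ∈ Set.Icc (0 : ℝ) 1)
    (hχs : Function.support χ ⊆ {x : EuclideanSpace ℝ (Fin 2) | 1 < ‖x‖})
    (hχ1 : ∀ x : EuclideanSpace ℝ (Fin 2), 2 ≤ ‖x‖ → χ x = 1)
    (α : ℝ) (hα : α ∈ Set.Ioo (0 : ℝ) 1) (k : ℕ) (hk : k ≤ 8) :
    ∃ B : ℝ, 0 < B ∧
      ∀ n : ℕ, 1 ≤ n → ∀ j : ℕ, j ≤ 2 * n →
      ∀ h ρ : SchwartzMap (EuclideanSpace ℝ (Fin 2)) ℝ,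
        eLpNorm (fun x : EuclideanSpace ℝ (Fin 2) => (1 + ‖x‖) ^ α *
            ‖iteratedFDeriv ℝ k (fun z => fderiv ℝ
              (fun w => h w ^ j * ∫ y : EuclideanSpace ℝ (Fin 2),
                (χ (w - y) * ‖w - y‖ ^ (-(2 * (n : ℤ)) - 1)) * (ρ y * h y ^ (2 * n - j))) z) x‖)
          2 volume ≤
          ENNReal.ofReal (B ^ n) * eLpNorm (⇑h) ⊤ volume ^ (2 * n - 1) *
            sobNorm (k + 1) ⊤ (⇑h) *
            eLpNorm (fun x : EuclideanSpace ℝ (Fin 2) => (1 + ‖x‖) ^ α * ‖ρ x‖) 2 volume := by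
  have hχ0 : ∀ x, ‖x‖ ≤ 1 → χ x = 0 := fun x hx => by
    by_contra hne
    exact absurd (hχs hne) (not_lt.mpr hx)
  obtain ⟨D, hD1, hD⟩ := exists_norm_iteratedFDeriv_kernel_le hχsm hχ0 hχ1 (k + 1)
  set m := k + 1
  set Y : ℝ := (∫⁻ z : EuclideanSpace ℝ (Fin 2),
      ENNReal.ofReal ((1 + ‖z‖) ^ α * ((1 + ‖z‖) ^ 3)⁻¹)).toReal
  have hYeq : (∫⁻ z : EuclideanSpace ℝ (Fin 2),
      ENNReal.ofReal ((1 + ‖z‖) ^ α * ((1 + ‖z‖) ^ 3)⁻¹)) = ENNReal.ofReal Y :=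
    (ENNReal.ofReal_toReal (lintegral_weight_lt_top hα.2).ne).symm
  have hY0 : 0 ≤ Y := ENNReal.toReal_nonneg
  set C : ℝ := 2 ^ m * 3 ^ (m ^ 2)
  have hC1 : 1 ≤ C := one_le_mul_of_one_le_of_one_le (one_le_pow₀ (by norm_num))
    (one_le_pow₀ (by norm_num))
  refine ⟨2 ^ m * C ^ 2 * D * (1 + Y), by positivity, fun n hn j hj h ρ => ?_⟩
  set a : ℕ → ℝ := fun i => (eLpNorm (iteratedFDeriv ℝ i h) ⊤ volume).toReal with ha
  set W : ℝ := ∑ i ∈ Finset.range (m + 1), a i with hW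
  have ha0 : ∀ i, 0 ≤ a i := fun i => ENNReal.toReal_nonneg
  have haW : ∀ i ≤ m, a i ≤ W := fun i hi =>
    Finset.single_le_sum (fun l _ => ha0 l) (Finset.mem_range.mpr (Nat.lt_succ_of_le hi))
  have hH : eLpNorm (⇑h) ⊤ volume = ENNReal.ofReal (a 0) := by
    rw [ha, ENNReal.ofReal_toReal (schwartz_eLpNorm_iteratedFDeriv_ne_top h 0),
      eLpNorm_iteratedFDeriv_zero]
  have hS : sobNorm m ⊤ (⇑h) = ENNReal.ofReal W := by
    rw [hW, ENNReal.ofReal_sum_of_nonneg (fun i _ => ha0 i), sobNorm]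
    exact Finset.sum_congr rfl fun i _ =>
      (ENNReal.ofReal_toReal (schwartz_eLpNorm_iteratedFDeriv_ne_top h i)).symm
  have hbd : ∀ x, ‖h x‖ ≤ a 0 := fun x =>
    (norm_iteratedFDeriv_zero (𝕜 := ℝ) (f := h) (x := x)).symm.le.trans
      (schwartz_norm_iteratedFDeriv_le (μ := volume) h 0 x)
  rcases (ha0 0).eq_or_lt with h00 | h0pos
  · have hz : ∀ x, h x = 0 := fun x => norm_le_zero_iff.mp (h00 ▸ hbd x)
    have hfun : (fun w => h w ^ j * ∫ y : EuclideanSpace ℝ (Fin 2),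
        (χ (w - y) * ‖w - y‖ ^ (-(2 * (n : ℤ)) - 1)) * (ρ y * h y ^ (2 * n - j))) =
        fun _ => 0 := by
      funext w
      rcases Nat.eq_zero_or_pos j with rfl | hj0
      · have : n ≠ 0 := by omega
        simp [hz, this]
      · simp [hz, hj0.ne']
    rw [hfun]
    simp
  set f : EuclideanSpace ℝ (Fin 2) → ℝ := fun y => ρ y * h y ^ (2 * n - j) with hf
  set Γ : EuclideanSpace ℝ (Fin 2) → ℝ := fun x => χ x * ‖x‖⁻¹ ^ (2 * n + 1) with hΓ
  have hfun : (fun w => h w ^ j * ∫ y : EuclideanSpace ℝ (Fin 2),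
        (χ (w - y) * ‖w - y‖ ^ (-(2 * (n : ℤ)) - 1)) * (ρ y * h y ^ (2 * n - j))) =
      fun w => h w ^ j * ∫ y, f y • Γ (w - y) := by
    funext w
    congr 1
    refine integral_congr_ae (Filter.Eventually.of_forall fun y => ?_)
    simp only [hf, hΓ, smul_eq_mul]
    rw [show -(2 * (n : ℤ)) - 1 = -((2 * n + 1 : ℕ) : ℤ) by push_cast; ring, zpow_neg,
      zpow_natCast, inv_pow]
    ring
  rw [hfun]
  have hfρ : ∀ y, ‖f y‖ ≤ a 0 ^ (2 * n - j) * ‖ρ y‖ := fun y => by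
    rw [hf, norm_mul, norm_pow, mul_comm]
    gcongr
    exact hbd y
  have hfi : Integrable f := by
    refine (ρ.integrable.norm.const_mul (a 0 ^ (2 * n - j))).mono'
      (ρ.continuous.mul (h.continuous.pow _)).aestronglyMeasurable
      (Filter.Eventually.of_forall hfρ)
  have hΓs : ContDiff ℝ (⊤ : ℕ∞) Γ := contDiff_kernel hχsm hχ0 _
  have hΓb : ∀ i, ∃ C, ∀ x, ‖iteratedFDeriv ℝ i Γ x‖ ≤ C := fun i => by
    obtain ⟨D', hD'1, hD'⟩ := exists_norm_iteratedFDeriv_kernel_le hχsm hχ0 hχ1 i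
    refine ⟨D' ^ n, fun x => (hD' n hn i le_rfl x).trans ?_⟩
    refine mul_le_of_le_one_right (by positivity) (inv_le_one_of_one_le₀ (one_le_pow₀ ?_))
    linarith [norm_nonneg x]
  have hGs : ContDiff ℝ (⊤ : ℕ∞) (fun w => ∫ y, f y • Γ (w - y)) :=
    contDiff_infty.mpr fun i => (contDiff_integral_smul_comp_sub hfi i hΓs hΓb).1
  set J : EuclideanSpace ℝ (Fin 2) → ℝ≥0∞ := fun x =>
    ∫⁻ y, ENNReal.ofReal ((1 + ‖x - y‖) ^ 3)⁻¹ * ‖ρ y‖ₑ with hJ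
  have hJfin : ∀ x, J x ≠ ⊤ := fun x => by
    refine ((lintegral_mono fun y => ?_).trans_lt ρ.integrable.2).ne
    refine mul_le_of_le_one_left' ?_
    rw [ENNReal.ofReal_le_one]
    refine inv_le_one_of_one_le₀ (one_le_pow₀ ?_)
    linarith [norm_nonneg (x - y)]
  have hmoser : ∀ x, ∀ i ≤ m, ‖iteratedFDeriv ℝ i (fun y => h y ^ j) x‖ ≤
      (C * a 0) ^ j * W / a 0 := fun x i hi => by
    rw [le_div_iff₀ h0pos, mul_comm]
    exact norm_iteratedFDeriv_pow_le (h.smooth ⊤) (schwartz_norm_iteratedFDeriv_le h)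
      (schwartz_eLpNorm_iteratedFDeriv_sq_le h) (Nat.succ_ne_zero k) h0pos
      (haW 0 (Nat.zero_le _)) (haW m le_rfl) j x i hi
  have hpt : ∀ x, ‖iteratedFDeriv ℝ m (fun w => h w ^ j * ∫ y, f y • Γ (w - y)) x‖ₑ ≤
      ENNReal.ofReal (2 ^ m * ((C * a 0) ^ j * W / a 0)) *
        (ENNReal.ofReal (a 0 ^ (2 * n - j) * D ^ n) * J x) := fun x =>
    enorm_iteratedFDeriv_mul_le ((h.smooth ⊤).pow j) hGs (hmoser x)
      (ENNReal.mul_ne_top ENNReal.ofReal_ne_top (hJfin x)) fun i hi =>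
        enorm_iteratedFDeriv_integral_le hfi (by positivity) hfρ hΓs hΓb (by positivity)
          (hD n hn i hi) x
  have hW0 : 0 ≤ W := (ha0 0).trans (haW 0 (Nat.zero_le _))
  clear_value a W C Y
  have hconst : (2 ^ m * ((C * a 0) ^ j * W / a 0)) * (a 0 ^ (2 * n - j) * D ^ n) * Y ≤
      (2 ^ m * C ^ 2 * D * (1 + Y)) ^ n * a 0 ^ (2 * n - 1) * W := by
    have hP : (1 : ℝ) ≤ 2 ^ m := one_le_pow₀ (by norm_num)
    exact mul_pow_collect_le hn hj hP hC1 (by positivity) hY0 hW0 h0pos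
  have hfin := eLpNorm_weight_mul_le hα (ρ := ρ) ρ.continuous.measurable
    (by positivity : 0 ≤ 2 ^ m * ((C * a 0) ^ j * W / a 0)) (by positivity) hYeq hpt
  simp only [norm_iteratedFDeriv_fderiv]
  rw [hH, hS, ← ENNReal.ofReal_pow (ha0 0), ← ENNReal.ofReal_mul (by positivity),
    ← ENNReal.ofReal_mul (by positivity)]
  exact hfin.trans (mul_le_mul_left (ENNReal.ofReal_le_ofReal hconst) _)


end
end

section
/- For every α ∈ (0,1) and every q ∈ (2, ∞) there is a constant C = C(α, q) such that for every Schwartz function u : ℝ² → ℂ: ‖(1+‖x‖)^α u‖_{L^q(ℝ²)} ≤ C · ( ‖(1+‖x‖)^α u‖_{L²(ℝ²)} + ‖(1+‖x‖)^α ∇u‖_{L²(ℝ²)} + ‖(1+‖x‖)^α ∇²u‖_{L²(ℝ²)} ). -/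
open MeasureTheory Filter
open scoped ENNReal LineDeriv Topology

/-- A `C¹` curve tending to `0` at infinity is bounded by the total variation of its tail. -/
theorem enorm_le_lintegral_Ioi_enorm_deriv {F : Type*} [NormedAddCommGroup F] [NormedSpace ℝ F]
    {g : ℝ → F} (hg : ContDiff ℝ 1 g) (h0 : Tendsto g atTop (𝓝 0)) :
    ‖g 0‖ₑ ≤ ∫⁻ t in Set.Ioi (0 : ℝ), ‖deriv g t‖ₑ := by
  have hbound : ∀ᶠ T in atTop, ‖g T - g 0‖ₑ ≤ ∫⁻ t in Set.Ioi (0 : ℝ), ‖deriv g t‖ₑ := by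
    filter_upwards [eventually_ge_atTop 0] with T hT
    refine (enorm_sub_le_lintegral_deriv_of_contDiffOn_Icc hg.contDiffOn hT).trans ?_
    rw [restrict_Ioi_eq_restrict_Ici]
    exact lintegral_mono_set fun t ht => ht.1
  have hlim : Tendsto (fun T => ‖g T - g 0‖ₑ) atTop (𝓝 ‖(0 : F) - g 0‖ₑ) :=
    (h0.sub_const _).enorm
  simpa using le_of_tendsto hlim hbound

section SchwartzLines

variable {E : Type*} [NormedAddCommGroup E] [NormedSpace ℝ E]

theorem SchwartzMap.tendsto_ray_zero [FiniteDimensional ℝ E] (u : SchwartzMap E ℂ) (z : E)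
    {e : E} (he : e ≠ 0) :
    Tendsto (fun t : ℝ => u (z + t • e)) atTop (𝓝 0) := by
  refine (zero_at_infty u).comp ?_
  rw [← Metric.cobounded_eq_cocompact, ← tendsto_norm_atTop_iff_cobounded]
  refine tendsto_atTop_mono (f := fun t : ℝ => t * ‖e‖ - ‖z‖) (fun t => ?_) ?_
  · have h1 := norm_sub_le (z + t • e) z
    have h2 : t * ‖e‖ ≤ ‖t • e‖ := by
      rw [norm_smul]; gcongr; exact le_abs_self t
    rw [add_sub_cancel_left] at h1
    linarith
  · exact tendsto_atTop_add_const_right _ _ (tendsto_id.atTop_mul_const (norm_pos_iff.2 he))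

theorem SchwartzMap.enorm_mul_le_lintegral_ray [FiniteDimensional ℝ E] (v w : SchwartzMap E ℂ)
    (z : E) {e : E} (he : e ≠ 0) :
    ‖v z * w z‖ₑ ≤ ∫⁻ t in Set.Ioi (0 : ℝ),
      ‖∂_{e} v (z + t • e) * w (z + t • e) + v (z + t • e) * ∂_{e} w (z + t • e)‖ₑ := by
  have hline : ∀ t : ℝ, HasDerivAt (fun t : ℝ => z + t • e) e t := fun t => by
    simpa using ((hasDerivAt_id t).smul_const e).const_add z
  have hderiv : ∀ (f : SchwartzMap E ℂ) (t : ℝ),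
      HasDerivAt (fun t : ℝ => f (z + t • e)) (∂_{e} f (z + t • e)) t := fun f t => by
    rw [SchwartzMap.lineDerivOp_apply_eq_fderiv]
    exact (f.differentiableAt.hasFDerivAt).comp_hasDerivAt t (hline t)
  have hsmooth : ∀ f : SchwartzMap E ℂ, ContDiff ℝ 1 (fun t : ℝ => f (z + t • e)) := fun f =>
    (f.smooth 1).comp (by fun_prop)
  have h := enorm_le_lintegral_Ioi_enorm_deriv ((hsmooth v).mul (hsmooth w))
    (by simpa using (v.tendsto_ray_zero z he).mul (w.tendsto_ray_zero z he))
  simpa [((hderiv v _).fun_mul (hderiv w _)).deriv] using h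

theorem SchwartzMap.norm_lineDerivOp_le (u : SchwartzMap E ℂ) (x : E) {a : E} (ha : ‖a‖ = 1) :
    ‖∂_{a} u x‖ ≤ ‖iteratedFDeriv ℝ 1 u x‖ := by
  rw [SchwartzMap.lineDerivOp_apply_eq_fderiv, norm_iteratedFDeriv_one]
  simpa [ha] using (fderiv ℝ u x).le_opNorm a

theorem SchwartzMap.norm_lineDerivOp_lineDerivOp_le (u : SchwartzMap E ℂ) (x : E) {a b : E}
    (ha : ‖a‖ = 1) (hb : ‖b‖ = 1) :
    ‖∂_{b} (∂_{a} u) x‖ ≤ ‖iteratedFDeriv ℝ 2 u x‖ := by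
  have h : ∂_{b} (∂_{a} u) x = iteratedFDeriv ℝ 2 u x ![b, a] := by
    rw [← SchwartzMap.iteratedLineDerivOp_eq_iteratedFDeriv]
    simp [LineDeriv.iteratedLineDerivOp_succ_left]
  rw [h]
  simpa [ha, hb] using (iteratedFDeriv ℝ 2 u x).le_opNorm ![b, a]

/-- Integrating the mixed derivative of `u²` over a quadrant with vertex `z`. -/
theorem SchwartzMap.enorm_sq_le_lintegral_quadrant [FiniteDimensional ℝ E]
    (u : SchwartzMap E ℂ) (z : E) {a b : E} (ha : ‖a‖ = 1) (hb : ‖b‖ = 1) :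
    ‖u z‖ₑ ^ 2 ≤ ∫⁻ s in Set.Ioi (0 : ℝ), ∫⁻ t in Set.Ioi (0 : ℝ),
      (‖u (z + s • a + t • b)‖ₑ ^ 2 + 2 * ‖iteratedFDeriv ℝ 1 u (z + s • a + t • b)‖ₑ ^ 2 +
        ‖iteratedFDeriv ℝ 2 u (z + s • a + t • b)‖ₑ ^ 2) := by
  have ha0 : a ≠ 0 := fun h => by simp [h] at ha
  have hb0 : b ≠ 0 := fun h => by simp [h] at hb
  have h1 := u.enorm_mul_le_lintegral_ray u z ha0
  rw [enorm_mul, ← sq] at h1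
  refine h1.trans (lintegral_mono fun s => ?_)
  have h2 := ((2 : ℂ) • u).enorm_mul_le_lintegral_ray (∂_{a} u) (z + s • a) hb0
  refine (le_of_eq ?_).trans (h2.trans (lintegral_mono fun t => ?_))
  · congr 1
    simp only [_root_.smul_apply, smul_eq_mul]
    ring
  · generalize z + s • a + t • b = x
    have hA := u.norm_lineDerivOp_le x ha
    have hB := u.norm_lineDerivOp_le x hb
    have hD := u.norm_lineDerivOp_lineDerivOp_le x ha hb
    have key : ‖∂_{b} ((2 : ℂ) • u) x * ∂_{a} u x + ((2 : ℂ) • u) x * ∂_{b} (∂_{a} u) x‖ ≤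
        ‖u x‖ ^ 2 + 2 * ‖iteratedFDeriv ℝ 1 u x‖ ^ 2 + ‖iteratedFDeriv ℝ 2 u x‖ ^ 2 := by
      have h2u : ∂_{b} ((2 : ℂ) • u) = (2 : ℂ) • ∂_{b} u := LineDeriv.lineDerivOp_smul _ _ _
      rw [h2u]
      simp only [_root_.smul_apply, smul_eq_mul]
      refine (norm_add_le _ _).trans ?_
      simp only [norm_mul, Complex.norm_ofNat]
      have p1 := mul_le_mul hB hA (norm_nonneg _) (norm_nonneg _)
      have p2 := mul_le_mul_of_nonneg_left hD (norm_nonneg (u x))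
      nlinarith [sq_nonneg (‖u x‖ - ‖iteratedFDeriv ℝ 2 u x‖)]
    simp only [← ofReal_norm]
    rw [show (2 : ℝ≥0∞) = ENNReal.ofReal 2 by simp, ← ENNReal.ofReal_pow (by positivity),
      ← ENNReal.ofReal_pow (by positivity), ← ENNReal.ofReal_pow (by positivity),
      ← ENNReal.ofReal_mul (by positivity), ← ENNReal.ofReal_add (by positivity) (by positivity),
      ← ENNReal.ofReal_add (by positivity) (by positivity)]
    exact ENNReal.ofReal_le_ofReal key

end SchwartzLines

theorem EuclideanSpace.exists_orthonormalBasis_inner_nonneg (z : EuclideanSpace ℝ (Fin 2)) :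
    ∃ b : OrthonormalBasis (Fin 2) ℝ (EuclideanSpace ℝ (Fin 2)),
      ∀ i, 0 ≤ inner ℝ z (b i) := by
  let e := EuclideanSpace.basisFun (Fin 2) ℝ
  let v : Fin 2 → EuclideanSpace ℝ (Fin 2) := fun i => (if 0 ≤ z i then (1 : ℝ) else -1) • e i
  have hv : Orthonormal ℝ v := by
    rw [orthonormal_iff_ite]
    intro i j
    simp only [v, inner_smul_left, inner_smul_right, orthonormal_iff_ite.1 e.orthonormal i j]
    obtain rfl | hij := eq_or_ne i j
    · split_ifs <;> simp
    · simp [hij]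
  obtain ⟨b, hb⟩ := Orthonormal.exists_orthonormalBasis_extension_of_card_eq (𝕜 := ℝ)
    (s := Set.univ) (v := v) (by simp) (hv.comp _ Subtype.val_injective)
  refine ⟨b, fun i => ?_⟩
  rw [hb i trivial, inner_smul_right, real_inner_comm, EuclideanSpace.basisFun_inner]
  split_ifs with h
  · simpa using h
  · simpa using (not_le.1 h).le

theorem norm_le_norm_add_of_inner_nonneg {E : Type*} [NormedAddCommGroup E]
    [InnerProductSpace ℝ E] {z w : E} (h : 0 ≤ inner ℝ z w) : ‖z‖ ≤ ‖z + w‖ := by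
  have := norm_add_sq_real z w
  exact le_of_sq_le_sq (by nlinarith [sq_nonneg ‖w‖]) (norm_nonneg _)

theorem OrthonormalBasis.lintegral_eq_lintegral_lintegral
    (b : OrthonormalBasis (Fin 2) ℝ (EuclideanSpace ℝ (Fin 2)))
    {G : EuclideanSpace ℝ (Fin 2) → ℝ≥0∞} (hG : Measurable G) :
    ∫⁻ s : ℝ, ∫⁻ t : ℝ, G (s • b 0 + t • b 1) = ∫⁻ x, G x := by
  have hmp := b.measurePreserving_repr_symm.comp
    ((PiLp.volume_preserving_toLp (Fin 2)).comp (volume_preserving_finTwoArrow ℝ).symm)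
  rw [← hmp.lintegral_comp hG, Measure.volume_eq_prod,
    lintegral_prod (fun p => G ((_ ∘ _) p)) (hG.comp hmp.measurable).aemeasurable]
  refine lintegral_congr fun s => lintegral_congr fun t => congrArg G ?_
  simp [← OrthonormalBasis.sum_repr_symm, MeasurableEquiv.finTwoArrow]

/-- Pointwise bound by weighted `L²` integrals: the radial weight only grows along a suitable
quadrant with vertex `z`. -/
theorem SchwartzMap.weight_mul_enorm_sq_le (u : SchwartzMap (EuclideanSpace ℝ (Fin 2)) ℂ)
    {ω : EuclideanSpace ℝ (Fin 2) → ℝ≥0∞}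
    (hω : Measurable ω) (hmono : ∀ x y, ‖x‖ ≤ ‖y‖ → ω x ≤ ω y) (z : EuclideanSpace ℝ (Fin 2)) :
    ω z * ‖u z‖ₑ ^ 2 ≤ ∫⁻ x, ω x * (‖u x‖ₑ ^ 2 + 2 * ‖iteratedFDeriv ℝ 1 u x‖ₑ ^ 2 +
        ‖iteratedFDeriv ℝ 2 u x‖ₑ ^ 2) := by
  obtain ⟨b, hb⟩ := EuclideanSpace.exists_orthonormalBasis_inner_nonneg z
  set H : EuclideanSpace ℝ (Fin 2) → ℝ≥0∞ := fun x =>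
    ‖u x‖ₑ ^ 2 + 2 * ‖iteratedFDeriv ℝ 1 u x‖ₑ ^ 2 +
        ‖iteratedFDeriv ℝ 2 u x‖ₑ ^ 2 with hH
  have hHm : Measurable H := by
    have h1 := (u.smooth 1).continuous_iteratedFDeriv (m := 1) le_rfl
    have h2 := (u.smooth 2).continuous_iteratedFDeriv (m := 2) le_rfl
    have h0 := u.continuous
    exact ((h0.enorm.measurable.pow_const 2).add
      ((h1.enorm.measurable.pow_const 2).const_mul 2)).add (h2.enorm.measurable.pow_const 2)
  have hGm : Measurable fun x => ω x * H x := hω.mul hHm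
  calc ω z * ‖u z‖ₑ ^ 2
      ≤ ω z * ∫⁻ s in Set.Ioi (0 : ℝ), ∫⁻ t in Set.Ioi (0 : ℝ), H (z + s • b 0 + t • b 1) := by
        gcongr
        exact u.enorm_sq_le_lintegral_quadrant z (b.norm_eq_one 0) (b.norm_eq_one 1)
    _ ≤ ∫⁻ s in Set.Ioi (0 : ℝ), ω z * ∫⁻ t in Set.Ioi (0 : ℝ), H (z + s • b 0 + t • b 1) :=
        (lintegral_const_mul _ (by fun_prop)).ge
    _ ≤ ∫⁻ s in Set.Ioi (0 : ℝ), ∫⁻ t in Set.Ioi (0 : ℝ), ω z * H (z + s • b 0 + t • b 1) := by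
        gcongr with s
        exact (lintegral_const_mul _ (by fun_prop)).ge
    _ ≤ ∫⁻ s in Set.Ioi (0 : ℝ), ∫⁻ t in Set.Ioi (0 : ℝ),
          ω (z + (s • b 0 + t • b 1)) * H (z + (s • b 0 + t • b 1)) := by
        refine setLIntegral_mono' measurableSet_Ioi fun s hs =>
          setLIntegral_mono' measurableSet_Ioi fun t ht => ?_
        rw [add_assoc]
        gcongr
        refine hmono _ _ (norm_le_norm_add_of_inner_nonneg ?_)
        rw [inner_add_right, inner_smul_right, inner_smul_right]
        exact add_nonneg (mul_nonneg (le_of_lt hs) (hb 0)) (mul_nonneg (le_of_lt ht) (hb 1))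
    _ ≤ ∫⁻ s : ℝ, ∫⁻ t : ℝ,
          ω (z + (s • b 0 + t • b 1)) * H (z + (s • b 0 + t • b 1)) :=
        (setLIntegral_le_lintegral _ _).trans
          (lintegral_mono fun s => setLIntegral_le_lintegral _ _)
    _ = ∫⁻ x, ω (z + x) * H (z + x) :=
        b.lintegral_eq_lintegral_lintegral (G := fun x => ω (z + x) * H (z + x))
          (hGm.comp (measurable_const_add z))
    _ = ∫⁻ x, ω x * H x := lintegral_add_left_eq_self (fun x => ω x * H x) z

theorem eLpNorm_two_sq {X F : Type*} [MeasurableSpace X] [NormedAddCommGroup F] (μ : Measure X)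
    (f : X → F) : eLpNorm f 2 μ ^ 2 = ∫⁻ x, ‖f x‖ₑ ^ 2 ∂μ := by
  simpa using eLpNorm_nnreal_pow_eq_lintegral (f := f) (μ := μ) (p := 2) two_ne_zero

/-- Interpolation between `L²` and `L^∞` bounds. -/
theorem eLpNorm_le_of_enorm_le_of_eLpNorm_two_le {X F : Type*} [MeasurableSpace X]
    [NormedAddCommGroup F] {μ : Measure X} {f : X → F} {K : ℝ≥0∞} {q : ℝ} (hq : 2 < q)
    (hsup : ∀ x, ‖f x‖ₑ ≤ K) (h2 : eLpNorm f 2 μ ≤ K) :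
    eLpNorm f (ENNReal.ofReal q) μ ≤ K := by
  have hq0 : 0 < q := by linarith
  have hsplit : ∀ a : ℝ≥0∞, a ^ q = a ^ (q - 2) * a ^ 2 := fun a => by
    rw [← ENNReal.rpow_two, ← ENNReal.rpow_add_of_nonneg _ _ (by linarith) zero_le_two]
    congr 1; ring
  rw [eLpNorm_eq_lintegral_rpow_enorm_toReal (by simpa using hq0) ENNReal.ofReal_ne_top,
    ENNReal.toReal_ofReal hq0.le, one_div, ENNReal.rpow_inv_le_iff hq0]
  by_cases hK : K = ∞
  · simp [hK, hq0]
  calc ∫⁻ x, ‖f x‖ₑ ^ q ∂μ ≤ ∫⁻ x, K ^ (q - 2) * ‖f x‖ₑ ^ 2 ∂μ := by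
        refine lintegral_mono fun x => ?_
        rw [hsplit]
        have hqs : 0 ≤ q - 2 := by linarith
        gcongr; exact hsup x
    _ = K ^ (q - 2) * eLpNorm f 2 μ ^ 2 := by
        rw [lintegral_const_mul' _ _ (ENNReal.rpow_ne_top_of_nonneg (by linarith) hK),
          eLpNorm_two_sq]
    _ ≤ K ^ (q - 2) * K ^ 2 := by gcongr
    _ = K ^ q := (hsplit K).symm

/-- Weighted Sobolev embedding in two dimensions: the weighted `L^q` norm of a Schwartz
function, `2 < q < ∞`, is controlled by the weighted `L²` norms of the function and its
first two derivatives (equations `Lq-H2` and `insert-weight` of the paper). -/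
theorem stmt11 (α q : ℝ) (hα : α ∈ Set.Ioo (0 : ℝ) 1) (hq : 2 < q) :
    ∃ C : ℝ, 0 < C ∧
      ∀ u : SchwartzMap (EuclideanSpace ℝ (Fin 2)) ℂ,
        eLpNorm (fun x : EuclideanSpace ℝ (Fin 2) => (1 + ‖x‖) ^ α * ‖u x‖)
            (ENNReal.ofReal q) volume ≤
          ENNReal.ofReal C *
            (eLpNorm (fun x : EuclideanSpace ℝ (Fin 2) => (1 + ‖x‖) ^ α * ‖u x‖) 2 volume +
              eLpNorm (fun x : EuclideanSpace ℝ (Fin 2) =>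
                (1 + ‖x‖) ^ α * ‖iteratedFDeriv ℝ 1 (⇑u) x‖) 2 volume +
              eLpNorm (fun x : EuclideanSpace ℝ (Fin 2) =>
                (1 + ‖x‖) ^ α * ‖iteratedFDeriv ℝ 2 (⇑u) x‖) 2 volume) := by
  refine ⟨2, two_pos, fun u => ?_⟩
  obtain ⟨hα0, -⟩ := hα
  set A := eLpNorm (fun x : EuclideanSpace ℝ (Fin 2) => (1 + ‖x‖) ^ α * ‖u x‖) 2 volume with hA
  set B := eLpNorm (fun x : EuclideanSpace ℝ (Fin 2) =>
    (1 + ‖x‖) ^ α * ‖iteratedFDeriv ℝ 1 (⇑u) x‖) 2 volume with hB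
  set D := eLpNorm (fun x : EuclideanSpace ℝ (Fin 2) =>
    (1 + ‖x‖) ^ α * ‖iteratedFDeriv ℝ 2 (⇑u) x‖) 2 volume with hD
  have hwc : Continuous fun x : EuclideanSpace ℝ (Fin 2) => (1 + ‖x‖) ^ α :=
    (by fun_prop : Continuous fun x : EuclideanSpace ℝ (Fin 2) => 1 + ‖x‖).rpow_const
      fun _ => Or.inr hα0.le
  have hwm : Measurable fun x : EuclideanSpace ℝ (Fin 2) => ‖(1 + ‖x‖) ^ α‖ₑ ^ 2 :=
    hwc.enorm.measurable.pow_const 2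
  have hm1 : Continuous (iteratedFDeriv ℝ 1 u) :=
    (u.smooth 1).continuous_iteratedFDeriv (m := 1) le_rfl
  have hint : ∫⁻ x : EuclideanSpace ℝ (Fin 2), ‖(1 + ‖x‖) ^ α‖ₑ ^ 2 *
      (‖u x‖ₑ ^ 2 + 2 * ‖iteratedFDeriv ℝ 1 u x‖ₑ ^ 2 + ‖iteratedFDeriv ℝ 2 u x‖ₑ ^ 2) =
      A ^ 2 + 2 * B ^ 2 + D ^ 2 := by
    rw [hA, hB, hD, eLpNorm_two_sq, eLpNorm_two_sq, eLpNorm_two_sq]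
    simp only [enorm_mul, enorm_norm, mul_pow]
    have hf : Measurable fun x => ‖(1 + ‖x‖) ^ α‖ₑ ^ 2 * ‖u x‖ₑ ^ 2 :=
      hwm.mul (u.continuous.enorm.measurable.pow_const 2)
    have hg : Measurable fun x => ‖(1 + ‖x‖) ^ α‖ₑ ^ 2 * ‖iteratedFDeriv ℝ 1 u x‖ₑ ^ 2 :=
      hwm.mul (hm1.enorm.measurable.pow_const 2)
    rw [← lintegral_const_mul _ hg, ← lintegral_add_left hf,
      ← lintegral_add_left (by exact hf.add (hg.const_mul 2))]
    exact lintegral_congr fun x => by ring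
  rw [show ENNReal.ofReal 2 = 2 by simp]
  refine eLpNorm_le_of_enorm_le_of_eLpNorm_two_le hq (fun z => ?_) ?_
  · have h := u.weight_mul_enorm_sq_le hwm (fun x y hxy => by
      have hnn : ∀ y : EuclideanSpace ℝ (Fin 2), 0 ≤ (1 + ‖y‖) ^ α := fun y => by positivity
      rw [Real.enorm_of_nonneg (hnn x), Real.enorm_of_nonneg (hnn y)]
      gcongr) z
    rw [hint] at h
    rw [← ENNReal.pow_le_pow_left_iff two_ne_zero, enorm_mul, enorm_norm, mul_pow]
    refine h.trans ?_
    calc A ^ 2 + 2 * B ^ 2 + D ^ 2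
        ≤ A ^ 2 + 2 * B ^ 2 + D ^ 2 + (3 * A ^ 2 + 2 * B ^ 2 + 3 * D ^ 2 + 8 * (A * B) +
            8 * (A * D) + 8 * (B * D)) := le_self_add
      _ = (2 * (A + B + D)) ^ 2 := by ring
  · calc A ≤ A + (A + 2 * B + 2 * D) := le_self_add
      _ = 2 * (A + B + D) := by ring
end

section
/- Let φ : ℝ² → [0,1] be smooth, equal to 1 on the ball B(0, 3/4) and supported in B(0, 3/2), and for k ∈ ℤ set φ_k(ξ) = φ(2^{−k}ξ) − φ(2^{−k+1}ξ). There is a constant C = C(φ) such that for all integers k₁, k₂, k₃ ∈ ℤ, all signs μ, ν ∈ {+1, −1}, and for i ∈ {1, 2}, the following hold, where max and min denote max(k₁,k₂,k₃) and min(k₁,k₂,k₃): (a) ∫_{ℝ⁴} |𝓕[ (ξ₁, ξ₂) ↦ φ_{k₃}(ξ₁+ξ₂) · m_i(ξ₁, ξ₂) · φ_{k₁}(ξ₁) φ_{k₂}(ξ₂) ](z)| dz ≤ C · 2^{(k₃ + max + min)/2}; (b) ∫_{ℝ⁴} |𝓕[ (ξ₁, ξ₂) ↦ φ_{k₃}(ξ₁+ξ₂)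 · (m_i(ξ₁, ξ₂)/Φ_{μν}(ξ₁, ξ₂)) · φ_{k₁}(ξ₁) φ_{k₂}(ξ₂) ](z)| dz ≤ C · 2^{(k₃ + max)/2}. (Here each bracketed function is supported where ξ₁, ξ₂ and ξ₁+ξ₂ are all nonzero, so m_i and m_i/Φ_{μν} are well defined on its support, and it is extended by 0 elsewhere; 𝓕 is the Fourier transform on ℝ⁴ ≅ ℝ² × ℝ².) -/
open MeasureTheory Complex
open scoped RealInnerProductSpace

noncomputable section

/-- The Fourier transform on `ℝ⁴ ≅ ℝ² × ℝ²`: `𝓕F(z) = ∫ e^{−i z·ζ} F(ζ) dζ`. -/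
def FT4 (F : EuclideanSpace ℝ (Fin 2) × EuclideanSpace ℝ (Fin 2) → ℂ)
    (z : EuclideanSpace ℝ (Fin 2) × EuclideanSpace ℝ (Fin 2)) : ℂ :=
  ∫ ζ : EuclideanSpace ℝ (Fin 2) × EuclideanSpace ℝ (Fin 2),
    Complex.exp (-(Complex.I * ((⟪z.1, ζ.1⟫ + ⟪z.2, ζ.2⟫ : ℝ) : ℂ))) * F ζ

/-- The Littlewood–Paley cutoff `φ_k(ξ) = φ(2^{−k}ξ) − φ(2^{−k+1}ξ)`. -/
def LPcut (φ : EuclideanSpace ℝ (Fin 2) → ℝ) (k : ℤ) (ξ : EuclideanSpace ℝ (Fin 2)) : ℝ :=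
  φ ((2 : ℝ) ^ (-k) • ξ) - φ ((2 : ℝ) ^ (-k + 1) • ξ)

/-- The quadratic interaction multiplier
`m₁(ξ₁,ξ₂) = (‖ξ₁+ξ₂‖·‖ξ₂‖ − ⟨ξ₁+ξ₂, ξ₂⟩)/‖ξ₂‖^{1/2}` of the gravity water wave system. -/
def mGWW1 (p : EuclideanSpace ℝ (Fin 2) × EuclideanSpace ℝ (Fin 2)) : ℝ :=
  (‖p.1 + p.2‖ * ‖p.2‖ - ⟪p.1 + p.2, p.2⟫) / Real.sqrt ‖p.2‖

/-- The quadratic interaction multiplier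
`m₂(ξ₁,ξ₂) = ‖ξ₁+ξ₂‖^{1/2}·(‖ξ₁‖·‖ξ₂‖ + ⟨ξ₁, ξ₂⟩)/(‖ξ₁‖·‖ξ₂‖)^{1/2}`. -/
def mGWW2 (p : EuclideanSpace ℝ (Fin 2) × EuclideanSpace ℝ (Fin 2)) : ℝ :=
  Real.sqrt ‖p.1 + p.2‖ * (‖p.1‖ * ‖p.2‖ + ⟪p.1, p.2⟫) / Real.sqrt (‖p.1‖ * ‖p.2‖)

/-- The phase `Φ_{μν}(ξ₁,ξ₂) = ‖ξ₁+ξ₂‖^{1/2} − μ‖ξ₁‖^{1/2} − ν‖ξ₂‖^{1/2}`. -/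
def PhiGWW (μ ν : ℝ) (p : EuclideanSpace ℝ (Fin 2) × EuclideanSpace ℝ (Fin 2)) : ℝ :=
  Real.sqrt ‖p.1 + p.2‖ - μ * Real.sqrt ‖p.1‖ - ν * Real.sqrt ‖p.2‖

open Filter
open scoped ContDiff

instance isAddHaarMeasure_volume_plane_prod :
    (volume : Measure (EuclideanSpace ℝ (Fin 2) × EuclideanSpace ℝ (Fin 2))).IsAddHaarMeasure :=
  Measure.prod.instIsAddHaarMeasure _ _

/-- The rescaled duality pairing on `ℝ² × ℝ²` that turns `FT4` into a `VectorFourier` integral. -/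
def pairing4 : (EuclideanSpace ℝ (Fin 2) × EuclideanSpace ℝ (Fin 2)) →L[ℝ]
    (EuclideanSpace ℝ (Fin 2) × EuclideanSpace ℝ (Fin 2)) →L[ℝ] ℝ :=
  (2 * Real.pi)⁻¹ •
    ((innerSL ℝ).bilinearComp (ContinuousLinearMap.fst ℝ _ _) (ContinuousLinearMap.fst ℝ _ _) +
      (innerSL ℝ).bilinearComp (ContinuousLinearMap.snd ℝ _ _) (ContinuousLinearMap.snd ℝ _ _))

lemma pairing4_apply (v w : EuclideanSpace ℝ (Fin 2) × EuclideanSpace ℝ (Fin 2)) :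
    pairing4 v w = (2 * Real.pi)⁻¹ * (⟪v.1, w.1⟫ + ⟪v.2, w.2⟫) := by
  rfl

lemma FT4_eq_fourierIntegral (F : EuclideanSpace ℝ (Fin 2) × EuclideanSpace ℝ (Fin 2) → ℂ) :
    FT4 F = VectorFourier.fourierIntegral Real.fourierChar volume pairing4.toLinearMap₁₂ F := by
  ext w
  simp only [FT4, VectorFourier.fourierIntegral]
  congr 1
  ext v
  have h : pairing4.toLinearMap₁₂ v w = pairing4 v w := rfl
  rw [Circle.smul_def, Real.fourierChar_apply, smul_eq_mul, h, pairing4_apply,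
    real_inner_comm v.1, real_inner_comm v.2]
  congr 2
  push_cast
  have := Real.pi_ne_zero
  field_simp

lemma norm_FT4_le {F : EuclideanSpace ℝ (Fin 2) × EuclideanSpace ℝ (Fin 2) → ℂ}
    (hF : ContDiff ℝ ∞ F) (hc : HasCompactSupport F)
    (w : EuclideanSpace ℝ (Fin 2) × EuclideanSpace ℝ (Fin 2)) :
    ‖FT4 F w‖ ≤ 16 * (1 + (4 * Real.pi) ^ 5) *
      (∑ p ∈ Finset.range 6, ∫ v, ‖iteratedFDeriv ℝ p F v‖) * (1 + ‖w‖) ^ (-5 : ℝ) := by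
  have hint : ∀ k n : ℕ, (k : ℕ∞) ≤ (⊤ : ℕ∞) → (n : ℕ∞) ≤ (⊤ : ℕ∞) →
      Integrable (fun v ↦ ‖v‖ ^ k * ‖iteratedFDeriv ℝ n F v‖)
        (volume : Measure (EuclideanSpace ℝ (Fin 2) × EuclideanSpace ℝ (Fin 2))) := by
    intro k n _ _
    have hcont : Continuous (iteratedFDeriv ℝ n F) :=
      hF.continuous_iteratedFDeriv (by exact_mod_cast le_top)
    refine Continuous.integrable_of_hasCompactSupport (by fun_prop) ?_
    exact ((hc.iteratedFDeriv (𝕜 := ℝ) n).norm).mul_left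
  have key := fun n : ℕ =>
    VectorFourier.pow_mul_norm_iteratedFDeriv_fourierIntegral_le (μ := volume) pairing4
    (K := ⊤) (N := ⊤) hF hint (k := 0) (n := n) le_top le_top w w
  rw [← FT4_eq_fourierIntegral] at key
  set S := ∑ p ∈ Finset.range 6, ∫ v, ‖iteratedFDeriv ℝ p F v‖ with hS
  have k0 : ‖FT4 F w‖ ≤ S := by
    have h0 := key 0
    simp only [pow_zero, one_mul, norm_iteratedFDeriv_zero, mul_one, zero_add, Finset.range_one,
      Finset.singleton_product_singleton, Finset.sum_singleton] at h0
    refine h0.trans ?_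
    rw [hS, Finset.sum_range_succ']
    simp only [norm_iteratedFDeriv_zero]
    have : 0 ≤ ∑ k ∈ Finset.range 5, ∫ v, ‖iteratedFDeriv ℝ (k + 1) F v‖ :=
      Finset.sum_nonneg fun _ _ => integral_nonneg fun _ => norm_nonneg _
    linarith
  have hS0 : 0 ≤ S := (norm_nonneg _).trans k0
  have k5 : ‖w‖ ^ 5 * ‖FT4 F w‖ ≤ (4 * Real.pi) ^ 5 * S := by
    have h5 := key 5
    simp only [norm_iteratedFDeriv_zero, pow_zero, mul_one, zero_add, Finset.range_one,
      Finset.singleton_product, Finset.sum_map, Function.Embedding.coeFn_mk, one_mul,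
      Nat.cast_zero, mul_zero] at h5
    rcases eq_or_lt_of_le (norm_nonneg w) with h | h
    · rw [← h]; simp; positivity
    have hL : ‖w‖ ^ 2 * (2 * Real.pi)⁻¹ ≤ |pairing4 w w| := by
      rw [pairing4_apply, real_inner_self_eq_norm_sq, real_inner_self_eq_norm_sq, mul_comm,
        abs_of_nonneg (by positivity)]
      gcongr
      rw [Prod.norm_def]
      rcases max_cases ‖w.1‖ ‖w.2‖ with ⟨h, _⟩ | ⟨h, _⟩ <;> rw [h] <;>
        nlinarith [sq_nonneg ‖w.1‖, sq_nonneg ‖w.2‖]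
    have h6 : (‖w‖ ^ 2 * (2 * Real.pi)⁻¹) ^ 5 * ‖FT4 F w‖ ≤ ‖w‖ ^ 5 * 2 ^ 5 * S := by
      refine le_trans ?_ h5
      gcongr
    have hpi := Real.pi_pos
    have h7 : (‖w‖ ^ 2 * (2 * Real.pi)⁻¹) ^ 5 * ‖FT4 F w‖ =
        ‖w‖ ^ 5 * ((‖w‖ ^ 5 * ‖FT4 F w‖) * ((2 * Real.pi) ^ 5)⁻¹) := by
      field_simp
    rw [h7, mul_assoc (‖w‖ ^ 5) (2 ^ 5) S] at h6
    have h8 := le_of_mul_le_mul_left h6 (by positivity)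
    rw [← div_eq_mul_inv, div_le_iff₀ (by positivity)] at h8
    refine h8.trans (le_of_eq ?_)
    ring
  have hw : (1 + ‖w‖) ^ 5 ≤ 16 * (1 + ‖w‖ ^ 5) := by
    have := add_pow_le (zero_le_one' ℝ) (norm_nonneg w) 5
    norm_num at this ⊢
    exact this
  have hr : (1 + ‖w‖) ^ (-5 : ℝ) = ((1 + ‖w‖) ^ 5)⁻¹ := by
    rw [Real.rpow_neg (by positivity)]
    norm_cast
  rw [hr, ← div_eq_mul_inv, le_div_iff₀ (by positivity)]
  calc ‖FT4 F w‖ * (1 + ‖w‖) ^ 5 ≤ ‖FT4 F w‖ * (16 * (1 + ‖w‖ ^ 5)) := by gcongr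
    _ = 16 * (‖FT4 F w‖ + ‖w‖ ^ 5 * ‖FT4 F w‖) := by ring
    _ ≤ 16 * (S + (4 * Real.pi) ^ 5 * S) := by gcongr
    _ = _ := by ring

/-- A smooth family of functions supported in a fixed compact set has uniformly integrable Fourier
transforms when the parameter stays in a compact set. -/
lemma exists_integral_norm_FT4_le {P : Type*} [NormedAddCommGroup P] [NormedSpace ℝ P]
    {G : P × (EuclideanSpace ℝ (Fin 2) × EuclideanSpace ℝ (Fin 2)) → ℝ} (hG : ContDiff ℝ ∞ G)
    {K : Set P} (hK : IsCompact K)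
    {T : Set (EuclideanSpace ℝ (Fin 2) × EuclideanSpace ℝ (Fin 2))} (hT : IsCompact T)
    (hGT : ∀ p, ∀ x ∉ T, G (p, x) = 0) :
    ∃ C : ℝ, 0 < C ∧ ∀ p ∈ K, (∫ z, ‖FT4 (fun x => (G (p, x) : ℂ)) z‖) ≤ C := by
  set G' : P × (EuclideanSpace ℝ (Fin 2) × EuclideanSpace ℝ (Fin 2)) → ℂ := fun y => (G y : ℂ)
    with hG'
  have hG's : ContDiff ℝ ∞ G' := Complex.ofRealCLM.contDiff.comp hG
  have hbd : ∀ n : ℕ, ∃ B : ℝ, ∀ y ∈ K ×ˢ T, ‖iteratedFDeriv ℝ n G' y‖ ≤ B := fun n =>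
    (hK.prod hT).exists_bound_of_continuousOn
      (hG's.continuous_iteratedFDeriv (by exact_mod_cast le_top)).continuousOn
  choose B hB using hbd
  set ι := ContinuousLinearMap.inr ℝ P (EuclideanSpace ℝ (Fin 2) × EuclideanSpace ℝ (Fin 2))
  set D : ℝ := ∑ n ∈ Finset.range 6, |B n * ‖ι‖ ^ n| * volume.real T
  set A : ℝ := 16 * (1 + (4 * Real.pi) ^ 5) * D
  have hI : Integrable (fun w : EuclideanSpace ℝ (Fin 2) × EuclideanSpace ℝ (Fin 2) =>
      (1 + ‖w‖) ^ (-5 : ℝ)) := integrable_one_add_norm (by simp; norm_num)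
  refine ⟨|A * ∫ w : EuclideanSpace ℝ (Fin 2) × EuclideanSpace ℝ (Fin 2),
      (1 + ‖w‖) ^ (-5 : ℝ)| + 1, by positivity, fun p hp => ?_⟩
  have hslice : (fun x => (G (p, x) : ℂ)) = fun x => G' ((p, 0) + ι x) := by
    ext x; simp [G', ι]
  have hsm : ContDiff ℝ ∞ (fun x => (G (p, x) : ℂ)) := by
    rw [hslice]; fun_prop
  have hc : HasCompactSupport (fun x => (G (p, x) : ℂ)) :=
    HasCompactSupport.intro hT fun x hx => by simp [hGT p x hx]
  have hder : ∀ n x, ‖iteratedFDeriv ℝ n (fun x => (G (p, x) : ℂ)) x‖ ≤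
      T.indicator (fun _ => |B n * ‖ι‖ ^ n|) x := by
    intro n x
    by_cases hx : x ∈ T
    · rw [Set.indicator_of_mem hx, hslice]
      have : (fun x => G' ((p, 0) + ι x)) = (fun y => G' ((p, 0) + y)) ∘ ι := rfl
      rw [this, ι.iteratedFDeriv_comp_right (n := ∞) (by fun_prop) x (by exact_mod_cast le_top),
        iteratedFDeriv_comp_add_left]
      refine (ContinuousMultilinearMap.norm_compContinuousLinearMap_le _ _).trans ?_
      simp only [Finset.prod_const, Finset.card_univ, Fintype.card_fin]
      refine le_trans ?_ (le_abs_self _)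
      gcongr
      exact hB n _ ⟨by simpa [ι] using hp, by simpa [ι] using hx⟩
    · rw [Set.indicator_of_notMem hx]
      have : x ∉ Function.support (iteratedFDeriv ℝ n (fun x => (G (p, x) : ℂ))) := fun h =>
        hx (closure_minimal (fun y hy => by
          by_contra hyT; exact hy (by simp [hGT p y hyT])) hT.isClosed
            (support_iteratedFDeriv_subset n h))
      simp [Function.notMem_support.1 this]
  have hsum : (∑ n ∈ Finset.range 6, ∫ v, ‖iteratedFDeriv ℝ n (fun x => (G (p, x) : ℂ)) v‖) ≤ D := by
    refine Finset.sum_le_sum fun n _ => ?_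
    refine (integral_mono_of_nonneg (Eventually.of_forall fun _ => norm_nonneg _) ?_
      (Eventually.of_forall (hder n))).trans (le_of_eq ?_)
    · exact (integrable_indicator_iff hT.measurableSet).2
        (integrableOn_const hT.measure_lt_top.ne)
    · rw [integral_indicator hT.measurableSet, setIntegral_const, smul_eq_mul, mul_comm]
  calc (∫ z, ‖FT4 (fun x => (G (p, x) : ℂ)) z‖)
      ≤ ∫ z : EuclideanSpace ℝ (Fin 2) × EuclideanSpace ℝ (Fin 2),
          A * (1 + ‖z‖) ^ (-5 : ℝ) := by
        refine integral_mono_of_nonneg (Eventually.of_forall fun _ => norm_nonneg _)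
          (hI.const_mul _) (Eventually.of_forall fun z => (norm_FT4_le hsm hc z).trans ?_)
        simp only [A]
        gcongr
    _ ≤ _ := by
        rw [integral_const_mul]
        linarith [le_abs_self (A * ∫ w : EuclideanSpace ℝ (Fin 2) × EuclideanSpace ℝ (Fin 2),
          (1 + ‖w‖) ^ (-5 : ℝ))]

/-- Invariance of the `L¹` norm of the Fourier transform under linear changes of variables. -/
lemma integral_norm_FT4_comp
    (L L' : (EuclideanSpace ℝ (Fin 2) × EuclideanSpace ℝ (Fin 2)) →ₗ[ℝ]
      (EuclideanSpace ℝ (Fin 2) × EuclideanSpace ℝ (Fin 2)))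
    (hdet : |LinearMap.det L| = |LinearMap.det L'|) (h0 : LinearMap.det L ≠ 0)
    (hadj : ∀ w v, ⟪(L' w).1, v.1⟫ + ⟪(L' w).2, v.2⟫ = ⟪w.1, (L v).1⟫ + ⟪w.2, (L v).2⟫)
    (F : EuclideanSpace ℝ (Fin 2) × EuclideanSpace ℝ (Fin 2) → ℂ) :
    (∫ z, ‖FT4 (fun v => F (L v)) z‖) = ∫ z, ‖FT4 F z‖ := by
  have h0' : LinearMap.det L' ≠ 0 := by
    rw [← abs_pos, ← hdet, abs_pos]; exact h0
  have cv : ∀ (M : (EuclideanSpace ℝ (Fin 2) × EuclideanSpace ℝ (Fin 2)) →ₗ[ℝ]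
      (EuclideanSpace ℝ (Fin 2) × EuclideanSpace ℝ (Fin 2))), LinearMap.det M ≠ 0 →
      ∀ {X : Type} [NormedAddCommGroup X] [NormedSpace ℝ X]
      (g : EuclideanSpace ℝ (Fin 2) × EuclideanSpace ℝ (Fin 2) → X),
      (∫ v, g (M v)) = |(LinearMap.det M)|⁻¹ • ∫ v, g v := by
    intro M hM X _ _ g
    have e := (LinearMap.equivOfDetNeZero M hM).toContinuousLinearEquiv.toHomeomorph
      |>.measurableEmbedding.integral_map (μ := volume) g
    have e2 : ⇑(LinearMap.equivOfDetNeZero M hM).toContinuousLinearEquiv.toHomeomorph = ⇑M := rfl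
    rw [e2, Measure.map_linearMap_addHaar_eq_smul_addHaar volume hM, integral_smul_measure] at e
    rw [← e, ENNReal.toReal_ofReal (abs_nonneg _), abs_inv]
  have h1 : ∀ w, FT4 (fun v => F (L v)) (L' w) = |LinearMap.det L|⁻¹ • FT4 F w := by
    intro w
    rw [FT4, FT4, ← cv L h0]
    simp only [hadj]
  have h2 := cv L' h0' (fun z => ‖FT4 (fun v => F (L v)) z‖)
  simp only [h1, norm_smul, integral_const_mul] at h2
  rw [hdet, Real.norm_eq_abs, abs_of_nonneg (by positivity), smul_eq_mul] at h2
  exact (mul_left_cancel₀ (inv_ne_zero (abs_ne_zero.2 h0')) h2).symm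

/-- A smooth cutoff supported in the annulus `3/8 ≤ ‖x‖ ≤ 3/2`. -/
structure IsAnnular (χ : EuclideanSpace ℝ (Fin 2) → ℝ) : Prop where
  smooth : ContDiff ℝ ∞ χ
  bounds : ∀ x, χ x ≠ 0 → 3 / 8 ≤ ‖x‖ ∧ ‖x‖ ≤ 3 / 2

namespace IsAnnular

variable {χ : EuclideanSpace ℝ (Fin 2) → ℝ}

lemma bounds_of_mem_tsupport (h : IsAnnular χ) {x : EuclideanSpace ℝ (Fin 2)}
    (hx : x ∈ tsupport χ) : 3 / 8 ≤ ‖x‖ ∧ ‖x‖ ≤ 3 / 2 := by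
  have hcl : IsClosed {x : EuclideanSpace ℝ (Fin 2) | 3 / 8 ≤ ‖x‖ ∧ ‖x‖ ≤ 3 / 2} :=
    (isClosed_le continuous_const continuous_norm).inter
      (isClosed_le continuous_norm continuous_const)
  exact closure_minimal (fun y hy => h.bounds y hy) hcl hx

lemma ne_zero_of_mem_tsupport (h : IsAnnular χ) {x : EuclideanSpace ℝ (Fin 2)}
    (hx : x ∈ tsupport χ) : x ≠ 0 := by
  have := (h.bounds_of_mem_tsupport hx).1
  rintro rfl
  norm_num at this

lemma apply_zero (h : IsAnnular χ) : χ 0 = 0 := by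
  by_contra h0
  have := (h.bounds 0 h0).1
  norm_num at this

lemma comp_neg (h : IsAnnular χ) : IsAnnular fun x => χ (-x) :=
  ⟨h.smooth.comp contDiff_neg, fun x hx => by simpa using h.bounds (-x) hx⟩

end IsAnnular

/-- A function of `(s, ζ, η)` that is smooth wherever `ζ`, `η` and `η + s²ζ` are nonzero. -/
def IsRegularSymbol (H : ℝ × EuclideanSpace ℝ (Fin 2) × EuclideanSpace ℝ (Fin 2) → ℝ) : Prop :=
  ∀ s ζ η, ζ ≠ 0 → η ≠ 0 → η + s ^ 2 • ζ ≠ 0 → ContDiffAt ℝ ∞ H (s, ζ, η)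

/-- The symbol `H(s, ζ, η)` localized in `ζ`, `η` and `u² (η + s²ζ)`. -/
def localizedSymbol (χ₁ χ₂ χ₃ : EuclideanSpace ℝ (Fin 2) → ℝ)
    (H : ℝ × EuclideanSpace ℝ (Fin 2) × EuclideanSpace ℝ (Fin 2) → ℝ)
    (p : (ℝ × ℝ) × (EuclideanSpace ℝ (Fin 2) × EuclideanSpace ℝ (Fin 2))) : ℝ :=
  χ₃ (p.1.2 ^ 2 • (p.2.2 + p.1.1 ^ 2 • p.2.1)) * H (p.1.1, p.2) * (χ₁ p.2.1 * χ₂ p.2.2)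

section Localized

variable {χ₁ χ₂ χ₃ : EuclideanSpace ℝ (Fin 2) → ℝ}
  {H : ℝ × EuclideanSpace ℝ (Fin 2) × EuclideanSpace ℝ (Fin 2) → ℝ}

lemma contDiff_localizedSymbol (h₁ : IsAnnular χ₁) (h₂ : IsAnnular χ₂) (h₃ : IsAnnular χ₃)
    (hH : IsRegularSymbol H) : ContDiff ℝ ∞ (localizedSymbol χ₁ χ₂ χ₃ H) := by
  have hs₁ := h₁.smooth
  have hs₂ := h₂.smooth
  have hs₃ := h₃.smooth
  rw [contDiff_iff_contDiffAt]
  rintro ⟨⟨s, u⟩, ζ, η⟩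
  have vanish : ∀ {χ : EuclideanSpace ℝ (Fin 2) → ℝ}
      {g : (ℝ × ℝ) × (EuclideanSpace ℝ (Fin 2) × EuclideanSpace ℝ (Fin 2)) →
        EuclideanSpace ℝ (Fin 2)}, Continuous g → g ((s, u), ζ, η) ∉ tsupport χ →
      (∀ p, χ (g p) = 0 → localizedSymbol χ₁ χ₂ χ₃ H p = 0) →
      ContDiffAt ℝ ∞ (localizedSymbol χ₁ χ₂ χ₃ H) ((s, u), ζ, η) := by
    intro χ g hg hx hz
    have hev := hg.continuousAt.eventually (notMem_tsupport_iff_eventuallyEq.1 hx)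
    refine (contDiffAt_const (c := (0 : ℝ))).congr_of_eventuallyEq ?_
    filter_upwards [hev] with p hp using hz p hp
  by_cases hζ : ζ ∈ tsupport χ₁
  swap
  · exact vanish (g := fun p => p.2.1) (by fun_prop) hζ fun p hp => by simp [localizedSymbol, hp]
  by_cases hη : η ∈ tsupport χ₂
  swap
  · exact vanish (g := fun p => p.2.2) (by fun_prop) hη fun p hp => by simp [localizedSymbol, hp]
  by_cases hw : u ^ 2 • (η + s ^ 2 • ζ) ∈ tsupport χ₃
  swap
  · exact vanish (g := fun p => p.1.2 ^ 2 • (p.2.2 + p.1.1 ^ 2 • p.2.1)) (by fun_prop) hw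
      fun p hp => by simp only [localizedSymbol, hp, zero_mul]
  have hHs : ContDiffAt ℝ ∞ H (s, ζ, η) :=
    hH s ζ η (h₁.ne_zero_of_mem_tsupport hζ) (h₂.ne_zero_of_mem_tsupport hη)
      (right_ne_zero_of_smul (h₃.ne_zero_of_mem_tsupport hw))
  have hHc : ContDiffAt ℝ ∞
      (fun p : (ℝ × ℝ) × (EuclideanSpace ℝ (Fin 2) × EuclideanSpace ℝ (Fin 2)) =>
        H (p.1.1, p.2)) ((s, u), ζ, η) :=
    ContDiffAt.comp (g := H) (f := fun p : (ℝ × ℝ) ×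
      (EuclideanSpace ℝ (Fin 2) × EuclideanSpace ℝ (Fin 2)) => (p.1.1, p.2)) _ hHs (by fun_prop)
  unfold localizedSymbol
  exact ((ContDiff.contDiffAt (by fun_prop)).mul hHc).mul (ContDiff.contDiffAt (by fun_prop))

lemma exists_integral_norm_FT4_localizedSymbol_le
    (h₁ : IsAnnular χ₁) (h₂ : IsAnnular χ₂) (h₃ : IsAnnular χ₃) (hH : IsRegularSymbol H) :
    ∃ C : ℝ, 0 < C ∧ ∀ s u : ℝ, 0 ≤ s → s ≤ 1 → 0 ≤ u → s * u ≤ 1 →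
      (∫ z, ‖FT4 (fun x => (localizedSymbol χ₁ χ₂ χ₃ H ((s, u), x) : ℂ)) z‖) ≤ C ∧
      u * (∫ z, ‖FT4 (fun x => (localizedSymbol χ₁ χ₂ χ₃ H ((s, u), x) : ℂ)) z‖) ≤ C := by
  obtain ⟨C, hC, hb⟩ := exists_integral_norm_FT4_le (contDiff_localizedSymbol h₁ h₂ h₃ hH)
    (K := Set.Icc 0 1 ×ˢ Set.Icc 0 3) (isCompact_Icc.prod isCompact_Icc)
    (T := Metric.closedBall 0 (3 / 2) ×ˢ Metric.closedBall 0 (3 / 2))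
    ((isCompact_closedBall _ _).prod (isCompact_closedBall _ _)) (by
      rintro p ⟨ζ, η⟩ hx
      rw [Set.mem_prod, mem_closedBall_zero_iff, mem_closedBall_zero_iff, not_and_or] at hx
      rcases hx with hx | hx
      · have : χ₁ ζ = 0 := by
          by_contra h; exact hx (h₁.bounds _ h).2
        simp [localizedSymbol, this]
      · have : χ₂ η = 0 := by
          by_contra h; exact hx (h₂.bounds _ h).2
        simp [localizedSymbol, this])
  refine ⟨3 * C, by positivity, fun s u hs0 hs1 hu hsu => ?_⟩
  rcases le_or_gt u 3 with hu3 | hu3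
  · have := hb (s, u) ⟨⟨hs0, hs1⟩, ⟨hu, hu3⟩⟩
    refine ⟨by linarith, ?_⟩
    gcongr
  · have hz : (fun x => (localizedSymbol χ₁ χ₂ χ₃ H ((s, u), x) : ℂ)) = fun _ => 0 := by
      ext ⟨ζ, η⟩
      by_contra hne
      simp only [localizedSymbol, ofReal_eq_zero, mul_eq_zero, not_or] at hne
      obtain ⟨⟨hc3, -⟩, hc1, hc2⟩ := hne
      have b1 := (h₁.bounds _ hc1).2
      have b2 := (h₂.bounds _ hc2).1
      have b3 := (h₃.bounds _ hc3).2
      rw [norm_smul, Real.norm_eq_abs, abs_of_nonneg (by positivity)] at b3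
      have b4 : ‖η‖ ≤ ‖η + s ^ 2 • ζ‖ + s ^ 2 * ‖ζ‖ := by
        have := norm_sub_le (η + s ^ 2 • ζ) (s ^ 2 • ζ)
        rwa [add_sub_cancel_right, norm_smul, Real.norm_eq_abs, abs_of_nonneg (by positivity)]
          at this
      have b5 : (s * u) ^ 2 ≤ 1 := pow_le_one₀ (by positivity) hsu
      have b6 : u ^ 2 * ‖η‖ ≤ 3 := by
        calc u ^ 2 * ‖η‖ ≤ u ^ 2 * ‖η + s ^ 2 • ζ‖ + (s * u) ^ 2 * ‖ζ‖ := by nlinarith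
          _ ≤ 3 / 2 + 1 * (3 / 2) := by gcongr
          _ = 3 := by norm_num
      nlinarith
    rw [hz]
    simp [FT4, hC.le]

end Localized

/-- The square root `2^{k/2}` of the dyadic number `2^k`. -/
def dyadicSqrt (k : ℤ) : ℝ := (2 : ℝ) ^ ((k : ℝ) / 2)

lemma dyadicSqrt_pos (k : ℤ) : 0 < dyadicSqrt k := by unfold dyadicSqrt; positivity

lemma dyadicSqrt_add (k l : ℤ) : dyadicSqrt (k + l) = dyadicSqrt k * dyadicSqrt l := by
  simp only [dyadicSqrt]
  rw [← Real.rpow_add two_pos]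
  push_cast
  ring_nf

lemma dyadicSqrt_le {k l : ℤ} (h : k ≤ l) : dyadicSqrt k ≤ dyadicSqrt l := by
  have : (k : ℝ) ≤ l := by exact_mod_cast h
  exact Real.rpow_le_rpow_of_exponent_le one_le_two (by linarith)

lemma dyadicSqrt_sq (k : ℤ) : dyadicSqrt k ^ 2 = (2 : ℝ) ^ k := by
  rw [dyadicSqrt, ← Real.rpow_natCast, ← Real.rpow_mul two_pos.le, ← Real.rpow_intCast]
  norm_num

/-- The symbol `f` localized to the dyadic frequencies `2^{k₁}`, `2^{k₂}`, `2^{k₃}` of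
`ξ₁`, `ξ₂`, `ξ₁ + ξ₂`. -/
def dyadicSymbol (χ₁ χ₂ χ₃ : EuclideanSpace ℝ (Fin 2) → ℝ) (k₁ k₂ k₃ : ℤ)
    (f : EuclideanSpace ℝ (Fin 2) × EuclideanSpace ℝ (Fin 2) → ℝ)
    (ξ : EuclideanSpace ℝ (Fin 2) × EuclideanSpace ℝ (Fin 2)) : ℝ :=
  χ₃ ((2 : ℝ) ^ (-k₃) • (ξ.1 + ξ.2)) * f ξ *
    (χ₁ ((2 : ℝ) ^ (-k₁) • ξ.1) * χ₂ ((2 : ℝ) ^ (-k₂) • ξ.2))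

/-- The `S^∞` norm of a real symbol. -/
def symbolNorm (F : EuclideanSpace ℝ (Fin 2) × EuclideanSpace ℝ (Fin 2) → ℝ) : ℝ :=
  ∫ z, ‖FT4 (fun ξ => (F ξ : ℂ)) z‖

lemma symbolNorm_comp
    (L L' : (EuclideanSpace ℝ (Fin 2) × EuclideanSpace ℝ (Fin 2)) →ₗ[ℝ]
      (EuclideanSpace ℝ (Fin 2) × EuclideanSpace ℝ (Fin 2)))
    (hdet : |LinearMap.det L| = |LinearMap.det L'|) (h0 : LinearMap.det L ≠ 0)
    (hadj : ∀ w v, ⟪(L' w).1, v.1⟫ + ⟪(L' w).2, v.2⟫ = ⟪w.1, (L v).1⟫ + ⟪w.2, (L v).2⟫)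
    (F : EuclideanSpace ℝ (Fin 2) × EuclideanSpace ℝ (Fin 2) → ℝ) :
    symbolNorm (fun v => F (L v)) = symbolNorm F :=
  integral_norm_FT4_comp L L' hdet h0 hadj fun ξ => (F ξ : ℂ)

lemma symbolNorm_const_mul (c : ℝ) (hc : 0 ≤ c)
    (F : EuclideanSpace ℝ (Fin 2) × EuclideanSpace ℝ (Fin 2) → ℝ) :
    symbolNorm (fun v => c * F v) = c * symbolNorm F := by
  have h : ∀ z, FT4 (fun ξ => ((c * F ξ : ℝ) : ℂ)) z = c * FT4 (fun ξ => (F ξ : ℂ)) z := by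
    intro z
    rw [FT4, FT4, ← integral_const_mul]
    congr 1
    ext ζ
    push_cast
    ring
  simp only [symbolNorm, h, norm_mul, Complex.norm_real, Real.norm_eq_abs, abs_of_nonneg hc,
    integral_const_mul]

lemma abs_det_eq_one_of_involutive
    {L : (EuclideanSpace ℝ (Fin 2) × EuclideanSpace ℝ (Fin 2)) →ₗ[ℝ]
      (EuclideanSpace ℝ (Fin 2) × EuclideanSpace ℝ (Fin 2))} (hL : ∀ v, L (L v) = v) :
    |LinearMap.det L| = 1 := by
  have h : L.comp L = LinearMap.id := LinearMap.ext hL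
  have := congrArg LinearMap.det h
  rw [LinearMap.det_comp, LinearMap.det_id] at this
  rcases mul_self_eq_one_iff.1 this with h | h <;> simp [h]

lemma symbolNorm_comp_of_involutive
    (L L' : (EuclideanSpace ℝ (Fin 2) × EuclideanSpace ℝ (Fin 2)) →ₗ[ℝ]
      (EuclideanSpace ℝ (Fin 2) × EuclideanSpace ℝ (Fin 2)))
    (hL : ∀ v, L (L v) = v) (hL' : ∀ v, L' (L' v) = v)
    (hadj : ∀ w v, ⟪(L' w).1, v.1⟫ + ⟪(L' w).2, v.2⟫ = ⟪w.1, (L v).1⟫ + ⟪w.2, (L v).2⟫)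
    (F : EuclideanSpace ℝ (Fin 2) × EuclideanSpace ℝ (Fin 2) → ℝ) :
    symbolNorm (fun v => F (L v)) = symbolNorm F := by
  have h := abs_det_eq_one_of_involutive hL
  refine symbolNorm_comp L L' (h.trans (abs_det_eq_one_of_involutive hL').symm) ?_ hadj F
  rw [← abs_pos, h]
  exact one_pos

lemma symbolNorm_swap (F : EuclideanSpace ℝ (Fin 2) × EuclideanSpace ℝ (Fin 2) → ℝ) :
    symbolNorm (fun v => F (v.2, v.1)) = symbolNorm F :=
  symbolNorm_comp_of_involutive
    ((LinearMap.snd ℝ _ _).prod (LinearMap.fst ℝ _ _))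
    ((LinearMap.snd ℝ _ _).prod (LinearMap.fst ℝ _ _)) (fun _ => rfl) (fun _ => rfl)
    (fun _ _ => add_comm _ _) F

lemma symbolNorm_shear (F : EuclideanSpace ℝ (Fin 2) × EuclideanSpace ℝ (Fin 2) → ℝ) :
    symbolNorm (fun v => F (v.1 + v.2, -v.2)) = symbolNorm F :=
  symbolNorm_comp_of_involutive
    ((LinearMap.fst ℝ _ _ + LinearMap.snd ℝ _ _).prod (-LinearMap.snd ℝ _ _))
    ((LinearMap.fst ℝ _ _).prod (LinearMap.fst ℝ _ _ - LinearMap.snd ℝ _ _))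
    (fun v => by simp) (fun v => by simp)
    (fun w v => by simp [inner_add_right, inner_sub_left]; ring) F

lemma symbolNorm_smul_smul {a b : ℝ} (ha : a ≠ 0) (hb : b ≠ 0)
    (F : EuclideanSpace ℝ (Fin 2) × EuclideanSpace ℝ (Fin 2) → ℝ) :
    symbolNorm (fun v => F (a • v.1, b • v.2)) = symbolNorm F := by
  refine symbolNorm_comp
    (LinearMap.prodMap (a • LinearMap.id) (b • LinearMap.id))
    (LinearMap.prodMap (a • LinearMap.id) (b • LinearMap.id)) rfl ?_ ?_ F
  · rw [LinearMap.det_prodMap, LinearMap.det_smul, LinearMap.det_smul]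
    simp [ha, hb]
  · intro w v
    simp [inner_smul_left, inner_smul_right]

/-- Bound for a dyadic symbol whose first frequency is the smallest one. -/
lemma exists_symbolNorm_dyadicSymbol_le {χ₁ χ₂ χ₃ : EuclideanSpace ℝ (Fin 2) → ℝ}
    {H : ℝ × EuclideanSpace ℝ (Fin 2) × EuclideanSpace ℝ (Fin 2) → ℝ}
    (h₁ : IsAnnular χ₁) (h₂ : IsAnnular χ₂) (h₃ : IsAnnular χ₃) (hH : IsRegularSymbol H) :
    ∃ C : ℝ, 0 < C ∧ ∀ k₁ k₂ k₃ : ℤ, k₁ ≤ k₂ → k₁ ≤ k₃ → ∀ w : ℝ, 0 ≤ w →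
      ∀ f : EuclideanSpace ℝ (Fin 2) × EuclideanSpace ℝ (Fin 2) → ℝ,
      (∀ ζ η, ζ ≠ 0 → η ≠ 0 → η + (dyadicSqrt k₁ / dyadicSqrt k₂) ^ 2 • ζ ≠ 0 →
        f (dyadicSqrt k₁ ^ 2 • ζ, dyadicSqrt k₂ ^ 2 • η) =
          w * H (dyadicSqrt k₁ / dyadicSqrt k₂, ζ, η)) →
      symbolNorm (dyadicSymbol χ₁ χ₂ χ₃ k₁ k₂ k₃ f) ≤ C * w ∧
      dyadicSqrt k₂ * symbolNorm (dyadicSymbol χ₁ χ₂ χ₃ k₁ k₂ k₃ f) ≤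
        C * w * dyadicSqrt k₃ := by
  obtain ⟨C, hC, hb⟩ := exists_integral_norm_FT4_localizedSymbol_le h₁ h₂ h₃ hH
  refine ⟨C, hC, fun k₁ k₂ k₃ h12 h13 w hw f hf => ?_⟩
  have p₁ := dyadicSqrt_pos k₁
  have p₂ := dyadicSqrt_pos k₂
  have p₃ := dyadicSqrt_pos k₃
  set s := dyadicSqrt k₁ / dyadicSqrt k₂ with hs
  set u := dyadicSqrt k₂ / dyadicSqrt k₃ with hu
  have hF : symbolNorm (dyadicSymbol χ₁ χ₂ χ₃ k₁ k₂ k₃ f) =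
      w * symbolNorm fun x => localizedSymbol χ₁ χ₂ χ₃ H ((s, u), x) := by
    rw [← symbolNorm_const_mul w hw, ← symbolNorm_smul_smul (pow_ne_zero 2 p₁.ne')
      (pow_ne_zero 2 p₂.ne') (dyadicSymbol χ₁ χ₂ χ₃ k₁ k₂ k₃ f)]
    congr 1
    ext ⟨ζ, η⟩
    have e : ∀ (k : ℤ) (x : EuclideanSpace ℝ (Fin 2)),
        (2 : ℝ) ^ (-k) • dyadicSqrt k ^ 2 • x = x := by
      intro k x
      rw [dyadicSqrt_sq, smul_smul, ← zpow_add₀ two_ne_zero]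
      simp
    have e3 : (2 : ℝ) ^ (-k₃) • (dyadicSqrt k₁ ^ 2 • ζ + dyadicSqrt k₂ ^ 2 • η) =
        u ^ 2 • (η + s ^ 2 • ζ) := by
      rw [zpow_neg, ← dyadicSqrt_sq, smul_add, smul_add, smul_smul, smul_smul, smul_smul, add_comm,
        hs, hu]
      congr 2 <;> field_simp
    simp only [dyadicSymbol, localizedSymbol, e, e3]
    by_cases hζ : ζ = 0
    · simp [hζ, h₁.apply_zero]
    by_cases hη : η = 0
    · simp [hη, h₂.apply_zero]
    by_cases hx : η + s ^ 2 • ζ = 0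
    · simp [hx, h₃.apply_zero]
    rw [hf ζ η hζ hη hx]
    ring
  have hsu : s * u ≤ 1 := by
    rw [hs, hu, div_mul_div_cancel₀ p₂.ne']
    exact (div_le_one p₃).2 (dyadicSqrt_le h13)
  obtain ⟨b1, b2⟩ := hb s u (by positivity) ((div_le_one p₂).2 (dyadicSqrt_le h12))
    (by positivity) hsu
  rw [hF]
  refine ⟨by rw [mul_comm C]; exact mul_le_mul_of_nonneg_left b1 hw, ?_⟩
  calc dyadicSqrt k₂ * (w * symbolNorm fun x => localizedSymbol χ₁ χ₂ χ₃ H ((s, u), x))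
      = w * dyadicSqrt k₃ *
        (u * symbolNorm fun x => localizedSymbol χ₁ χ₂ χ₃ H ((s, u), x)) := by
        rw [hu]; field_simp
    _ ≤ w * dyadicSqrt k₃ * C := by gcongr; exact b2
    _ = _ := by ring

namespace IsRegularSymbol

variable {F G : ℝ × EuclideanSpace ℝ (Fin 2) × EuclideanSpace ℝ (Fin 2) → ℝ}

lemma const (c : ℝ) : IsRegularSymbol fun _ => c := fun _ _ _ _ _ _ => contDiffAt_const

lemma fst : IsRegularSymbol fun p => p.1 := fun _ _ _ _ _ _ => contDiffAt_fst

lemma add (hF : IsRegularSymbol F) (hG : IsRegularSymbol G) :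
    IsRegularSymbol fun p => F p + G p :=
  fun s ζ η h₁ h₂ h₃ => (hF s ζ η h₁ h₂ h₃).add (hG s ζ η h₁ h₂ h₃)

lemma sub (hF : IsRegularSymbol F) (hG : IsRegularSymbol G) :
    IsRegularSymbol fun p => F p - G p :=
  fun s ζ η h₁ h₂ h₃ => (hF s ζ η h₁ h₂ h₃).sub (hG s ζ η h₁ h₂ h₃)

lemma mul (hF : IsRegularSymbol F) (hG : IsRegularSymbol G) :
    IsRegularSymbol fun p => F p * G p :=
  fun s ζ η h₁ h₂ h₃ => (hF s ζ η h₁ h₂ h₃).mul (hG s ζ η h₁ h₂ h₃)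

lemma pow (hF : IsRegularSymbol F) (n : ℕ) : IsRegularSymbol fun p => F p ^ n :=
  fun s ζ η h₁ h₂ h₃ => (hF s ζ η h₁ h₂ h₃).pow n

lemma div (hF : IsRegularSymbol F) (hG : IsRegularSymbol G)
    (h0 : ∀ s ζ η, ζ ≠ 0 → η ≠ 0 → η + s ^ 2 • ζ ≠ 0 → G (s, ζ, η) ≠ 0) :
    IsRegularSymbol fun p => F p / G p :=
  fun s ζ η h₁ h₂ h₃ => (hF s ζ η h₁ h₂ h₃).div (hG s ζ η h₁ h₂ h₃) (h0 s ζ η h₁ h₂ h₃)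

end IsRegularSymbol

/-- `√‖ζ‖` as a function of `(s, ζ, η)`. -/
def rootLow (p : ℝ × EuclideanSpace ℝ (Fin 2) × EuclideanSpace ℝ (Fin 2)) : ℝ := √‖p.2.1‖

/-- `√‖η‖` as a function of `(s, ζ, η)`. -/
def rootHigh (p : ℝ × EuclideanSpace ℝ (Fin 2) × EuclideanSpace ℝ (Fin 2)) : ℝ := √‖p.2.2‖

/-- `√‖η + s²ζ‖` as a function of `(s, ζ, η)`. -/
def rootSum (p : ℝ × EuclideanSpace ℝ (Fin 2) × EuclideanSpace ℝ (Fin 2)) : ℝ :=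
  √‖p.2.2 + p.1 ^ 2 • p.2.1‖

/-- The difference quotient `(‖η + s²ζ‖ - ‖η‖) / s²`, extended smoothly to `s = 0`. -/
def normQuot (p : ℝ × EuclideanSpace ℝ (Fin 2) × EuclideanSpace ℝ (Fin 2)) : ℝ :=
  (2 * ⟪p.2.2, p.2.1⟫ + p.1 ^ 2 * ‖p.2.1‖ ^ 2) / (rootHigh p ^ 2 + rootSum p ^ 2)

lemma rootLow_pos {s : ℝ} {ζ η : EuclideanSpace ℝ (Fin 2)} (h : ζ ≠ 0) :
    0 < rootLow (s, ζ, η) := Real.sqrt_pos.2 (norm_pos_iff.2 h)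

lemma rootHigh_pos {s : ℝ} {ζ η : EuclideanSpace ℝ (Fin 2)} (h : η ≠ 0) :
    0 < rootHigh (s, ζ, η) := Real.sqrt_pos.2 (norm_pos_iff.2 h)

lemma rootSum_pos {s : ℝ} {ζ η : EuclideanSpace ℝ (Fin 2)} (h : η + s ^ 2 • ζ ≠ 0) :
    0 < rootSum (s, ζ, η) := Real.sqrt_pos.2 (norm_pos_iff.2 h)

lemma isRegularSymbol_rootLow : IsRegularSymbol rootLow := fun s ζ η h₁ _ _ =>
  (ContDiffAt.norm ℝ (f := fun p : ℝ × EuclideanSpace ℝ (Fin 2) × EuclideanSpace ℝ (Fin 2) => p.2.1)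
    (by fun_prop) h₁).sqrt (norm_ne_zero_iff.2 h₁)

lemma isRegularSymbol_rootHigh : IsRegularSymbol rootHigh := fun s ζ η _ h₂ _ =>
  (ContDiffAt.norm ℝ (f := fun p : ℝ × EuclideanSpace ℝ (Fin 2) × EuclideanSpace ℝ (Fin 2) => p.2.2)
    (by fun_prop) h₂).sqrt (norm_ne_zero_iff.2 h₂)

lemma isRegularSymbol_rootSum : IsRegularSymbol rootSum := fun s ζ η _ _ h₃ =>
  (ContDiffAt.norm ℝ (f := fun p : ℝ × EuclideanSpace ℝ (Fin 2) × EuclideanSpace ℝ (Fin 2) =>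
    p.2.2 + p.1 ^ 2 • p.2.1) (by fun_prop) h₃).sqrt (norm_ne_zero_iff.2 h₃)

lemma isRegularSymbol_normQuot : IsRegularSymbol normQuot := by
  refine IsRegularSymbol.div (fun s ζ η h₁ _ _ => ?_)
    ((isRegularSymbol_rootHigh.pow 2).add (isRegularSymbol_rootSum.pow 2))
    fun s ζ η _ h₂ _ => ?_
  · have h : ContDiffAt ℝ ∞ (fun p : ℝ × EuclideanSpace ℝ (Fin 2) × EuclideanSpace ℝ (Fin 2) =>
        ‖p.2.1‖ ^ 2) (s, ζ, η) := ContDiffAt.norm_sq ℝ (by fun_prop)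
    have h' : ContDiffAt ℝ ∞ (fun p : ℝ × EuclideanSpace ℝ (Fin 2) × EuclideanSpace ℝ (Fin 2) =>
        ⟪p.2.2, p.2.1⟫) (s, ζ, η) := ContDiffAt.inner ℝ (by fun_prop) (by fun_prop)
    exact (contDiffAt_const.mul h').add ((contDiffAt_fst.pow 2).mul h)
  · have := rootHigh_pos (s := s) (ζ := ζ) h₂
    positivity

lemma rootSum_sq_eq {s : ℝ} {ζ η : EuclideanSpace ℝ (Fin 2)} (h : η ≠ 0) :
    rootSum (s, ζ, η) ^ 2 = rootHigh (s, ζ, η) ^ 2 + s ^ 2 * normQuot (s, ζ, η) := by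
  have hp := rootHigh_pos (s := s) (ζ := ζ) h
  have e1 : rootSum (s, ζ, η) ^ 2 = ‖η + s ^ 2 • ζ‖ := Real.sq_sqrt (norm_nonneg _)
  have e2 : rootHigh (s, ζ, η) ^ 2 = ‖η‖ := Real.sq_sqrt (norm_nonneg _)
  have e3 : ‖η + s ^ 2 • ζ‖ ^ 2 = ‖η‖ ^ 2 + s ^ 2 * (2 * ⟪η, ζ⟫ + s ^ 2 * ‖ζ‖ ^ 2) := by
    rw [norm_add_sq_real, inner_smul_right, norm_smul, Real.norm_eq_abs,
      abs_of_nonneg (by positivity)]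
    ring
  have hd : rootHigh (s, ζ, η) ^ 2 + rootSum (s, ζ, η) ^ 2 ≠ 0 := by positivity
  have e4 : normQuot (s, ζ, η) * (rootHigh (s, ζ, η) ^ 2 + rootSum (s, ζ, η) ^ 2) =
      2 * ⟪η, ζ⟫ + s ^ 2 * ‖ζ‖ ^ 2 := div_mul_cancel₀ _ hd
  refine mul_right_cancel₀ hd ?_
  rw [add_mul, mul_assoc, e4, e1, e2]
  linear_combination e3

/-- The strict triangle inequality for square roots of the sides of a triangle. -/
lemma root_phase_ne_zero {x y z : ℝ} (hx : 0 < x) (hy : 0 < y) (hz : z ≠ 0)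
    (h₁ : y ^ 2 ≤ x ^ 2 + z ^ 2) (h₂ : x ^ 2 ≤ y ^ 2 + z ^ 2) (h₃ : z ^ 2 ≤ x ^ 2 + y ^ 2)
    {σ : ℝ} (hσ : σ = 1 ∨ σ = -1) : y - σ * x - z ≠ 0 := by
  intro h
  rcases hσ with rfl | rfl
  · rcases lt_or_gt_of_ne hz with hz | hz
    · have : x = y - z := by linarith
      subst this
      nlinarith [mul_pos hy (neg_pos.2 hz)]
    · have : y = x + z := by linarith
      subst this
      nlinarith [mul_pos hx hz]
  · have : z = y + x := by linarith
    subst this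
    nlinarith [mul_pos hx hy]

lemma rootSum_phase_ne_zero {s : ℝ} {ζ η : EuclideanSpace ℝ (Fin 2)} (hs : s ≠ 0) (h₁ : ζ ≠ 0)
    (h₂ : η ≠ 0) (h₃ : η + s ^ 2 • ζ ≠ 0) {σ τ : ℝ} (hσ : σ = 1 ∨ σ = -1)
    (hτ : τ = 1 ∨ τ = -1) :
    rootSum (s, ζ, η) - σ * rootHigh (s, ζ, η) - τ * s * rootLow (s, ζ, η) ≠ 0 := by
  have hx := rootHigh_pos (s := s) (ζ := ζ) h₂
  have hy := rootSum_pos h₃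
  have hz := rootLow_pos (s := s) (η := η) h₁
  have e1 : rootSum (s, ζ, η) ^ 2 = ‖η + s ^ 2 • ζ‖ := Real.sq_sqrt (norm_nonneg _)
  have e2 : rootHigh (s, ζ, η) ^ 2 = ‖η‖ := Real.sq_sqrt (norm_nonneg _)
  have e3 : (τ * s * rootLow (s, ζ, η)) ^ 2 = ‖s ^ 2 • ζ‖ := by
    have e : rootLow (s, ζ, η) ^ 2 = ‖ζ‖ := Real.sq_sqrt (norm_nonneg _)
    have hτ2 : τ ^ 2 = 1 := by rcases hτ with rfl | rfl <;> norm_num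
    rw [mul_pow, mul_pow, e, hτ2, norm_smul, Real.norm_eq_abs, abs_of_nonneg (sq_nonneg s),
      one_mul]
  have hτ0 : τ ≠ 0 := by rcases hτ with rfl | rfl <;> norm_num
  have hz0 : τ * s * rootLow (s, ζ, η) ≠ 0 := mul_ne_zero (mul_ne_zero hτ0 hs) hz.ne'
  have n1 := norm_add_le η (s ^ 2 • ζ)
  have n2 := norm_sub_le (η + s ^ 2 • ζ) (s ^ 2 • ζ)
  have n3 := norm_sub_le (η + s ^ 2 • ζ) η
  rw [add_sub_cancel_right, ← e1, ← e2, ← e3] at n2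
  rw [add_sub_cancel_left, ← e1, ← e2, ← e3, add_comm] at n3
  rw [← e1, ← e2, ← e3] at n1
  exact root_phase_ne_zero hx hy hz0 n1 n2 n3 hσ

/-- Dividing by the phase costs at most one power of `s`, uniformly as `s → 0`. -/
lemma exists_isRegularSymbol_phase {σ τ : ℝ} (hσ : σ = 1 ∨ σ = -1) (hτ : τ = 1 ∨ τ = -1) :
    ∃ R, IsRegularSymbol R ∧ ∀ s ζ η, 0 < s → ζ ≠ 0 → η ≠ 0 → η + s ^ 2 • ζ ≠ 0 →
      s / (rootSum (s, ζ, η) - σ * rootHigh (s, ζ, η) - τ * s * rootLow (s, ζ, η)) =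
        R (s, ζ, η) := by
  have hτ0 : τ ≠ 0 := by rcases hτ with rfl | rfl <;> norm_num
  rcases hσ with rfl | rfl
  · have hq : ∀ {s : ℝ} {ζ η : EuclideanSpace ℝ (Fin 2)}, η ≠ 0 → η + s ^ 2 • ζ ≠ 0 →
        rootSum (s, ζ, η) - 1 * rootHigh (s, ζ, η) - τ * s * rootLow (s, ζ, η) =
        s * (s * normQuot (s, ζ, η) / (rootHigh (s, ζ, η) + rootSum (s, ζ, η)) -
          τ * rootLow (s, ζ, η)) := by
      intro s ζ η h₂ h₃
      have hx := rootHigh_pos (s := s) (ζ := ζ) h₂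
      have hy := rootSum_pos h₃
      have := rootSum_sq_eq (s := s) (ζ := ζ) h₂
      field_simp
      linear_combination this
    refine ⟨fun p => 1 / (p.1 * normQuot p / (rootHigh p + rootSum p) - τ * rootLow p), ?_, ?_⟩
    · refine (IsRegularSymbol.const 1).div
        (((IsRegularSymbol.fst.mul isRegularSymbol_normQuot).div
          (isRegularSymbol_rootHigh.add isRegularSymbol_rootSum) ?_).sub
          ((IsRegularSymbol.const τ).mul isRegularSymbol_rootLow)) ?_
      · intro s ζ η _ h₂ h₃
        have hx := rootHigh_pos (s := s) (ζ := ζ) h₂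
        have hy := rootSum_pos h₃
        positivity
      · intro s ζ η h₁ h₂ h₃
        have hz := rootLow_pos (s := s) (η := η) h₁
        rcases eq_or_ne s 0 with rfl | hs
        · simp [hτ0, hz.ne']
        · have := rootSum_phase_ne_zero hs h₁ h₂ h₃ (Or.inl rfl) hτ
          rw [hq h₂ h₃] at this
          exact right_ne_zero_of_mul this
    · intro s ζ η hs h₁ h₂ h₃
      rw [hq h₂ h₃, div_mul_eq_div_div, div_self hs.ne']
  · refine ⟨fun p => p.1 / (rootSum p - (-1) * rootHigh p - τ * p.1 * rootLow p),
      IsRegularSymbol.fst.div ((isRegularSymbol_rootSum.sub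
        ((IsRegularSymbol.const (-1)).mul isRegularSymbol_rootHigh)).sub
        (((IsRegularSymbol.const τ).mul .fst).mul isRegularSymbol_rootLow)) ?_,
      fun _ _ _ _ _ _ _ => rfl⟩
    intro s ζ η h₁ h₂ h₃
    rcases eq_or_ne s 0 with rfl | hs
    · have hx := rootHigh_pos (s := 0) (ζ := ζ) h₂
      have hy := rootSum_pos h₃
      simp only [mul_zero, zero_mul, sub_zero]
      linarith
    · exact rootSum_phase_ne_zero hs h₁ h₂ h₃ (Or.inr rfl) hτ

/-- A function `g` of `√‖ξ₁‖`, `√‖ξ₂‖`, `√‖ξ₁ + ξ₂‖` scales like a weight times a regular symbol.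
The weight is `W` when `ξ₁` or `ξ₂` is the smallest frequency, and `W'` when `ξ₁ + ξ₂` is. -/
def HasSymbolScaling (g : ℝ → ℝ → ℝ → ℝ) (W W' : ℝ → ℝ → ℝ) : Prop :=
  ∃ hA hB hC, IsRegularSymbol hA ∧ IsRegularSymbol hB ∧ IsRegularSymbol hC ∧
    ∀ κ s ζ η, 0 < κ → 0 < s → ζ ≠ 0 → η ≠ 0 → η + s ^ 2 • ζ ≠ 0 →
      g (κ * s * rootLow (s, ζ, η)) (κ * rootHigh (s, ζ, η)) (κ * rootSum (s, ζ, η)) =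
        W κ s * hA (s, ζ, η) ∧
      g (κ * rootHigh (s, ζ, η)) (κ * s * rootLow (s, ζ, η)) (κ * rootSum (s, ζ, η)) =
        W κ s * hB (s, ζ, η) ∧
      g (κ * rootSum (s, ζ, η)) (κ * rootHigh (s, ζ, η)) (κ * s * rootLow (s, ζ, η)) =
        W' κ s * hC (s, ζ, η)

/-- The multiplier `mGWW1` in terms of `a = √‖ξ₁‖`, `b = √‖ξ₂‖`, `c = √‖ξ₁ + ξ₂‖`. -/
def rootGWW1 (a b c : ℝ) : ℝ := (a ^ 4 - (c ^ 2 - b ^ 2) ^ 2) / (2 * b)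

/-- The multiplier `mGWW2` in terms of `a = √‖ξ₁‖`, `b = √‖ξ₂‖`, `c = √‖ξ₁ + ξ₂‖`. -/
def rootGWW2 (a b c : ℝ) : ℝ := c * (c ^ 4 - (a ^ 2 - b ^ 2) ^ 2) / (2 * (a * b))

lemma sqrt_pow_four {x : ℝ} (hx : 0 ≤ x) : √x ^ 4 = x ^ 2 := by
  rw [show 4 = 2 * 2 from rfl, pow_mul, Real.sq_sqrt hx]

lemma mGWW1_eq (p : EuclideanSpace ℝ (Fin 2) × EuclideanSpace ℝ (Fin 2)) :
    mGWW1 p = rootGWW1 (√‖p.1‖) (√‖p.2‖) (√‖p.1 + p.2‖) := by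
  have h := norm_sub_sq_real (p.1 + p.2) p.2
  rw [add_sub_cancel_right] at h
  rw [rootGWW1, mGWW1, sqrt_pow_four (norm_nonneg _), Real.sq_sqrt (norm_nonneg _),
    Real.sq_sqrt (norm_nonneg _), h, ← mul_div_mul_left _ _ (two_ne_zero' ℝ)]
  ring_nf

lemma mGWW2_eq (p : EuclideanSpace ℝ (Fin 2) × EuclideanSpace ℝ (Fin 2)) :
    mGWW2 p = rootGWW2 (√‖p.1‖) (√‖p.2‖) (√‖p.1 + p.2‖) := by
  have h := norm_add_sq_real p.1 p.2
  rw [rootGWW2, mGWW2, sqrt_pow_four (norm_nonneg _), Real.sq_sqrt (norm_nonneg _),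
    Real.sq_sqrt (norm_nonneg _), h, Real.sqrt_mul (norm_nonneg _),
    ← mul_div_mul_left _ _ (two_ne_zero' ℝ)]
  ring_nf

lemma hasSymbolScaling_rootGWW1 :
    HasSymbolScaling rootGWW1 (fun κ s => κ ^ 3 * s) (fun κ s => κ ^ 3 * s ^ 2) := by
  have X := isRegularSymbol_rootHigh
  have Y := isRegularSymbol_rootSum
  have Z := isRegularSymbol_rootLow
  have Q := isRegularSymbol_normQuot
  have S := IsRegularSymbol.fst
  have T := IsRegularSymbol.const 2
  refine ⟨fun p => p.1 ^ 3 * (rootLow p ^ 4 - normQuot p ^ 2) / (2 * rootHigh p),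
    fun p => (rootLow p ^ 2 - normQuot p) *
      (rootHigh p ^ 2 + rootSum p ^ 2 - p.1 ^ 2 * rootLow p ^ 2) / (2 * rootLow p),
    fun p => (normQuot p + rootLow p ^ 2) *
      (rootHigh p ^ 2 + rootSum p ^ 2 - p.1 ^ 2 * rootLow p ^ 2) / (2 * rootHigh p),
    ((S.pow 3).mul ((Z.pow 4).sub (Q.pow 2))).div (T.mul X) fun s ζ η _ h₂ _ =>
      (mul_pos two_pos (rootHigh_pos h₂)).ne',
    (((Z.pow 2).sub Q).mul (((X.pow 2).add (Y.pow 2)).sub ((S.pow 2).mul (Z.pow 2)))).div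
      (T.mul Z) fun s ζ η h₁ _ _ => (mul_pos two_pos (rootLow_pos h₁)).ne',
    ((Q.add (Z.pow 2)).mul (((X.pow 2).add (Y.pow 2)).sub ((S.pow 2).mul (Z.pow 2)))).div
      (T.mul X) fun s ζ η _ h₂ _ => (mul_pos two_pos (rootHigh_pos h₂)).ne', ?_⟩
  intro κ s ζ η hκ hs h₁ h₂ h₃
  have hx := rootHigh_pos (s := s) (ζ := ζ) h₂
  have hy := rootSum_pos h₃
  have hz := rootLow_pos (s := s) (η := η) h₁
  have hq := rootSum_sq_eq (s := s) (ζ := ζ) h₂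
  simp only [rootGWW1]
  generalize rootHigh (s, ζ, η) = x at *
  generalize rootSum (s, ζ, η) = y at *
  generalize rootLow (s, ζ, η) = z at *
  generalize normQuot (s, ζ, η) = q at *
  refine ⟨?_, ?_, ?_⟩
  · have e : (κ * s * z) ^ 4 - ((κ * y) ^ 2 - (κ * x) ^ 2) ^ 2 =
        κ ^ 4 * s ^ 4 * (z ^ 4 - q ^ 2) := by
      rw [mul_pow κ y, hq]; ring
    rw [e]; field_simp
  · have e : (κ * x) ^ 4 - ((κ * y) ^ 2 - (κ * s * z) ^ 2) ^ 2 =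
        κ ^ 4 * s ^ 2 * ((z ^ 2 - q) * (x ^ 2 + y ^ 2 - s ^ 2 * z ^ 2)) := by
      rw [mul_pow κ y, hq]; ring
    rw [e]; field_simp
  · have e : (κ * y) ^ 4 - ((κ * s * z) ^ 2 - (κ * x) ^ 2) ^ 2 =
        κ ^ 4 * s ^ 2 * ((q + z ^ 2) * (x ^ 2 + y ^ 2 - s ^ 2 * z ^ 2)) := by
      rw [show (κ * y) ^ 4 = κ ^ 4 * (y ^ 2) ^ 2 by ring, hq]; ring
    rw [e]; field_simp

lemma hasSymbolScaling_rootGWW2 :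
    HasSymbolScaling rootGWW2 (fun κ s => κ ^ 3 * s) (fun κ s => κ ^ 3 * s ^ 2) := by
  have X := isRegularSymbol_rootHigh
  have Y := isRegularSymbol_rootSum
  have Z := isRegularSymbol_rootLow
  have Q := isRegularSymbol_normQuot
  have S := IsRegularSymbol.fst
  have T := IsRegularSymbol.const 2
  have hreg : IsRegularSymbol fun p => rootSum p * ((normQuot p + rootLow p ^ 2) *
      (rootHigh p ^ 2 + rootSum p ^ 2 - p.1 ^ 2 * rootLow p ^ 2)) /
      (2 * (rootLow p * rootHigh p)) :=
    (Y.mul ((Q.add (Z.pow 2)).mul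
      (((X.pow 2).add (Y.pow 2)).sub ((S.pow 2).mul (Z.pow 2))))).div
      (T.mul (Z.mul X)) fun s ζ η h₁ h₂ _ =>
        (mul_pos two_pos (mul_pos (rootLow_pos h₁) (rootHigh_pos h₂))).ne'
  refine ⟨_, _, fun p => p.1 ^ 3 * rootLow p * (rootLow p ^ 4 - normQuot p ^ 2) /
      (2 * (rootHigh p * rootSum p)), hreg, hreg,
    (((S.pow 3).mul Z).mul ((Z.pow 4).sub (Q.pow 2))).div (T.mul (X.mul Y)) fun s ζ η _ h₂ h₃ =>
      (mul_pos two_pos (mul_pos (rootHigh_pos h₂) (rootSum_pos h₃))).ne', ?_⟩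
  intro κ s ζ η hκ hs h₁ h₂ h₃
  have hx := rootHigh_pos (s := s) (ζ := ζ) h₂
  have hy := rootSum_pos h₃
  have hz := rootLow_pos (s := s) (η := η) h₁
  have hq := rootSum_sq_eq (s := s) (ζ := ζ) h₂
  simp only [rootGWW2]
  generalize rootHigh (s, ζ, η) = x at *
  generalize rootSum (s, ζ, η) = y at *
  generalize rootLow (s, ζ, η) = z at *
  generalize normQuot (s, ζ, η) = q at *
  have e : (κ * y) ^ 4 - ((κ * s * z) ^ 2 - (κ * x) ^ 2) ^ 2 =
      κ ^ 4 * s ^ 2 * ((q + z ^ 2) * (x ^ 2 + y ^ 2 - s ^ 2 * z ^ 2)) := by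
    rw [show (κ * y) ^ 4 = κ ^ 4 * (y ^ 2) ^ 2 by ring, hq]; ring
  refine ⟨?_, ?_, ?_⟩
  · rw [e]; field_simp
  · rw [show ((κ * x) ^ 2 - (κ * s * z) ^ 2) ^ 2 = ((κ * s * z) ^ 2 - (κ * x) ^ 2) ^ 2 by ring, e]
    field_simp
  · have e' : (κ * s * z) ^ 4 - ((κ * y) ^ 2 - (κ * x) ^ 2) ^ 2 =
        κ ^ 4 * s ^ 4 * (z ^ 4 - q ^ 2) := by
      rw [mul_pow κ y, hq]; ring
    rw [e']; field_simp

lemma HasSymbolScaling.div_phase {g : ℝ → ℝ → ℝ → ℝ}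
    (hg : HasSymbolScaling g (fun κ s => κ ^ 3 * s) (fun κ s => κ ^ 3 * s ^ 2))
    {μ ν : ℝ} (hμ : μ = 1 ∨ μ = -1) (hν : ν = 1 ∨ ν = -1) :
    HasSymbolScaling (fun a b c => g a b c / (c - μ * a - ν * b))
      (fun κ _ => κ ^ 2) (fun κ s => κ ^ 2 * s) := by
  obtain ⟨hA, hB, hC, rA, rB, rC, h⟩ := hg
  have hμν : -(μ * ν) = 1 ∨ -(μ * ν) = -1 := by
    rcases hμ with rfl | rfl <;> rcases hν with rfl | rfl <;> norm_num
  have hμ2 : μ * μ = 1 := by rcases hμ with rfl | rfl <;> norm_num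
  obtain ⟨RA, rRA, eA⟩ := exists_isRegularSymbol_phase hν hμ
  obtain ⟨RB, rRB, eB⟩ := exists_isRegularSymbol_phase hμ hν
  obtain ⟨RC, rRC, eC⟩ := exists_isRegularSymbol_phase hμν hμ
  refine ⟨fun p => hA p * RA p, fun p => hB p * RB p, fun p => -μ * (hC p * RC p),
    rA.mul rRA, rB.mul rRB, (IsRegularSymbol.const (-μ)).mul (rC.mul rRC), ?_⟩
  intro κ s ζ η hκ hs h₁ h₂ h₃
  obtain ⟨fA, fB, fC⟩ := h κ s ζ η hκ hs h₁ h₂ h₃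
  have nA := rootSum_phase_ne_zero hs.ne' h₁ h₂ h₃ hν hμ
  have nB := rootSum_phase_ne_zero hs.ne' h₁ h₂ h₃ hμ hν
  have nC := rootSum_phase_ne_zero hs.ne' h₁ h₂ h₃ hμν hμ
  simp only [fA, fB, fC, ← eA s ζ η hs h₁ h₂ h₃, ← eB s ζ η hs h₁ h₂ h₃,
    ← eC s ζ η hs h₁ h₂ h₃]
  generalize rootHigh (s, ζ, η) = x at *
  generalize rootSum (s, ζ, η) = y at *
  generalize rootLow (s, ζ, η) = z at *
  refine ⟨?_, ?_, ?_⟩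
  · rw [show κ * y - μ * (κ * s * z) - ν * (κ * x) = κ * (y - ν * x - μ * s * z) by ring]
    field_simp
  · rw [show κ * y - μ * (κ * x) - ν * (κ * s * z) = κ * (y - μ * x - ν * s * z) by ring]
    field_simp
  · have hμ0 : μ ≠ 0 := left_ne_zero_of_mul_eq_one hμ2
    have e : κ * s * z - μ * (κ * y) - ν * (κ * x) =
        κ * (-μ * (y - -(μ * ν) * x - μ * s * z)) := by
      linear_combination -(κ * (s * z - ν * x)) * hμ2
    rw [e]
    generalize y - -(μ * ν) * x - μ * s * z = D at *
    field_simp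
    linear_combination hC (s, ζ, η) * hμ2

lemma isAnnular_LPcut_zero {φ : EuclideanSpace ℝ (Fin 2) → ℝ} (hφsm : ContDiff ℝ ∞ φ)
    (hφ1 : ∀ ξ ∈ Metric.ball (0 : EuclideanSpace ℝ (Fin 2)) (3 / 4), φ ξ = 1)
    (hφs : Function.support φ ⊆ Metric.ball (0 : EuclideanSpace ℝ (Fin 2)) (3 / 2)) :
    IsAnnular (LPcut φ 0) := by
  constructor
  · unfold LPcut
    fun_prop
  · intro x hx
    have hx' : φ x - φ ((2 : ℝ) • x) ≠ 0 := by simpa [LPcut] using hx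
    have h2 : ‖(2 : ℝ) • x‖ = 2 * ‖x‖ := by rw [norm_smul]; norm_num
    constructor
    · by_contra! h
      refine hx' ?_
      rw [hφ1 x (by rw [mem_ball_zero_iff]; linarith),
        hφ1 _ (by rw [mem_ball_zero_iff, h2]; linarith), sub_self]
    · by_contra! h
      have hz : ∀ y : EuclideanSpace ℝ (Fin 2), 3 / 2 ≤ ‖y‖ → φ y = 0 := fun y hy => by
        by_contra h0
        exact hy.not_gt (mem_ball_zero_iff.1 (hφs h0))
      exact hx' (by rw [hz x h.le, hz _ (by rw [h2]; linarith), sub_self])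

lemma LPcut_eq_smul (φ : EuclideanSpace ℝ (Fin 2) → ℝ) (k : ℤ) (ξ : EuclideanSpace ℝ (Fin 2)) :
    LPcut φ k ξ = LPcut φ 0 ((2 : ℝ) ^ (-k) • ξ) := by
  simp only [LPcut, smul_smul]
  rw [zpow_add₀ two_ne_zero, mul_comm ((2 : ℝ) ^ (-k))]
  simp

lemma sqrt_norm_sq_smul {a : ℝ} (ha : 0 ≤ a) (x : EuclideanSpace ℝ (Fin 2)) :
    √‖a ^ 2 • x‖ = a * √‖x‖ := by
  rw [norm_smul, Real.norm_eq_abs, abs_of_nonneg (sq_nonneg a), Real.sqrt_mul (sq_nonneg a),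
    Real.sqrt_sq ha]

/-- The symbol `g(√‖ξ₁‖, √‖ξ₂‖, √‖ξ₁ + ξ₂‖)`. -/
def rootSymbol (g : ℝ → ℝ → ℝ → ℝ) (ξ : EuclideanSpace ℝ (Fin 2) × EuclideanSpace ℝ (Fin 2)) : ℝ :=
  g (√‖ξ.1‖) (√‖ξ.2‖) (√‖ξ.1 + ξ.2‖)

/-- Bounds for the localized symbol according to which of the three frequencies is smallest. -/
lemma HasSymbolScaling.exists_symbolNorm_le {g : ℝ → ℝ → ℝ → ℝ} {W W' : ℝ → ℝ → ℝ}
    (hg : HasSymbolScaling g W W') (hW : ∀ κ s, 0 < κ → 0 < s → 0 ≤ W κ s)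
    (hW' : ∀ κ s, 0 < κ → 0 < s → 0 ≤ W' κ s)
    {ψ : EuclideanSpace ℝ (Fin 2) → ℝ} (hψ : IsAnnular ψ) :
    ∃ C : ℝ, 0 < C ∧ ∀ k₁ k₂ k₃ : ℤ,
      (k₁ ≤ k₂ → k₁ ≤ k₃ →
        dyadicSqrt k₂ * symbolNorm (dyadicSymbol ψ ψ ψ k₁ k₂ k₃ (rootSymbol g)) ≤
          C * W (dyadicSqrt k₂) (dyadicSqrt k₁ / dyadicSqrt k₂) * dyadicSqrt k₃) ∧
      (k₂ ≤ k₁ → k₂ ≤ k₃ →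
        dyadicSqrt k₁ * symbolNorm (dyadicSymbol ψ ψ ψ k₁ k₂ k₃ (rootSymbol g)) ≤
          C * W (dyadicSqrt k₁) (dyadicSqrt k₂ / dyadicSqrt k₁) * dyadicSqrt k₃) ∧
      (k₃ ≤ k₁ → k₃ ≤ k₂ →
        symbolNorm (dyadicSymbol ψ ψ ψ k₁ k₂ k₃ (rootSymbol g)) ≤
          C * W' (dyadicSqrt k₂) (dyadicSqrt k₃ / dyadicSqrt k₂)) := by
  obtain ⟨hA, hB, hC, rA, rB, rC, h⟩ := hg
  obtain ⟨A, hA0, bA⟩ := exists_symbolNorm_dyadicSymbol_le hψ hψ hψ rA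
  obtain ⟨B, hB0, bB⟩ := exists_symbolNorm_dyadicSymbol_le hψ hψ hψ rB
  obtain ⟨D, hD0, bD⟩ := exists_symbolNorm_dyadicSymbol_le hψ hψ.comp_neg hψ rC
  have scale : ∀ k l : ℤ, dyadicSqrt l * (dyadicSqrt k / dyadicSqrt l) = dyadicSqrt k :=
    fun k l => mul_div_cancel₀ _ (dyadicSqrt_pos l).ne'
  have low : ∀ (k l : ℤ) (ζ η : EuclideanSpace ℝ (Fin 2)), √‖dyadicSqrt k ^ 2 • ζ‖ =
      dyadicSqrt l * (dyadicSqrt k / dyadicSqrt l) *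
        rootLow (dyadicSqrt k / dyadicSqrt l, ζ, η) := fun k l ζ η => by
    rw [scale, sqrt_norm_sq_smul (dyadicSqrt_pos k).le, rootLow]
  have high : ∀ (k l : ℤ) (ζ η : EuclideanSpace ℝ (Fin 2)), √‖dyadicSqrt l ^ 2 • η‖ =
      dyadicSqrt l * rootHigh (dyadicSqrt k / dyadicSqrt l, ζ, η) := fun k l ζ η => by
    rw [sqrt_norm_sq_smul (dyadicSqrt_pos l).le, rootHigh]
  have sum : ∀ (k l : ℤ) (ζ η : EuclideanSpace ℝ (Fin 2)),
      √‖dyadicSqrt k ^ 2 • ζ + dyadicSqrt l ^ 2 • η‖ =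
        dyadicSqrt l * rootSum (dyadicSqrt k / dyadicSqrt l, ζ, η) := fun k l ζ η => by
    have e : dyadicSqrt k ^ 2 • ζ + dyadicSqrt l ^ 2 • η =
        dyadicSqrt l ^ 2 • (η + (dyadicSqrt k / dyadicSqrt l) ^ 2 • ζ) := by
      rw [smul_add, smul_smul, ← mul_pow, scale, add_comm]
    rw [e, sqrt_norm_sq_smul (dyadicSqrt_pos l).le, rootSum]
  have pos : ∀ k l : ℤ, 0 < dyadicSqrt k / dyadicSqrt l := fun k l =>
    div_pos (dyadicSqrt_pos k) (dyadicSqrt_pos l)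
  have wpos : ∀ k l : ℤ, 0 ≤ W (dyadicSqrt l) (dyadicSqrt k / dyadicSqrt l) := fun k l =>
    hW _ _ (dyadicSqrt_pos l) (pos k l)
  have wpos' : ∀ k l : ℤ, 0 ≤ W' (dyadicSqrt l) (dyadicSqrt k / dyadicSqrt l) := fun k l =>
    hW' _ _ (dyadicSqrt_pos l) (pos k l)
  refine ⟨A + B + D, by positivity, fun k₁ k₂ k₃ => ⟨fun h₁ h₂ => ?_, fun h₁ h₂ => ?_,
    fun h₁ h₂ => ?_⟩⟩
  · refine (bA k₁ k₂ k₃ h₁ h₂ _ (wpos k₁ k₂) (rootSymbol g) fun ζ η n₁ n₂ n₃ => ?_).2.trans ?_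
    · have e := (h _ _ ζ η (dyadicSqrt_pos k₂) (pos k₁ k₂) n₁ n₂ n₃).1
      rw [← e]
      simp only [rootSymbol]
      rw [sum, low k₁ k₂ ζ η, high k₁ k₂ ζ η]
    · have := wpos k₁ k₂
      have := dyadicSqrt_pos k₃
      gcongr
      linarith
  · rw [← symbolNorm_swap]
    have e₀ : (fun v : EuclideanSpace ℝ (Fin 2) × EuclideanSpace ℝ (Fin 2) =>
        dyadicSymbol ψ ψ ψ k₁ k₂ k₃ (rootSymbol g) (v.2, v.1)) =
        dyadicSymbol ψ ψ ψ k₂ k₁ k₃ fun v => rootSymbol g (v.2, v.1) := by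
      ext v
      simp only [dyadicSymbol]
      rw [add_comm v.2, mul_comm (ψ _) (ψ ((2 : ℝ) ^ (-k₁) • v.2))]
    rw [e₀]
    refine (bB k₂ k₁ k₃ h₁ h₂ _ (wpos k₂ k₁) _ fun ζ η n₁ n₂ n₃ => ?_).2.trans ?_
    · have e := (h _ _ ζ η (dyadicSqrt_pos k₁) (pos k₂ k₁) n₁ n₂ n₃).2.1
      rw [← e]
      simp only [rootSymbol]
      rw [add_comm (dyadicSqrt k₁ ^ 2 • η), sum, low k₂ k₁ ζ η, high k₂ k₁ ζ η]
    · have := wpos k₂ k₁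
      have := dyadicSqrt_pos k₃
      gcongr
      linarith
  · rw [← symbolNorm_shear]
    have e₀ : (fun v : EuclideanSpace ℝ (Fin 2) × EuclideanSpace ℝ (Fin 2) =>
        dyadicSymbol ψ ψ ψ k₁ k₂ k₃ (rootSymbol g) (v.1 + v.2, -v.2)) =
        dyadicSymbol ψ (fun x => ψ (-x)) ψ k₃ k₂ k₁
          fun v => rootSymbol g (v.1 + v.2, -v.2) := by
      ext v
      simp only [dyadicSymbol, add_neg_cancel_right, smul_neg]
      ring
    rw [e₀]
    refine (bD k₃ k₂ k₁ h₂ h₁ _ (wpos' k₃ k₂) _ fun ζ η n₁ n₂ n₃ => ?_).1.trans ?_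
    · have e := (h _ _ ζ η (dyadicSqrt_pos k₂) (pos k₃ k₂) n₁ n₂ n₃).2.2
      rw [← e]
      simp only [rootSymbol, add_neg_cancel_right, norm_neg]
      rw [sum, low k₃ k₂ ζ η, high k₃ k₂ ζ η]
    · have := wpos' k₃ k₂
      gcongr
      linarith

lemma HasSymbolScaling.exists_symbolNorm_le_cubic {g : ℝ → ℝ → ℝ → ℝ}
    (hg : HasSymbolScaling g (fun κ s => κ ^ 3 * s) (fun κ s => κ ^ 3 * s ^ 2))
    {ψ : EuclideanSpace ℝ (Fin 2) → ℝ} (hψ : IsAnnular ψ) :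
    ∃ C : ℝ, 0 < C ∧ ∀ k₁ k₂ k₃ : ℤ,
      symbolNorm (dyadicSymbol ψ ψ ψ k₁ k₂ k₃ (rootSymbol g)) ≤
        C * dyadicSqrt (k₃ + max (max k₁ k₂) k₃ + min (min k₁ k₂) k₃) := by
  obtain ⟨C, hC, h⟩ := hg.exists_symbolNorm_le (fun κ s _ _ => by positivity)
    (fun κ s _ _ => by positivity) hψ
  refine ⟨C, hC, fun k₁ k₂ k₃ => ?_⟩
  obtain ⟨b₁, b₂, b₃⟩ := h k₁ k₂ k₃
  have p₁ := dyadicSqrt_pos k₁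
  have p₂ := dyadicSqrt_pos k₂
  have p₃ := dyadicSqrt_pos k₃
  have m₁ := dyadicSqrt_le ((le_max_left k₁ k₂).trans (le_max_left _ k₃))
  have m₂ := dyadicSqrt_le ((le_max_right k₁ k₂).trans (le_max_left _ k₃))
  rw [dyadicSqrt_add, dyadicSqrt_add]
  generalize symbolNorm (dyadicSymbol ψ ψ ψ k₁ k₂ k₃ (rootSymbol g)) = N at *
  rcases le_total k₁ k₂ with h₁₂ | h₁₂
  · rcases le_total k₁ k₃ with h₁₃ | h₁₃
    · rw [min_eq_left h₁₂, min_eq_left h₁₃]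
      refine le_of_mul_le_mul_left ((b₁ h₁₂ h₁₃).trans ?_) p₂
      calc _ = dyadicSqrt k₂ * (C * (dyadicSqrt k₃ * dyadicSqrt k₂ * dyadicSqrt k₁)) := by
            field_simp
        _ ≤ _ := by gcongr
    · rw [min_eq_left h₁₂, min_eq_right h₁₃]
      refine (b₃ h₁₃ (h₁₃.trans h₁₂)).trans ?_
      calc _ = C * (dyadicSqrt k₃ * dyadicSqrt k₂ * dyadicSqrt k₃) := by field_simp
        _ ≤ _ := by gcongr
  · rcases le_total k₂ k₃ with h₂₃ | h₂₃
    · rw [min_eq_right h₁₂, min_eq_left h₂₃]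
      refine le_of_mul_le_mul_left ((b₂ h₁₂ h₂₃).trans ?_) p₁
      calc _ = dyadicSqrt k₁ * (C * (dyadicSqrt k₃ * dyadicSqrt k₁ * dyadicSqrt k₂)) := by
            field_simp
        _ ≤ _ := by gcongr
    · rw [min_eq_right h₁₂, min_eq_right h₂₃]
      refine (b₃ (h₂₃.trans h₁₂) h₂₃).trans ?_
      calc _ = C * (dyadicSqrt k₃ * dyadicSqrt k₂ * dyadicSqrt k₃) := by field_simp
        _ ≤ _ := by gcongr

lemma HasSymbolScaling.exists_symbolNorm_le_quadratic {g : ℝ → ℝ → ℝ → ℝ}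
    (hg : HasSymbolScaling g (fun κ _ => κ ^ 2) (fun κ s => κ ^ 2 * s))
    {ψ : EuclideanSpace ℝ (Fin 2) → ℝ} (hψ : IsAnnular ψ) :
    ∃ C : ℝ, 0 < C ∧ ∀ k₁ k₂ k₃ : ℤ,
      symbolNorm (dyadicSymbol ψ ψ ψ k₁ k₂ k₃ (rootSymbol g)) ≤
        C * dyadicSqrt (k₃ + max (max k₁ k₂) k₃) := by
  obtain ⟨C, hC, h⟩ := hg.exists_symbolNorm_le (fun κ s _ _ => by positivity)
    (fun κ s _ _ => by positivity) hψ
  refine ⟨C, hC, fun k₁ k₂ k₃ => ?_⟩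
  obtain ⟨b₁, b₂, b₃⟩ := h k₁ k₂ k₃
  have p₁ := dyadicSqrt_pos k₁
  have p₂ := dyadicSqrt_pos k₂
  have p₃ := dyadicSqrt_pos k₃
  have m₁ := dyadicSqrt_le ((le_max_left k₁ k₂).trans (le_max_left _ k₃))
  have m₂ := dyadicSqrt_le ((le_max_right k₁ k₂).trans (le_max_left _ k₃))
  rw [dyadicSqrt_add]
  generalize symbolNorm (dyadicSymbol ψ ψ ψ k₁ k₂ k₃ (rootSymbol g)) = N at *
  have high : k₃ ≤ k₁ → k₃ ≤ k₂ → N ≤ C * (dyadicSqrt k₃ * dyadicSqrt (max (max k₁ k₂) k₃)) :=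
    fun h₁ h₂ => (b₃ h₁ h₂).trans <| by
      calc _ = C * (dyadicSqrt k₃ * dyadicSqrt k₂) := by field_simp
        _ ≤ _ := by gcongr
  rcases le_total k₁ k₂ with h₁₂ | h₁₂
  · rcases le_total k₁ k₃ with h₁₃ | h₁₃
    · refine le_of_mul_le_mul_left ((b₁ h₁₂ h₁₃).trans ?_) p₂
      calc _ = dyadicSqrt k₂ * (C * (dyadicSqrt k₃ * dyadicSqrt k₂)) := by ring
        _ ≤ _ := by gcongr
    · exact high h₁₃ (h₁₃.trans h₁₂)
  · rcases le_total k₂ k₃ with h₂₃ | h₂₃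
    · refine le_of_mul_le_mul_left ((b₂ h₁₂ h₂₃).trans ?_) p₁
      calc _ = dyadicSqrt k₁ * (C * (dyadicSqrt k₃ * dyadicSqrt k₁)) := by ring
        _ ≤ _ := by gcongr
    · exact high (h₂₃.trans h₁₂) h₂₃

lemma exists_symbolNorm_le_of_hasSymbolScaling {g : ℝ → ℝ → ℝ → ℝ}
    (hg : HasSymbolScaling g (fun κ s => κ ^ 3 * s) (fun κ s => κ ^ 3 * s ^ 2))
    {ψ : EuclideanSpace ℝ (Fin 2) → ℝ} (hψ : IsAnnular ψ) :
    ∃ C : ℝ, 0 < C ∧ ∀ k₁ k₂ k₃ : ℤ, ∀ μ ν : ℝ, (μ = 1 ∨ μ = -1) → (ν = 1 ∨ ν = -1) →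
      symbolNorm (dyadicSymbol ψ ψ ψ k₁ k₂ k₃ (rootSymbol g)) ≤
        C * dyadicSqrt (k₃ + max (max k₁ k₂) k₃ + min (min k₁ k₂) k₃) ∧
      symbolNorm (dyadicSymbol ψ ψ ψ k₁ k₂ k₃ fun ξ => rootSymbol g ξ / PhiGWW μ ν ξ) ≤
        C * dyadicSqrt (k₃ + max (max k₁ k₂) k₃) := by
  obtain ⟨A, hA, bA⟩ := hg.exists_symbolNorm_le_cubic hψ
  have hB : ∀ μ ν : ℝ, (μ = 1 ∨ μ = -1) → (ν = 1 ∨ ν = -1) → ∃ B : ℝ, 0 < B ∧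
      ∀ k₁ k₂ k₃ : ℤ,
        symbolNorm (dyadicSymbol ψ ψ ψ k₁ k₂ k₃ fun ξ => rootSymbol g ξ / PhiGWW μ ν ξ) ≤
          B * dyadicSqrt (k₃ + max (max k₁ k₂) k₃) := fun μ ν hμ hν =>
    (hg.div_phase hμ hν).exists_symbolNorm_le_quadratic hψ
  obtain ⟨B₁, hB₁, b₁⟩ := hB 1 1 (.inl rfl) (.inl rfl)
  obtain ⟨B₂, hB₂, b₂⟩ := hB 1 (-1) (.inl rfl) (.inr rfl)
  obtain ⟨B₃, hB₃, b₃⟩ := hB (-1) 1 (.inr rfl) (.inl rfl)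
  obtain ⟨B₄, hB₄, b₄⟩ := hB (-1) (-1) (.inr rfl) (.inr rfl)
  refine ⟨A + B₁ + B₂ + B₃ + B₄, by positivity, fun k₁ k₂ k₃ μ ν hμ hν => ⟨?_, ?_⟩⟩
  · refine (bA k₁ k₂ k₃).trans ?_
    have := dyadicSqrt_pos (k₃ + max (max k₁ k₂) k₃ + min (min k₁ k₂) k₃)
    gcongr
    linarith
  · have := dyadicSqrt_pos (k₃ + max (max k₁ k₂) k₃)
    rcases hμ with rfl | rfl <;> rcases hν with rfl | rfl
    · refine (b₁ k₁ k₂ k₃).trans ?_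
      gcongr
      linarith
    · refine (b₂ k₁ k₂ k₃).trans ?_
      gcongr
      linarith
    · refine (b₃ k₁ k₂ k₃).trans ?_
      gcongr
      linarith
    · refine (b₄ k₁ k₂ k₃).trans ?_
      gcongr
      linarith

/-- `S^∞` bounds for the Littlewood–Paley localized quadratic multipliers `m_i` and
`m_i/Φ_{μν}` of the gravity water wave system (Lemma `m-Soo-lem` of the paper). -/
theorem stmt13 (φ : EuclideanSpace ℝ (Fin 2) → ℝ) (hφsm : ContDiff ℝ (⊤ : ℕ∞) φ)
    (hφr : ∀ ξ, φ ξ ∈ Set.Icc (0 : ℝ) 1)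
    (hφ1 : ∀ ξ ∈ Metric.ball (0 : EuclideanSpace ℝ (Fin 2)) (3 / 4), φ ξ = 1)
    (hφs : Function.support φ ⊆ Metric.ball (0 : EuclideanSpace ℝ (Fin 2)) (3 / 2)) :
    ∃ C : ℝ, 0 < C ∧
      ∀ (k₁ k₂ k₃ : ℤ) (μ ν : ℝ), (μ = 1 ∨ μ = -1) → (ν = 1 ∨ ν = -1) →
      ∀ m : EuclideanSpace ℝ (Fin 2) × EuclideanSpace ℝ (Fin 2) → ℝ,
        (m = mGWW1 ∨ m = mGWW2) →
        (∫ z : EuclideanSpace ℝ (Fin 2) × EuclideanSpace ℝ (Fin 2),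
            ‖FT4 (fun ζ =>
              ((LPcut φ k₃ (ζ.1 + ζ.2) * m ζ * (LPcut φ k₁ ζ.1 * LPcut φ k₂ ζ.2) : ℝ) : ℂ)) z‖) ≤
          C * (2 : ℝ) ^
            (((k₃ + max (max k₁ k₂) k₃ + min (min k₁ k₂) k₃ : ℤ) : ℝ) / 2) ∧
        (∫ z : EuclideanSpace ℝ (Fin 2) × EuclideanSpace ℝ (Fin 2),
            ‖FT4 (fun ζ =>
              ((LPcut φ k₃ (ζ.1 + ζ.2) * (m ζ / PhiGWW μ ν ζ) *
                (LPcut φ k₁ ζ.1 * LPcut φ k₂ ζ.2) : ℝ) : ℂ)) z‖) ≤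
          C * (2 : ℝ) ^ (((k₃ + max (max k₁ k₂) k₃ : ℤ) : ℝ) / 2) := by
  have hψ := isAnnular_LPcut_zero hφsm hφ1 hφs
  obtain ⟨A, hA, bA⟩ := exists_symbolNorm_le_of_hasSymbolScaling hasSymbolScaling_rootGWW1 hψ
  obtain ⟨B, hB, bB⟩ := exists_symbolNorm_le_of_hasSymbolScaling hasSymbolScaling_rootGWW2 hψ
  refine ⟨A + B, by positivity, fun k₁ k₂ k₃ μ ν hμ hν m hm => ?_⟩
  simp only [LPcut_eq_smul φ k₁, LPcut_eq_smul φ k₂, LPcut_eq_smul φ k₃]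
  have p := dyadicSqrt_pos (k₃ + max (max k₁ k₂) k₃ + min (min k₁ k₂) k₃)
  have q := dyadicSqrt_pos (k₃ + max (max k₁ k₂) k₃)
  rcases hm with rfl | rfl
  · obtain ⟨b₁, b₂⟩ := bA k₁ k₂ k₃ μ ν hμ hν
    rw [show rootSymbol rootGWW1 = mGWW1 from funext fun p => (mGWW1_eq p).symm] at b₁ b₂
    exact ⟨b₁.trans (mul_le_mul_of_nonneg_right (by linarith) p.le),
      b₂.trans (mul_le_mul_of_nonneg_right (by linarith) q.le)⟩
  · obtain ⟨b₁, b₂⟩ := bB k₁ k₂ k₃ μ ν hμ hν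
    rw [show rootSymbol rootGWW2 = mGWW2 from funext fun p => (mGWW2_eq p).symm] at b₁ b₂
    exact ⟨b₁.trans (mul_le_mul_of_nonneg_right (by linarith) p.le),
      b₂.trans (mul_le_mul_of_nonneg_right (by linarith) q.le)⟩

end
end
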